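/- arXiv:0711.4486 — 2 statements merged into one kernel-verified Lean document; each statement's English description precedes it below -/
import Mathlib

section
/- Define A_{n,k} := E[(∇h(X_1)·(X_{j(1,n,k)} − X_1))²] / (2·E[|X_{j(1,n,k)} − X_1|²]). Then as n → ∞, A_{n,k} converges to (∫_Ω κ(x)^{(d−2)/d} |∇h(x)|² dx) / (2d·∫_Ω κ(x)^{(d−2)/d} dx). (Theorem 5.2 of the paper.) -/
open MeasureTheory ProbabilityTheory Filter Topology
open scoped RealInnerProductSpace

noncomputable section

/-- Euclidean space `ℝ^d`. -/
abbrev EucSp (d : ℕ) := EuclideanSpace ℝ (Fin d)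

/-- The property that `J i n k ω` is (a.s.) the index of the `k`-th nearest neighbour of
`X i ω` among `X 0 ω, …, X (n-1) ω`: it is an index `j < n`, `j ≠ i`, such that exactly
`k − 1` indices `ℓ < n`, `ℓ ≠ i`, satisfy `|X ℓ − X i| < |X j − X i|`. -/
def IsNNIndex {d : ℕ} {Ωp : Type*} [MeasureSpace Ωp]
    (X : ℕ → Ωp → EucSp d) (J : ℕ → ℕ → ℕ → Ωp → ℕ) : Prop :=
  ∀ i n k : ℕ, i < n → 1 ≤ k → k < n → ∀ᵐ ω ∂ℙ,
    J i n k ω < n ∧ J i n k ω ≠ i ∧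
      ((Finset.range n).filter fun ℓ => ℓ ≠ i ∧
        dist (X ℓ ω) (X i ω) < dist (X (J i n k ω) ω) (X i ω)).card = k - 1


/-! ### Beta weights -/

/-- Density of the Beta(`m+1`, `N+1`) distribution. -/
def betaW (N m : ℕ) (u : ℝ) : ℝ := ((N : ℝ) + m + 1) * ((N + m).choose m : ℝ) * (u ^ m * (1 - u) ^ N)

lemma betaW_cont (N m : ℕ) : Continuous (betaW N m) := by
  unfold betaW; fun_prop

lemma betaW_nonneg (N m : ℕ) {u : ℝ} (h0 : 0 ≤ u) (h1 : u ≤ 1) : 0 ≤ betaW N m u := by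
  unfold betaW
  have : 0 ≤ 1 - u := by linarith
  positivity

lemma betaW_le (N m : ℕ) {u : ℝ} (h0 : 0 ≤ u) (h1 : u ≤ 1) : betaW N m u ≤ (N : ℝ) + m + 1 := by
  have h2 : 0 ≤ 1 - u := by linarith
  have h3 : ((N + m).choose m : ℝ) * (u ^ m * (1 - u) ^ N) ≤ 1 := by
    have h4 := add_pow u (1 - u) (N + m)
    have h5 : u + (1 - u) = 1 := by ring
    rw [h5, one_pow] at h4
    have := Finset.single_le_sum (s := Finset.range (N + m + 1))
      (f := fun i => u ^ i * (1 - u) ^ (N + m - i) * ((N + m).choose i : ℝ))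
      (fun i _ => by positivity) (a := m) (Finset.mem_range.2 (by omega))
    simp only [Nat.add_sub_cancel] at this
    calc _ = u ^ m * (1 - u) ^ N * ((N + m).choose m : ℝ) := by ring
      _ ≤ _ := this
      _ = 1 := h4.symm
  unfold betaW
  rw [mul_assoc]
  exact mul_le_of_le_one_right (by positivity) h3

lemma beta_rec (N m : ℕ) :
    ((m : ℝ) + 1) * ∫ u in (0:ℝ)..1, u ^ m * (1 - u) ^ (N + 1) =
      ((N : ℝ) + 1) * ∫ u in (0:ℝ)..1, u ^ (m + 1) * (1 - u) ^ N := by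
  have hd : ∀ u ∈ Set.uIcc (0:ℝ) 1, HasDerivAt (fun u : ℝ => u ^ (m + 1) * (1 - u) ^ (N + 1))
      ((m + 1) * (u ^ m * (1 - u) ^ (N + 1)) - (N + 1) * (u ^ (m + 1) * (1 - u) ^ N)) u := by
    intro u _
    have h1 := hasDerivAt_pow (m + 1) u
    have h2 : HasDerivAt (fun u : ℝ => (1 - u) ^ (N + 1)) _ u :=
      ((hasDerivAt_id u).const_sub 1).pow (N + 1)
    refine (h1.mul h2).congr_deriv ?_
    simp
    ring
  have := intervalIntegral.integral_eq_sub_of_hasDerivAt hd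
    (Continuous.intervalIntegrable (by fun_prop) _ _)
  rw [intervalIntegral.integral_sub (Continuous.intervalIntegrable (by fun_prop) _ _)
    (Continuous.intervalIntegrable (by fun_prop) _ _), intervalIntegral.integral_const_mul,
    intervalIntegral.integral_const_mul] at this
  simp at this
  linarith

lemma betaW_int (N m : ℕ) : ∫ u in (0:ℝ)..1, betaW N m u = 1 := by
  unfold betaW
  rw [intervalIntegral.integral_const_mul]
  induction N generalizing m with
  | zero => simp; field_simp
  | succ N ih =>
    have h1 := ih (m + 1)
    have h2 := beta_rec N m
    have h3 : ((N + (m + 1)).choose (m + 1) : ℝ) * (m + 1) = ((N + 1 + m).choose m : ℝ) * (N + 1) := by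
      have := Nat.choose_succ_right_eq (N + 1 + m) m
      rw [show N + (m + 1) = N + 1 + m by ring]
      rw [show N + 1 + m - m = N + 1 by omega] at this
      exact_mod_cast this
    set I := ∫ u in (0:ℝ)..1, u ^ m * (1 - u) ^ (N + 1)
    set I' := ∫ u in (0:ℝ)..1, u ^ (m + 1) * (1 - u) ^ N
    push_cast at h1 ⊢
    have hm : (m : ℝ) + 1 ≠ 0 := by positivity
    have hI : I = (N + 1) * I' / (m + 1) := by field_simp; linarith
    rw [hI]
    have : ((N + 1 + m).choose m : ℝ) * ((N + 1) * I' / (m + 1)) = ((N + (m + 1)).choose (m + 1) : ℝ) * I' := by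
      field_simp
      linear_combination (-I') * h3
    rw [mul_assoc, this, ← mul_assoc]
    linarith

/-- uniform measure on `[0,1]` -/
def unif : Measure ℝ := volume.restrict (Set.Icc 0 1)

instance : IsProbabilityMeasure unif := ⟨by simp [unif]⟩

lemma unif_ae : ∀ᵐ u ∂unif, 0 ≤ u ∧ u ≤ 1 := by
  have := ae_restrict_mem (μ := (volume : Measure ℝ)) (s := Set.Icc (0:ℝ) 1) measurableSet_Icc
  exact this

lemma unif_integrable {f : ℝ → ℝ} (hf : Continuous f) : Integrable f unif :=
  hf.continuousOn.integrableOn_compact isCompact_Icc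

lemma betaW_unif (N m : ℕ) : ∫ u, betaW N m u ∂unif = 1 := by
  rw [unif, integral_Icc_eq_integral_Ioc, ← intervalIntegral.integral_of_le zero_le_one, betaW_int]

/-- `s`-moment of the Beta distribution. -/
def betaM (s : ℝ) (N m : ℕ) : ℝ := ∫ u, u ^ s * betaW N m u ∂unif

lemma betaM_integrable {s : ℝ} (hs : 0 ≤ s) (N m : ℕ) :
    Integrable (fun u => u ^ s * betaW N m u) unif :=
  unif_integrable ((Real.continuous_rpow_const hs).mul (betaW_cont N m))

lemma betaM_lower {s : ℝ} (hs : 0 ≤ s) (N m : ℕ) :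
    (1 / 2) * (2 * ((N : ℝ) + m + 2)) ^ (-s) ≤ betaM s N m := by
  set n : ℝ := (N : ℝ) + m + 2 with hn
  have hn0 : 0 < n := by positivity
  set a : ℝ := 1 / (2 * n) with ha
  have ha0 : 0 < a := by positivity
  have ha1 : a ≤ 1 := by
    rw [ha, div_le_one (by positivity)]
    have : (0:ℝ) ≤ N := by positivity
    have : (0:ℝ) ≤ m := by positivity
    linarith
  have hpt : ∀ᵐ u ∂unif, a ^ s * (betaW N m u - (Set.Icc 0 a).indicator (fun _ => n) u) ≤
      u ^ s * betaW N m u := by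
    filter_upwards [unif_ae] with u ⟨h0, h1⟩
    have hw := betaW_nonneg N m h0 h1
    have hw' := betaW_le N m h0 h1
    by_cases hu : u ≤ a
    · rw [Set.indicator_of_mem (show u ∈ Set.Icc 0 a from ⟨h0, hu⟩)]
      have : a ^ s * (betaW N m u - n) ≤ 0 :=
        mul_nonpos_of_nonneg_of_nonpos (by positivity) (by linarith)
      have : 0 ≤ u ^ s * betaW N m u := by positivity
      linarith
    · rw [Set.indicator_of_notMem (fun h => hu h.2), sub_zero]
      have : a ^ s ≤ u ^ s := Real.rpow_le_rpow ha0.le (not_le.1 hu).le hs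
      gcongr
  have hi1 : Integrable (betaW N m) unif := unif_integrable (betaW_cont N m)
  have hi2 : Integrable ((Set.Icc 0 a).indicator (fun _ => n)) unif :=
    (integrable_const n).indicator measurableSet_Icc
  have := integral_mono_ae ((hi1.sub hi2).const_mul (a ^ s)) (betaM_integrable hs N m) hpt
  simp only [Pi.sub_apply] at this
  rw [integral_const_mul, integral_sub hi1 hi2, betaW_unif, integral_indicator measurableSet_Icc,
    integral_const] at this
  have hv : unif.real (Set.Icc 0 a) = a := by
    rw [unif, Measure.real, Measure.restrict_apply measurableSet_Icc, Set.Icc_inter_Icc]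
    simp [ha0.le, ha1]
  rw [show (unif.restrict (Set.Icc 0 a)).real Set.univ = a by simpa using hv] at this
  rw [smul_eq_mul, show a * n = 1 / 2 by rw [ha]; field_simp] at this
  have h2 : (2 * n) ^ (-s) = a ^ s := by
    rw [ha, one_div, Real.inv_rpow (by positivity), Real.rpow_neg (by positivity)]
  rw [h2]
  unfold betaM
  linarith

lemma betaM_pos {s : ℝ} (hs : 0 ≤ s) (N m : ℕ) : 0 < betaM s N m :=
  lt_of_lt_of_le (by positivity) (betaM_lower hs N m)

lemma betaW_shift (N m : ℕ) (u : ℝ) :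
    u * betaW N m u = (((m : ℝ) + 1) / ((N : ℝ) + m + 2)) * betaW N (m + 1) u := by
  unfold betaW
  have h := Nat.add_one_mul_choose_eq (N + m) m
  have h' : ((N : ℝ) + m + 1) * ((N + m).choose m : ℝ) = ((N + (m + 1)).choose (m + 1) : ℝ) * (m + 1) := by
    exact_mod_cast h
  rw [h']
  have : (N : ℝ) + m + 2 ≠ 0 := by positivity
  push_cast
  field_simp
  ring

lemma betaW_three (N m : ℕ) :
    ∫ u, u ^ 3 * betaW N m u ∂unif ≤ ((m : ℝ) + 3) ^ 3 / ((N : ℝ) + m + 2) ^ 3 := by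
  have h : ∀ u, u ^ 3 * betaW N m u = ((((m : ℝ) + 1) / ((N : ℝ) + m + 2)) *
      (((m : ℝ) + 2) / ((N : ℝ) + m + 3)) * (((m : ℝ) + 3) / ((N : ℝ) + m + 4))) *
      betaW N (m + 3) u := by
    intro u
    have h1 := betaW_shift N m u
    have h2 := betaW_shift N (m + 1) u
    have h3 := betaW_shift N (m + 2) u
    push_cast at h2 h3
    rw [show u ^ 3 * betaW N m u = u * (u * (u * betaW N m u)) by ring, h1,
      mul_left_comm u ((_ : ℝ) / _) (betaW N (m + 1) u), h2,
      show ∀ a b c : ℝ, u * (a * (b * c)) = a * b * (u * c) by intros; ring, h3]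
    ring_nf
  simp_rw [h]
  rw [integral_const_mul, betaW_unif, mul_one]
  rw [← div_pow, pow_three, ← mul_assoc]
  gcongr <;> linarith

/-- uniform tail bound -/
lemma betaM_tail (m : ℕ) {s : ℝ} (hs : 0 ≤ s) (hs3 : s ≤ 3) : ∃ C, 0 < C ∧ ∀ N : ℕ, ∀ A : ℝ, 0 < A →
    ∫ u, (Set.Ici (A / ((N : ℝ) + m + 2))).indicator (fun u => u ^ s * betaW N m u) u ∂unif ≤
      C * A ^ (s - 3) * betaM s N m := by
  refine ⟨((m : ℝ) + 3) ^ 3 * (2 * 2 ^ s), by positivity, fun N A hA => ?_⟩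
  have hlow := betaM_lower hs N m
  set n : ℝ := (N : ℝ) + m + 2 with hn
  have hn0 : 0 < n := by positivity
  have h1 : ∫ u, (Set.Ici (A / n)).indicator (fun u => u ^ s * betaW N m u) u ∂unif ≤
      ∫ u, (A / n) ^ (s - 3) * (u ^ 3 * betaW N m u) ∂unif := by
    refine integral_mono_ae ((betaM_integrable hs N m).indicator measurableSet_Ici)
      ((unif_integrable ((continuous_pow 3).mul (betaW_cont N m))).const_mul _) ?_
    filter_upwards [unif_ae] with u ⟨h0, h1⟩
    have hw := betaW_nonneg N m h0 h1
    by_cases hu : A / n ≤ u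
    · rw [Set.indicator_of_mem (show u ∈ Set.Ici (A / n) from hu)]
      have hA0 : 0 < A / n := by positivity
      have hu0 : 0 < u := lt_of_lt_of_le hA0 hu
      have h2 : u ^ s = u ^ (s - 3) * u ^ 3 := by
        rw [← Real.rpow_natCast u 3, ← Real.rpow_add hu0]; norm_num
      have h3 : u ^ (s - 3) ≤ (A / n) ^ (s - 3) :=
        Real.rpow_le_rpow_of_nonpos hA0 hu (by linarith)
      rw [h2, mul_assoc]
      gcongr
    · rw [Set.indicator_of_notMem (show u ∉ Set.Ici (A / n) from hu)]
      positivity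
  refine h1.trans ?_
  rw [integral_const_mul]
  have h2 := betaW_three N m
  rw [← hn] at h2
  calc (A / n) ^ (s - 3) * ∫ u, u ^ 3 * betaW N m u ∂unif
      ≤ (A / n) ^ (s - 3) * (((m : ℝ) + 3) ^ 3 / n ^ 3) := by gcongr
    _ = (((m : ℝ) + 3) ^ 3 * (2 * 2 ^ s)) * A ^ (s - 3) * (1 / 2 * (2 * n) ^ (-s)) := by
        rw [Real.div_rpow hA.le hn0.le, Real.mul_rpow (by norm_num) hn0.le, Real.rpow_sub hn0,
          Real.rpow_neg hn0.le, Real.rpow_neg (by norm_num), show n ^ (3 : ℝ) = n ^ 3 by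
            exact_mod_cast Real.rpow_natCast n 3]
        have : (0:ℝ) < 2 ^ s := by positivity
        have : (0:ℝ) < n ^ s := by positivity
        field_simp
    _ ≤ _ := by gcongr

/-! ### Binomial counts and the law of the pair (point, neighbour) -/

open scoped ENNReal

lemma pi_count {ι E : Type*} [Fintype ι] [DecidableEq ι] [MeasurableSpace E] (μ : Measure E)
    [IsProbabilityMeasure μ] {B : Set E} (hB : MeasurableSet B) (m : ℕ) [DecidablePred (· ∈ B)] :
    Measure.pi (fun _ : ι => μ) {v | (Finset.univ.filter fun i => v i ∈ B).card = m} =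
      (Fintype.card ι).choose m * (μ B ^ m * μ Bᶜ ^ (Fintype.card ι - m)) := by
  have hset : {v : ι → E | (Finset.univ.filter fun i => v i ∈ B).card = m} =
      ⋃ S ∈ Finset.powersetCard m (Finset.univ : Finset ι),
        Set.pi Set.univ (fun i => if i ∈ S then B else Bᶜ) := by
    ext v
    simp only [Set.mem_ofPred_eq, Set.mem_iUnion, Finset.mem_powersetCard, Set.mem_pi, Set.mem_univ,
      true_imp_iff, exists_prop]
    constructor
    · intro h
      refine ⟨_, ⟨Finset.subset_univ _, h⟩, fun i => ?_⟩
      by_cases hi : v i ∈ B <;> simp [hi]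
    · rintro ⟨S, ⟨-, hS⟩, h⟩
      rw [← hS]
      congr 1
      ext i
      have := h i
      by_cases hi : i ∈ S <;> simp [hi] at this ⊢ <;> exact this
  rw [hset, measure_biUnion_finset]
  · have : ∀ S ∈ Finset.powersetCard m (Finset.univ : Finset ι),
        Measure.pi (fun _ : ι => μ) (Set.pi Set.univ (fun i => if i ∈ S then B else Bᶜ)) =
          μ B ^ m * μ Bᶜ ^ (Fintype.card ι - m) := by
      intro S hS
      rw [Measure.pi_pi]
      have : ∀ i, μ (if i ∈ S then B else Bᶜ) = if i ∈ S then μ B else μ Bᶜ := by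
        intro i; split_ifs <;> rfl
      simp_rw [this]
      rw [Finset.prod_ite]
      simp only [Finset.prod_const]
      have h1 : (Finset.univ.filter fun i => i ∈ S) = S := by ext; simp
      have h2 : (Finset.univ.filter fun i => i ∉ S) = Sᶜ := by ext; simp
      rw [h1, h2, Finset.card_compl, (Finset.mem_powersetCard.1 hS).2]
    rw [Finset.sum_congr rfl this]
    simp [Finset.card_powersetCard]
  · intro S hS S' hS' hne
    rw [Function.onFun, Set.disjoint_left]
    intro v hv hv'
    apply hne
    ext i
    have h1 := hv i (Set.mem_univ i)
    have h2 := hv' i (Set.mem_univ i)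
    by_cases hi : i ∈ S <;> by_cases hi' : i ∈ S' <;> simp_all
  · intro S _
    exact MeasurableSet.univ_pi fun i => by split_ifs; exacts [hB, hB.compl]

section law

variable {d : ℕ} {Ωp : Type*} [MeasureSpace Ωp] [IsProbabilityMeasure (ℙ : Measure Ωp)]

/-- mass of the open ball around `x` through `y` -/
def ballP (μ : Measure (EucSp d)) (z : EucSp d × EucSp d) : ℝ :=
  μ.real (Metric.ball z.1 (dist z.2 z.1))

lemma measurable_ball_meas (μ : Measure (EucSp d)) [IsProbabilityMeasure μ] :
    Measurable (fun z : EucSp d × EucSp d => μ (Metric.ball z.1 (dist z.2 z.1))) := by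
  have hs : MeasurableSet {q : (EucSp d × EucSp d) × EucSp d | dist q.2 q.1.1 < dist q.1.2 q.1.1} :=
    measurableSet_lt (by fun_prop) (by fun_prop)
  exact measurable_measure_prodMk_left hs

lemma measurable_ballP (μ : Measure (EucSp d)) [IsProbabilityMeasure μ] :
    Measurable (ballP μ) := (measurable_ball_meas μ).ennreal_toReal

lemma indep_law (μ : Measure (EucSp d)) [IsProbabilityMeasure μ]
    (X : ℕ → Ωp → EucSp d) (hXmeas : ∀ i, Measurable (X i)) (hiid : iIndepFun X ℙ)
    (hlaw : ∀ i, Measure.map (X i) ℙ = μ) (j : ℕ) (hj : j ≠ 0) (T : Finset ℕ) (h0 : 0 ∉ T)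
    (hjT : j ∉ T) :
    Measure.map (fun ω => ((X 0 ω, X j ω), fun i : T => X i ω)) ℙ =
      (μ.prod μ).prod (Measure.pi fun _ : T => μ) := by
  have h1 : IndepFun (X 0) (X j) ℙ := hiid.indepFun hj.symm
  have h2 : Measure.map (fun ω => (X 0 ω, X j ω)) ℙ = μ.prod μ := by
    have := (indepFun_iff_map_prod_eq_prod_map_map (hXmeas 0).aemeasurable (hXmeas j).aemeasurable).1 h1
    rw [this, hlaw, hlaw]
  have hT : iIndepFun (fun i : T => X i) ℙ := hiid.precomp Subtype.val_injective
  have h3 : Measure.map (fun ω => fun i : T => X i ω) ℙ = Measure.pi fun _ : T => μ := by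
    have := (iIndepFun_iff_map_fun_eq_pi_map (fun i : T => (hXmeas i).aemeasurable)).1 hT
    rw [this]; simp_rw [hlaw]
  have hd : Disjoint ({0, j} : Finset ℕ) T := by
    rw [Finset.disjoint_left]; intro a ha; simp at ha; rcases ha with rfl | rfl <;> assumption
  have h4 := hiid.indepFun_finset {0, j} T hd hXmeas
  have h5 : IndepFun (fun ω => (X 0 ω, X j ω)) (fun ω => fun i : T => X i ω) ℙ := by
    have hφ : Measurable (fun v : ({0, j} : Finset ℕ) → EucSp d =>
      (v ⟨0, by simp⟩, v ⟨j, by simp⟩)) := by fun_prop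
    exact h4.comp hφ measurable_id
  have := (indepFun_iff_map_prod_eq_prod_map_map
    ((hXmeas 0).prodMk (hXmeas j)).aemeasurable
    (measurable_pi_lambda _ fun i : T => hXmeas i).aemeasurable).1 h5
  rw [this, h2, h3]

open Classical in
lemma count_law (μ : Measure (EucSp d)) [IsProbabilityMeasure μ]
    (X : ℕ → Ωp → EucSp d) (hXmeas : ∀ i, Measurable (X i)) (hiid : iIndepFun X ℙ)
    (hlaw : ∀ i, Measure.map (X i) ℙ = μ) (j : ℕ) (hj : j ≠ 0) (T : Finset ℕ) (h0 : 0 ∉ T)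
    (hjT : j ∉ T) (m : ℕ) (A : Set (EucSp d × EucSp d)) (hA : MeasurableSet A) :
    ℙ {ω | (X 0 ω, X j ω) ∈ A ∧
      (T.filter fun ℓ => dist (X ℓ ω) (X 0 ω) < dist (X j ω) (X 0 ω)).card = m} =
    ∫⁻ z in A, (T.card.choose m * (μ (Metric.ball z.1 (dist z.2 z.1)) ^ m *
      μ (Metric.ball z.1 (dist z.2 z.1))ᶜ ^ (T.card - m))) ∂(μ.prod μ) := by
  have hS : MeasurableSet {q : (EucSp d × EucSp d) × (T → EucSp d) | q.1 ∈ A ∧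
      (Finset.univ.filter fun i : T => q.2 i ∈ Metric.ball q.1.1 (dist q.1.2 q.1.1)).card = m} := by
    refine (measurable_fst hA).inter ?_
    have : Measurable (fun q : (EucSp d × EucSp d) × (T → EucSp d) =>
        (Finset.univ.filter fun i : T => q.2 i ∈ Metric.ball q.1.1 (dist q.1.2 q.1.1)).card) := by
      simp_rw [Finset.card_filter]
      refine Finset.measurable_sum _ fun i _ => ?_
      refine Measurable.ite ?_ measurable_const measurable_const
      have h1 : Measurable (fun q : (EucSp d × EucSp d) × (T → EucSp d) => dist (q.2 i) q.1.1) := by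
        fun_prop
      have h2 : Measurable (fun q : (EucSp d × EucSp d) × (T → EucSp d) => dist q.1.2 q.1.1) := by
        fun_prop
      exact measurableSet_lt h1 h2
    exact this (measurableSet_singleton m)
  have hmeas : Measurable (fun ω => ((X 0 ω, X j ω), fun i : T => X i ω)) :=
    ((hXmeas 0).prodMk (hXmeas j)).prodMk (measurable_pi_lambda _ fun i : T => hXmeas i)
  have hpre : {ω | (X 0 ω, X j ω) ∈ A ∧
      (T.filter fun ℓ => dist (X ℓ ω) (X 0 ω) < dist (X j ω) (X 0 ω)).card = m} =
      (fun ω => ((X 0 ω, X j ω), fun i : T => X i ω)) ⁻¹' {q | q.1 ∈ A ∧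
      (Finset.univ.filter fun i : T => q.2 i ∈ Metric.ball q.1.1 (dist q.1.2 q.1.1)).card = m} := by
    ext ω
    simp only [Set.mem_ofPred_eq, Set.mem_preimage, Metric.mem_ball]
    have : (Finset.univ.filter fun i : T => dist (X i ω) (X 0 ω) < dist (X j ω) (X 0 ω)).card =
      (T.filter fun ℓ => dist (X ℓ ω) (X 0 ω) < dist (X j ω) (X 0 ω)).card := by
      rw [Finset.card_filter, Finset.card_filter, ← Finset.sum_coe_sort T]
    rw [this]
  rw [hpre, ← Measure.map_apply hmeas hS, indep_law μ X hXmeas hiid hlaw j hj T h0 hjT,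
    Measure.prod_apply hS, ← lintegral_indicator hA]
  congr 1
  ext z
  by_cases hz : z ∈ A
  · rw [Set.indicator_of_mem hz]
    have := pi_count (ι := T) μ (measurableSet_ball (x := z.1) (ε := dist z.2 z.1)) m
    rw [Fintype.card_coe] at this
    rw [← this]
    congr 1
    ext v
    simp [hz]
  · rw [Set.indicator_of_notMem hz]
    convert measure_empty (μ := Measure.pi fun _ : T => μ)
    ext v
    simp [hz]

lemma no_ties (μ : Measure (EucSp d)) [IsProbabilityMeasure μ]
    (hsph : ∀ x r, μ (Metric.sphere x r) = 0)
    (X : ℕ → Ωp → EucSp d) (hXmeas : ∀ i, Measurable (X i)) (hiid : iIndepFun X ℙ)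
    (hlaw : ∀ i, Measure.map (X i) ℙ = μ) (i j : ℕ) (hi : i ≠ 0) (hij : i ≠ j) :
    ∀ᵐ ω ∂(ℙ : Measure Ωp), dist (X i ω) (X 0 ω) ≠ dist (X j ω) (X 0 ω) := by
  have h := hiid.indepFun_prodMk hXmeas 0 j i hi.symm hij.symm
  have h1 := (indepFun_iff_map_prod_eq_prod_map_map
    ((hXmeas 0).prodMk (hXmeas j)).aemeasurable (hXmeas i).aemeasurable).1 h
  have hS : MeasurableSet {q : (EucSp d × EucSp d) × EucSp d | dist q.2 q.1.1 = dist q.1.2 q.1.1} :=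
    measurableSet_eq_fun (by fun_prop) (by fun_prop)
  have h2 : ℙ ((fun ω => ((X 0 ω, X j ω), X i ω)) ⁻¹'
      {q : (EucSp d × EucSp d) × EucSp d | dist q.2 q.1.1 = dist q.1.2 q.1.1}) = 0 := by
    rw [← Measure.map_apply (((hXmeas 0).prodMk (hXmeas j)).prodMk (hXmeas i)) hS, h1, hlaw i,
      Measure.prod_apply hS]
    rw [lintegral_eq_zero_iff (measurable_measure_prodMk_left hS)]
    refine Eventually.of_forall fun z => ?_
    have h3 := hsph z.1 (dist z.2 z.1)
    exact h3
  rw [ae_iff]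
  simpa using h2

lemma pair_law (μ : Measure (EucSp d)) [IsProbabilityMeasure μ]
    (hsph : ∀ x r, μ (Metric.sphere x r) = 0)
    (X : ℕ → Ωp → EucSp d) (hXmeas : ∀ i, Measurable (X i)) (hiid : iIndepFun X ℙ)
    (hlaw : ∀ i, Measure.map (X i) ℙ = μ)
    (J : ℕ → ℕ → ℕ → Ωp → ℕ) (hJmeas : ∀ i n k, Measurable (J i n k))
    (hJ : IsNNIndex X J) (N m : ℕ) :
    Measure.map (fun ω => (X 0 ω, X (J 0 (N + m + 2) (m + 1) ω) ω)) ℙ =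
      (μ.prod μ).withDensity fun z => ENNReal.ofReal (betaW N m (ballP μ z)) := by
  classical
  set n := N + m + 2 with hn
  set K := J 0 n (m + 1) with hK
  have hKm : Measurable K := hJmeas _ _ _
  have hXK : Measurable (fun ω => X (K ω) ω) := by
    have : Measurable (fun q : ℕ × Ωp => X q.1 q.2) := measurable_from_prod_countable_right hXmeas
    exact this.comp (hKm.prodMk measurable_id)
  ext A hA
  rw [Measure.map_apply ((hXmeas 0).prodMk hXK) hA, withDensity_apply _ hA]
  have hJ' := hJ 0 n (m + 1) (by omega) (by omega) (by omega)
  simp only [Nat.add_sub_cancel] at hJ'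
  rw [← hK] at hJ'
  -- a.s. characterization
  have hnt : ∀ᵐ ω ∂(ℙ : Measure Ωp), ∀ i j : ℕ, i ≠ 0 → i ≠ j →
      dist (X i ω) (X 0 ω) ≠ dist (X j ω) (X 0 ω) := by
    rw [ae_all_iff]; intro i
    rw [ae_all_iff]; intro j
    by_cases hi : i = 0
    · simp [hi]
    by_cases hij : i = j
    · simp [hij]
    filter_upwards [no_ties μ hsph X hXmeas hiid hlaw i j hi hij] with ω hω _ _ using hω
  set T : ℕ → Finset ℕ := fun j => ((Finset.range n).erase 0).erase j with hT
  set Ev : ℕ → Set Ωp := fun j => {ω | (X 0 ω, X j ω) ∈ A ∧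
      ((T j).filter fun ℓ => dist (X ℓ ω) (X 0 ω) < dist (X j ω) (X 0 ω)).card = m} with hEv
  have hTcount : ∀ j ω, ((T j).filter fun ℓ => dist (X ℓ ω) (X 0 ω) < dist (X j ω) (X 0 ω)) =
      (Finset.range n).filter fun ℓ => ℓ ≠ 0 ∧ dist (X ℓ ω) (X 0 ω) < dist (X j ω) (X 0 ω) := by
    intro j ω
    ext ℓ
    simp only [hT, Finset.mem_filter, Finset.mem_erase, Finset.mem_range]
    constructor
    · tauto
    · rintro ⟨h1, h2, h3⟩
      refine ⟨⟨?_, h2, h1⟩, h3⟩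
      rintro rfl
      exact lt_irrefl _ h3
  have hchar : ∀ᵐ ω ∂(ℙ : Measure Ωp), ∀ j ∈ (Finset.range n).erase 0, (ω ∈ Ev j ↔
      (K ω = j ∧ (X 0 ω, X (K ω) ω) ∈ A)) := by
    filter_upwards [hJ', hnt] with ω ⟨h1, h2, h3⟩ h4 j hj
    simp only [Finset.mem_erase, Finset.mem_range] at hj
    simp only [hEv, Set.mem_ofPred_eq, hTcount]
    constructor
    · rintro ⟨hA', hc⟩
      have hKj : K ω = j := by
        by_contra hne
        rcases lt_or_gt_of_ne (h4 _ j h2 hne) with hlt | hlt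
        · have : ((Finset.range n).filter fun ℓ => ℓ ≠ 0 ∧
            dist (X ℓ ω) (X 0 ω) < dist (X (K ω) ω) (X 0 ω)) ⊂
            ((Finset.range n).filter fun ℓ => ℓ ≠ 0 ∧
            dist (X ℓ ω) (X 0 ω) < dist (X j ω) (X 0 ω)) := by
            rw [Finset.ssubset_iff_of_subset]
            · refine ⟨K ω, ?_, ?_⟩
              · simp [h1, h2, hlt]
              · simp
            · intro ℓ hℓ
              simp only [Finset.mem_filter] at hℓ ⊢
              exact ⟨hℓ.1, hℓ.2.1, hℓ.2.2.trans hlt⟩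
          have := Finset.card_lt_card this
          omega
        · have : ((Finset.range n).filter fun ℓ => ℓ ≠ 0 ∧
            dist (X ℓ ω) (X 0 ω) < dist (X j ω) (X 0 ω)) ⊂
            ((Finset.range n).filter fun ℓ => ℓ ≠ 0 ∧
            dist (X ℓ ω) (X 0 ω) < dist (X (K ω) ω) (X 0 ω)) := by
            rw [Finset.ssubset_iff_of_subset]
            · refine ⟨j, ?_, ?_⟩
              · simp [hj, hlt]
              · simp
            · intro ℓ hℓ
              simp only [Finset.mem_filter] at hℓ ⊢
              exact ⟨hℓ.1, hℓ.2.1, hℓ.2.2.trans hlt⟩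
          have := Finset.card_lt_card this
          omega
      exact ⟨hKj, by rw [hKj]; exact hA'⟩
    · rintro ⟨rfl, hA'⟩
      exact ⟨hA', h3⟩
  have hsplit : ℙ ((fun ω => (X 0 ω, X (K ω) ω)) ⁻¹' A) =
      ∑ j ∈ (Finset.range n).erase 0, ℙ {ω | K ω = j ∧ (X 0 ω, X (K ω) ω) ∈ A} := by
    rw [← measure_biUnion_finset]
    · refine measure_congr ?_
      filter_upwards [hJ'] with ω ⟨h1, h2, h3⟩
      refine propext ⟨fun hω => ?_, fun hω => ?_⟩
      · refine Set.mem_biUnion (x := K ω) ?_ ⟨rfl, hω⟩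
        simp [h1, h2]
      · obtain ⟨j, hj, h⟩ := Set.mem_iUnion₂.1 hω
        exact h.2
    · intro i _ j _ hij
      rw [Function.onFun, Set.disjoint_left]
      intro ω h1 h2
      exact hij (h1.1.symm.trans h2.1)
    · intro j _
      exact (hKm (measurableSet_singleton j)).inter (((hXmeas 0).prodMk hXK) hA)
  have hterm : ∀ j ∈ (Finset.range n).erase 0, ℙ {ω | K ω = j ∧ (X 0 ω, X (K ω) ω) ∈ A} =
      ∫⁻ z in A, ((N + m).choose m * (μ (Metric.ball z.1 (dist z.2 z.1)) ^ m *
      μ (Metric.ball z.1 (dist z.2 z.1))ᶜ ^ N)) ∂(μ.prod μ) := by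
    intro j hj
    have h1 : ℙ {ω | K ω = j ∧ (X 0 ω, X (K ω) ω) ∈ A} = ℙ (Ev j) := by
      refine measure_congr ?_
      filter_upwards [hchar] with ω hω
      exact propext (hω j hj).symm
    have hcard : (T j).card = N + m := by
      rw [hT]; simp only
      rw [Finset.card_erase_of_mem hj, Finset.card_erase_of_mem (by simp [hn]), Finset.card_range, hn]
      omega
    have h2 := count_law μ X hXmeas hiid hlaw j (by simp at hj; exact hj.1) (T j)
      (by simp [hT]) (by simp [hT]) m A hA
    rw [hcard, Nat.add_sub_cancel] at h2
    rw [h1, ← h2]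
  rw [hsplit, Finset.sum_congr rfl hterm, Finset.sum_const, Finset.card_erase_of_mem (by simp [hn]),
    Finset.card_range, nsmul_eq_mul, ← lintegral_const_mul']
  swap
  · exact ENNReal.natCast_ne_top _
  refine lintegral_congr fun z => ?_
  set B := Metric.ball z.1 (dist z.2 z.1)
  have hB : μ B = ENNReal.ofReal (μ.real B) := by simp [Measure.real]
  have hBc : μ Bᶜ = ENNReal.ofReal (1 - μ.real B) := by
    rw [← probReal_compl_eq_one_sub (s := B) measurableSet_ball]; simp [Measure.real]
  have hle : μ.real B ≤ 1 := measureReal_le_one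
  have h0 : 0 ≤ 1 - μ.real B := by linarith
  rw [hB, hBc, ballP, betaW, ENNReal.ofReal_mul (by positivity), ENNReal.ofReal_mul (by positivity),
    ENNReal.ofReal_mul (by positivity), ENNReal.ofReal_pow (by positivity), ENNReal.ofReal_pow h0,
    ENNReal.ofReal_natCast, mul_assoc]
  congr 1
  rw [← ENNReal.ofReal_natCast]
  congr 1
  rw [hn, show N + m + 2 - 1 = N + m + 1 by omega]
  push_cast; ring

end law

/-! ### Probability integral transform -/

section pit

variable {d : ℕ}

lemma ballP_nonneg (μ : Measure (EucSp d)) (z : EucSp d × EucSp d) : 0 ≤ ballP μ z :=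
  measureReal_nonneg

lemma ballP_le_one (μ : Measure (EucSp d)) [IsProbabilityMeasure μ] (z : EucSp d × EucSp d) :
    ballP μ z ≤ 1 := measureReal_le_one

lemma ball_cont (μ : Measure (EucSp d)) [IsProbabilityMeasure μ]
    (hsph : ∀ x r, μ (Metric.sphere x r) = 0) (x : EucSp d) :
    Continuous (fun r => μ.real (Metric.ball x r)) := by
  rw [continuous_iff_continuousAt]
  intro r
  have h : ∀ r, μ.real (Metric.ball x r) = ∫ y, (Metric.ball x r).indicator (fun _ => (1:ℝ)) y ∂μ := by
    intro r
    rw [integral_indicator measurableSet_ball]; simp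
  simp_rw [h]
  refine continuousAt_of_dominated (bound := fun _ => 1) ?_ ?_ (integrable_const _) ?_
  · exact Eventually.of_forall fun r => (measurable_const.indicator measurableSet_ball).aestronglyMeasurable
  · refine Eventually.of_forall fun r => Eventually.of_forall fun y => ?_
    by_cases hy : y ∈ Metric.ball x r
    · simp [Set.indicator_of_mem hy]
    · simp [Set.indicator_of_notMem hy]
  · have : ∀ᵐ y ∂μ, y ∉ Metric.sphere x r := measure_eq_zero_iff_ae_notMem.1 (hsph x r)
    filter_upwards [this] with y hy
    have hne : dist y x ≠ r := hy
    rcases lt_or_gt_of_ne hne with hlt | hlt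
    · refine (continuousAt_const (y := (1:ℝ))).congr ?_
      filter_upwards [lt_mem_nhds hlt] with r' hr'
      rw [Set.indicator_of_mem (show y ∈ Metric.ball x r' from hr')]
    · refine (continuousAt_const (y := (0:ℝ))).congr ?_
      filter_upwards [gt_mem_nhds hlt] with r' hr'
      rw [Set.indicator_of_notMem (show y ∉ Metric.ball x r' from not_lt.2 (le_of_lt hr'))]

lemma ball_surj (μ : Measure (EucSp d)) [IsProbabilityMeasure μ]
    (hsph : ∀ x r, μ (Metric.sphere x r) = 0) (x : EucSp d) {t : ℝ} (h0 : 0 ≤ t) (h1 : t < 1) :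
    ∃ r, μ.real (Metric.ball x r) = t := by
  have hlim : Tendsto (fun n : ℕ => μ.real (Metric.ball x n)) atTop (𝓝 1) := by
    have := tendsto_measure_iUnion_atTop (μ := μ) (s := fun n : ℕ => Metric.ball x (n:ℝ))
      (fun a b hab => Metric.ball_subset_ball (by exact_mod_cast hab))
    rw [Metric.iUnion_ball_nat, measure_univ] at this
    have h2 := (ENNReal.tendsto_toReal ENNReal.one_ne_top).comp this
    rw [ENNReal.toReal_one] at h2
    exact h2
  obtain ⟨n, hn⟩ := (hlim.eventually (lt_mem_nhds h1)).exists
  have := intermediate_value_Icc (a := (0:ℝ)) (b := n) (by positivity)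
    (ball_cont μ hsph x).continuousOn
  obtain ⟨r, -, hr⟩ := this ⟨by simpa using h0, hn.le⟩
  exact ⟨r, hr⟩

lemma pit (μ : Measure (EucSp d)) [IsProbabilityMeasure μ]
    (hsph : ∀ x r, μ (Metric.sphere x r) = 0) (x : EucSp d) :
    Measure.map (fun y => ballP μ (x, y)) μ = unif := by
  have hm : Measurable (fun y => ballP μ (x, y)) :=
    (measurable_ballP μ).comp measurable_prodMk_left
  have : IsProbabilityMeasure (Measure.map (fun y => ballP μ (x, y)) μ) :=
    Measure.isProbabilityMeasure_map hm.aemeasurable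
  refine Measure.ext_of_Iic _ _ fun t => ?_
  rw [Measure.map_apply hm measurableSet_Iic]
  have hu : unif (Set.Iic t) = ENNReal.ofReal (min 1 t) := by
    rw [unif, Measure.restrict_apply measurableSet_Iic, 
      show Set.Iic t ∩ Set.Icc 0 1 = Set.Icc 0 (min 1 t) by ext; simp; tauto,
      Real.volume_Icc, sub_zero]
  rw [hu]
  have hset : (fun y => ballP μ (x, y)) ⁻¹' Set.Iic t = {y | μ.real (Metric.ball x (dist y x)) ≤ t} := rfl
  rcases lt_or_ge t 0 with ht0 | ht0
  · rw [ENNReal.ofReal_of_nonpos ((min_le_right _ _).trans ht0.le), hset]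
    convert measure_empty (μ := μ)
    ext y
    simp only [Set.mem_ofPred_eq, Set.mem_empty_iff_false, iff_false, not_le]
    exact lt_of_lt_of_le ht0 measureReal_nonneg
  rcases le_or_gt 1 t with ht1 | ht1
  · rw [min_eq_left ht1, ENNReal.ofReal_one, hset]
    convert measure_univ (μ := μ)
    ext y
    simp only [Set.mem_ofPred_eq, Set.mem_univ, iff_true]
    exact measureReal_le_one.trans ht1
  rw [min_eq_right ht1.le, hset]
  apply le_antisymm
  · have key : ∀ t', t < t' → t' < 1 →
        μ {y | μ.real (Metric.ball x (dist y x)) ≤ t} ≤ ENNReal.ofReal t' := by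
      intro t' h1 h2
      obtain ⟨r, hr⟩ := ball_surj μ hsph x (ht0.trans h1.le) h2
      rw [← hr, ofReal_measureReal]
      refine measure_mono fun y hy => ?_
      by_contra hny
      have hle : r ≤ dist y x := not_lt.1 hny
      have : μ.real (Metric.ball x r) ≤ μ.real (Metric.ball x (dist y x)) :=
        measureReal_mono (Metric.ball_subset_ball hle)
      have hy' : μ.real (Metric.ball x (dist y x)) ≤ t := hy
      linarith
    have hlim : Tendsto (fun t' => ENNReal.ofReal t') (𝓝[>] t) (𝓝 (ENNReal.ofReal t)) :=
      (ENNReal.continuous_ofReal.tendsto t).mono_left nhdsWithin_le_nhds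
    refine ge_of_tendsto hlim ?_
    filter_upwards [Ioo_mem_nhdsGT ht1] with t' ht' using key t' ht'.1 ht'.2
  · obtain ⟨r, hr⟩ := ball_surj μ hsph x ht0 ht1
    rw [← hr, ofReal_measureReal]
    refine measure_mono fun y hy => ?_
    exact measureReal_mono (Metric.ball_subset_ball (le_of_lt hy))

lemma pit_integral (μ : Measure (EucSp d)) [IsProbabilityMeasure μ]
    (hsph : ∀ x r, μ (Metric.sphere x r) = 0) (x : EucSp d) {f : ℝ → ℝ} (hf : Measurable f) :
    ∫ y, f (ballP μ (x, y)) ∂μ = ∫ u, f u ∂unif := by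
  have hm : Measurable (fun y => ballP μ (x, y)) :=
    (measurable_ballP μ).comp measurable_prodMk_left
  rw [← pit μ hsph x, integral_map hm.aemeasurable hf.aestronglyMeasurable]

end pit

/-! ### Rotational symmetry -/

section rot

variable {d : ℕ}

lemma rot_pair (φ : ℝ → ℝ) {v w : EucSp d} (h : ‖v‖ = ‖w‖) :
    ∫ z : EucSp d, ⟪v, z⟫ ^ 2 * φ ‖z‖ = ∫ z : EucSp d, ⟪w, z⟫ ^ 2 * φ ‖z‖ := by
  set R : EucSp d ≃ₗᵢ[ℝ] EucSp d := (Submodule.span ℝ {v - w})ᗮ.reflection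
  have hR : R v = w := Submodule.reflection_sub h
  have := (R.measurePreserving).integral_comp R.toHomeomorph.measurableEmbedding
    (fun z => ⟪w, z⟫ ^ 2 * φ ‖z‖)
  rw [← this]
  congr 1
  ext z
  rw [← hR, R.inner_map_map, R.norm_map]

lemma rot_zero (hd : 1 ≤ d) (φ : ℝ → ℝ)
    (hφ : Integrable fun z : EucSp d => ‖z‖ ^ 2 * φ ‖z‖) (g : EucSp d) 
    (hφm : Measurable φ) :
    ∫ z : EucSp d, (⟪g, z⟫ ^ 2 - ‖g‖ ^ 2 / d * ‖z‖ ^ 2) * φ ‖z‖ = 0 := by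
  have hIntg : ∀ v : EucSp d, Integrable fun z : EucSp d => ⟪v, z⟫ ^ 2 * φ ‖z‖ := by
    intro v
    refine (hφ.norm.const_mul (‖v‖ ^ 2)).mono' ?_ ?_
    · exact Measurable.aestronglyMeasurable (by fun_prop)
    · refine Eventually.of_forall fun z => ?_
      rw [norm_mul, norm_mul, ← mul_assoc, norm_pow, norm_pow, norm_norm, ← mul_pow]
      gcongr
      exact norm_inner_le_norm v z
  have hsum : ∀ i : Fin d, ∫ z : EucSp d, ⟪g, z⟫ ^ 2 * φ ‖z‖ =
      ∫ z : EucSp d, ⟪EuclideanSpace.single i ‖g‖, z⟫ ^ 2 * φ ‖z‖ := fun i =>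
    rot_pair φ (by simp)
  have h1 : (d : ℝ) * ∫ z : EucSp d, ⟪g, z⟫ ^ 2 * φ ‖z‖ =
      ∫ z : EucSp d, ‖g‖ ^ 2 * (‖z‖ ^ 2 * φ ‖z‖) := by
    have : ∑ _i : Fin d, ∫ z : EucSp d, ⟪g, z⟫ ^ 2 * φ ‖z‖ =
       ∑ i : Fin d, ∫ z : EucSp d, ⟪EuclideanSpace.single i ‖g‖, z⟫ ^ 2 * φ ‖z‖ :=
      Finset.sum_congr rfl fun i _ => hsum i
    rw [Finset.sum_const, Finset.card_univ, Fintype.card_fin, nsmul_eq_mul,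
      ← integral_finsetSum _ (fun i _ => hIntg _)] at this
    rw [this]
    congr 1
    ext z
    rw [EuclideanSpace.norm_sq_eq z, Finset.sum_mul, Finset.mul_sum]
    refine Finset.sum_congr rfl fun i _ => ?_
    rw [EuclideanSpace.inner_single_left]
    simp
    ring
  rw [integral_const_mul] at h1
  have hd' : (d : ℝ) ≠ 0 := by positivity
  have h2 : ∀ z : EucSp d, (⟪g, z⟫ ^ 2 - ‖g‖ ^ 2 / d * ‖z‖ ^ 2) * φ ‖z‖ =
    ⟪g, z⟫ ^ 2 * φ ‖z‖ - ‖g‖ ^ 2 / d * (‖z‖ ^ 2 * φ ‖z‖) := fun z => by ring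
  simp_rw [h2]
  rw [integral_sub (hIntg g) (hφ.const_mul _), integral_const_mul]
  field_simp
  linarith

end rot

/-! ### Pointwise asymptotics -/

section pointwise

variable {d : ℕ}

lemma sq_le_rpow (hd : 1 ≤ d) {c r p : ℝ} (hc : 0 < c) (hr : 0 ≤ r) (h : c * r ^ d ≤ p) :
    r ^ 2 ≤ c ^ (-(2 / (d:ℝ))) * p ^ (2 / (d:ℝ)) := by
  have hd' : (d : ℝ) ≠ 0 := by positivity
  have h1 : (c * r ^ d) ^ (2 / (d:ℝ)) ≤ p ^ (2 / (d:ℝ)) :=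
    Real.rpow_le_rpow (by positivity) h (by positivity)
  have h2 : (r ^ d) ^ (2 / (d:ℝ)) = r ^ 2 := by
    rw [← Real.rpow_natCast r d, ← Real.rpow_mul hr, mul_div_cancel₀ _ hd']
    exact_mod_cast Real.rpow_natCast r 2
  rw [Real.mul_rpow hc.le (by positivity), h2] at h1
  rw [Real.rpow_neg hc.le, inv_mul_eq_div, le_div_iff₀ (by positivity)]
  linarith

lemma betaW_ballP_int (μ : Measure (EucSp d)) [IsProbabilityMeasure μ] (x : EucSp d) (N m : ℕ)
    {f : EucSp d → ℝ} (hf : AEStronglyMeasurable f μ) {C s : ℝ} (hs : 0 ≤ s)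
    (hb : ∀ᵐ y ∂μ, |f y| ≤ C * ballP μ (x, y) ^ s) :
    Integrable (fun y => f y * betaW N m (ballP μ (x, y))) μ := by
  have hm : Measurable (fun y => ballP μ (x, y)) :=
    (measurable_ballP μ).comp measurable_prodMk_left
  refine (integrable_const (|C| * ((N:ℝ) + m + 1))).mono'
    (hf.mul ((betaW_cont N m).measurable.comp hm).aestronglyMeasurable) ?_
  filter_upwards [hb] with y hy
  have h0 := ballP_nonneg μ (x, y)
  have h1 := ballP_le_one μ (x, y)
  rw [norm_mul, Real.norm_eq_abs, Real.norm_eq_abs, abs_of_nonneg (betaW_nonneg N m h0 h1)]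
  have h2 : ballP μ (x, y) ^ s ≤ 1 := Real.rpow_le_one h0 h1 hs
  have h3 : |f y| ≤ |C| := by
    refine hy.trans ?_
    calc C * ballP μ (x, y) ^ s ≤ |C| * ballP μ (x, y) ^ s := by
          gcongr; exact le_abs_self C
      _ ≤ |C| * 1 := by gcongr
      _ = |C| := mul_one _
  exact mul_le_mul h3 (betaW_le N m h0 h1) (betaW_nonneg N m h0 h1) (by positivity)

/-- main domination estimate -/
lemma abs_integral_le (μ : Measure (EucSp d)) [IsProbabilityMeasure μ]
    (hsph : ∀ x r, μ (Metric.sphere x r) = 0) (x : EucSp d) (m : ℕ) {s : ℝ} (hs : 0 ≤ s)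
    (hs3 : s ≤ 3) :
    ∃ T, 0 < T ∧ ∀ (N : ℕ) (f : EucSp d → ℝ), AEStronglyMeasurable f μ → ∀ ε C A : ℝ,
      0 ≤ C → 0 < A →
      (∀ᵐ y ∂μ, |f y| ≤ ε * ballP μ (x, y) ^ s + (Set.Ici (A / ((N:ℝ) + m + 2))).indicator
        (fun u => C * u ^ s) (ballP μ (x, y))) →
      |∫ y, f y * betaW N m (ballP μ (x, y)) ∂μ| ≤ (ε + C * (T * A ^ (s - 3))) * betaM s N m := by
  obtain ⟨T, hT, htail⟩ := betaM_tail m hs hs3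
  refine ⟨T, hT, fun N f hf ε C A hC hA hb => ?_⟩
  set S := Set.Ici (A / ((N:ℝ) + m + 2))
  have hm : Measurable (fun y => ballP μ (x, y)) :=
    (measurable_ballP μ).comp measurable_prodMk_left
  have hmS : Measurable (fun u : ℝ => S.indicator (fun u => u ^ s * betaW N m u) u) :=
    ((Real.continuous_rpow_const hs).mul (betaW_cont N m)).measurable.indicator measurableSet_Ici
  have hm1 : Measurable (fun u : ℝ => u ^ s * betaW N m u) :=
    ((Real.continuous_rpow_const hs).mul (betaW_cont N m)).measurable
  have hi1 : Integrable (fun y => ballP μ (x, y) ^ s * betaW N m (ballP μ (x, y))) μ := by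
    refine betaW_ballP_int μ x N m (C := 1) (s := s) (f := fun y => ballP μ (x, y) ^ s) ?_ hs ?_
    · exact ((Real.continuous_rpow_const hs).measurable.comp hm).aestronglyMeasurable
    · refine Eventually.of_forall fun y => ?_
      rw [abs_of_nonneg (Real.rpow_nonneg (ballP_nonneg μ _) s), one_mul]
  have hi2 : Integrable (fun y => S.indicator (fun u => u ^ s * betaW N m u) (ballP μ (x, y))) μ :=
    hi1.indicator (hm measurableSet_Ici)
  have hle : |∫ y, f y * betaW N m (ballP μ (x, y)) ∂μ| ≤
      ∫ y, (ε * (ballP μ (x, y) ^ s * betaW N m (ballP μ (x, y))) +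
        C * S.indicator (fun u => u ^ s * betaW N m u) (ballP μ (x, y))) ∂μ := by
    rw [← Real.norm_eq_abs]
    refine norm_integral_le_of_norm_le ((hi1.const_mul ε).add (hi2.const_mul C)) ?_
    filter_upwards [hb] with y hy
    have h0 := ballP_nonneg μ (x, y)
    have h1 := ballP_le_one μ (x, y)
    have hw := betaW_nonneg N m h0 h1
    rw [norm_mul, Real.norm_eq_abs, Real.norm_eq_abs, abs_of_nonneg hw]
    refine (mul_le_mul_of_nonneg_right hy hw).trans (le_of_eq ?_)
    by_cases hS : ballP μ (x, y) ∈ S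
    · rw [Set.indicator_of_mem hS, Set.indicator_of_mem hS]; ring
    · rw [Set.indicator_of_notMem hS, Set.indicator_of_notMem hS]; ring
  refine hle.trans ?_
  rw [integral_add (hi1.const_mul ε) (hi2.const_mul C), integral_const_mul, integral_const_mul,
    pit_integral μ hsph x hm1, pit_integral μ hsph x hmS]
  have := htail N A hA
  have h2 : C * ∫ u, S.indicator (fun u => u ^ s * betaW N m u) u ∂unif ≤
    C * (T * A ^ (s - 3) * betaM s N m) := by gcongr
  have h3 : ∫ u, u ^ s * betaW N m u ∂unif = betaM s N m := rfl
  rw [h3]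
  nlinarith

lemma two_div_le (hd : 1 ≤ d) : 2 / (d:ℝ) ≤ 2 := by
  have : (1:ℝ) ≤ d := by exact_mod_cast hd
  rw [div_le_iff₀ (by linarith)]; linarith

lemma uniform_bound (hd : 1 ≤ d) (μ : Measure (EucSp d)) [IsProbabilityMeasure μ]
    (hsph : ∀ x r, μ (Metric.sphere x r) = 0) (x : EucSp d) (m N : ℕ) {c : ℝ} (hc : 0 < c)
    (hball : ∀ᵐ y ∂μ, c * dist y x ^ d ≤ ballP μ (x, y)) :
    ∫ y, dist y x ^ 2 * betaW N m (ballP μ (x, y)) ∂μ ≤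
      c ^ (-(2 / (d:ℝ))) * betaM (2 / (d:ℝ)) N m := by
  have hs : 0 ≤ 2 / (d:ℝ) := by positivity
  obtain ⟨T, hT, H⟩ := abs_integral_le μ hsph x m hs ((two_div_le hd).trans (by norm_num))
  have := H N (fun y => dist y x ^ 2) (by fun_prop) (c ^ (-(2 / (d:ℝ)))) 0 1 le_rfl one_pos (by
    filter_upwards [hball] with y hy
    rw [abs_of_nonneg (by positivity)]
    refine (sq_le_rpow hd hc dist_nonneg hy).trans (le_of_eq ?_)
    simp [Set.indicator])
  rw [zero_mul, add_zero] at this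
  exact (le_abs_self _).trans this

lemma radial_limit (hd : 1 ≤ d) (μ : Measure (EucSp d)) [IsProbabilityMeasure μ]
    (hsph : ∀ x r, μ (Metric.sphere x r) = 0) (x : EucSp d) (m : ℕ) {c a : ℝ} (hc : 0 < c)
    (ha : 0 < a)
    (hball : ∀ᵐ y ∂μ, c * dist y x ^ d ≤ ballP μ (x, y))
    (hlim : Tendsto (fun r => μ.real (Metric.ball x r) / r ^ d) (𝓝[>] 0) (𝓝 a)) :
    Tendsto (fun N : ℕ => (∫ y, dist y x ^ 2 * betaW N m (ballP μ (x, y)) ∂μ) /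
      betaM (2 / (d:ℝ)) N m) atTop (𝓝 (a ^ (-(2 / (d:ℝ))))) := by
  have hd' : (d:ℝ) ≠ 0 := by positivity
  set s := 2 / (d:ℝ) with hsdef
  have hs : 0 < s := by positivity
  have hs2 : s ≤ 2 := two_div_le hd
  set L := a ^ (-s) with hL
  have hL0 : 0 < L := by positivity
  have hm : Measurable (fun y => ballP μ (x, y)) :=
    (measurable_ballP μ).comp measurable_prodMk_left
  obtain ⟨T, hT, H⟩ := abs_integral_le μ hsph x m hs.le (hs2.trans (by norm_num))
  rw [Metric.tendsto_atTop]
  intro ε hε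
  -- small radii
  have h1 : Tendsto (fun r => (μ.real (Metric.ball x r) / r ^ d) ^ (-s)) (𝓝[>] 0) (𝓝 L) :=
    hlim.rpow_const (Or.inl ha.ne')
  have h2 : ∀ᶠ r in 𝓝[>] (0:ℝ), |r ^ 2 - L * μ.real (Metric.ball x r) ^ s| ≤
      ε / 2 * μ.real (Metric.ball x r) ^ s := by
    have h3 := (Metric.tendsto_nhds.1 h1) (ε / 2) (by positivity)
    have h4 := hlim.eventually (lt_mem_nhds ha)
    filter_upwards [h3, h4, self_mem_nhdsWithin] with r h3 h4 hr
    have hr : 0 < r := hr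
    set G := μ.real (Metric.ball x r)
    have hG : 0 < G := by
      by_contra hG
      have : G / r ^ d ≤ 0 := div_nonpos_of_nonpos_of_nonneg (not_lt.1 hG) (by positivity)
      linarith
    have h5 : (G / r ^ d) ^ (-s) = r ^ 2 / G ^ s := by
      rw [Real.rpow_neg (by positivity), Real.div_rpow hG.le (by positivity), inv_div]
      congr 1
      rw [← Real.rpow_natCast r d, ← Real.rpow_mul hr.le, hsdef, mul_div_cancel₀ _ hd']
      exact_mod_cast Real.rpow_natCast r 2
    rw [h5, Real.dist_eq] at h3
    have hGs : 0 < G ^ s := by positivity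
    have h6 : r ^ 2 - L * G ^ s = (r ^ 2 / G ^ s - L) * G ^ s := by field_simp
    rw [h6, abs_mul, abs_of_pos hGs]
    gcongr
  obtain ⟨δ, hδ, h3⟩ := mem_nhdsGT_iff_exists_Ioo_subset.1 h2
  have hδ : 0 < δ := hδ
  set η := c * δ ^ d with hη
  have hη0 : 0 < η := by positivity
  set C := c ^ (-s) + L with hCdef
  have hC : 0 < C := by positivity
  have hdec : Tendsto (fun N : ℕ => ε / 2 + C * (T * (η * ((N:ℝ) + m + 2)) ^ (s - 3))) atTop
      (𝓝 (ε / 2)) := by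
    have h5 : Tendsto (fun N : ℕ => η * ((N:ℝ) + m + 2)) atTop atTop := by
      refine Tendsto.const_mul_atTop hη0 ?_
      exact tendsto_atTop_add_const_right _ _ (tendsto_atTop_add_const_right _ _
        tendsto_natCast_atTop_atTop)
    have h6 := (tendsto_rpow_neg_atTop (y := 3 - s) (by linarith)).comp h5
    simp only [Function.comp_def, neg_sub] at h6
    have := ((h6.const_mul T).const_mul C).const_add (ε / 2)
    simpa using this
  obtain ⟨N₀, hN₀⟩ := eventually_atTop.1 (hdec.eventually (gt_mem_nhds (show ε / 2 < ε by linarith)))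
  refine ⟨N₀, fun N hN => ?_⟩
  have hN' := hN₀ N hN
  have hM := betaM_pos hs.le N m
  have hn0 : (0:ℝ) < (N:ℝ) + m + 2 := by positivity
  have hb := H N (fun y => dist y x ^ 2 - L * ballP μ (x, y) ^ s) (by
      refine Measurable.aestronglyMeasurable ?_
      have : Measurable (fun y => ballP μ (x, y) ^ s) :=
        (Real.continuous_rpow_const hs.le).measurable.comp hm
      fun_prop) (ε / 2) C (η * ((N:ℝ) + m + 2)) hC.le (by positivity) (by
    filter_upwards [hball] with y hy
    rw [mul_div_assoc, div_self hn0.ne', mul_one]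
    have h0 := ballP_nonneg μ (x, y)
    have hps : 0 ≤ ballP μ (x, y) ^ s := Real.rpow_nonneg h0 s
    have hind : 0 ≤ (Set.Ici η).indicator (fun u => C * u ^ s) (ballP μ (x, y)) := by
      by_cases hS : ballP μ (x, y) ∈ Set.Ici η
      · rw [Set.indicator_of_mem hS]; positivity
      · rw [Set.indicator_of_notMem hS]
    rcases (dist_nonneg : 0 ≤ dist y x).eq_or_lt with h00 | hpos
    · have : ballP μ (x, y) = 0 := by simp [ballP, ← h00]
      rw [← h00, this, Real.zero_rpow hs.ne']
      simpa [this] using hind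
    rcases lt_or_ge (dist y x) δ with hlt | hge
    · have := h3 ⟨hpos, hlt⟩
      have h4 : |dist y x ^ 2 - L * ballP μ (x, y) ^ s| ≤ ε / 2 * ballP μ (x, y) ^ s := this
      linarith
    · have hS : ballP μ (x, y) ∈ Set.Ici η := by
        refine le_trans ?_ hy
        rw [hη]; gcongr
      rw [Set.indicator_of_mem hS]
      have h4 := sq_le_rpow hd hc dist_nonneg hy
      rw [← hsdef] at h4
      have h5 : |dist y x ^ 2 - L * ballP μ (x, y) ^ s| ≤ dist y x ^ 2 + L * ballP μ (x, y) ^ s := by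
        rw [abs_le]; constructor <;> nlinarith [sq_nonneg (dist y x), mul_nonneg hL0.le hps]
      have h6 : 0 ≤ ε / 2 * ballP μ (x, y) ^ s := by positivity
      rw [hCdef]
      nlinarith)
  have hi1 : Integrable (fun y => dist y x ^ 2 * betaW N m (ballP μ (x, y))) μ := by
    refine betaW_ballP_int μ x N m (C := c ^ (-s)) (s := s) (by fun_prop) hs.le ?_
    filter_upwards [hball] with y hy
    rw [abs_of_nonneg (by positivity)]
    exact sq_le_rpow hd hc dist_nonneg hy
  have hi2 : Integrable (fun y => ballP μ (x, y) ^ s * betaW N m (ballP μ (x, y))) μ := by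
    refine betaW_ballP_int μ x N m (C := 1) (s := s) (f := fun y => ballP μ (x, y) ^ s) ?_ hs.le ?_
    · exact ((Real.continuous_rpow_const hs.le).measurable.comp hm).aestronglyMeasurable
    · refine Eventually.of_forall fun y => ?_
      rw [abs_of_nonneg (Real.rpow_nonneg (ballP_nonneg μ _) s), one_mul]
  have heq : ∫ y, (dist y x ^ 2 - L * ballP μ (x, y) ^ s) * betaW N m (ballP μ (x, y)) ∂μ =
      (∫ y, dist y x ^ 2 * betaW N m (ballP μ (x, y)) ∂μ) - L * betaM s N m := by
    have h7 : ∫ y, ballP μ (x, y) ^ s * betaW N m (ballP μ (x, y)) ∂μ = betaM s N m :=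
      pit_integral μ hsph x (f := fun u => u ^ s * betaW N m u)
        ((Real.continuous_rpow_const hs.le).mul (betaW_cont N m)).measurable
    rw [← h7, ← integral_const_mul, ← integral_sub hi1 (hi2.const_mul L)]
    congr 1; ext y; ring
  rw [heq] at hb
  rw [Real.dist_eq]
  have h8 : (∫ y, dist y x ^ 2 * betaW N m (ballP μ (x, y)) ∂μ) / betaM s N m - L =
    ((∫ y, dist y x ^ 2 * betaW N m (ballP μ (x, y)) ∂μ) - L * betaM s N m) / betaM s N m := by
    field_simp
  rw [h8, abs_div, abs_of_pos hM, div_lt_iff₀ hM]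
  refine hb.trans_lt ?_
  gcongr

end pointwise

section angular

variable {d : ℕ}

/-- the trace-free quadratic form -/
def qf (g x y : EucSp d) : ℝ := ⟪g, y - x⟫ ^ 2 - ‖g‖ ^ 2 / d * dist y x ^ 2

lemma qf_meas (g x : EucSp d) : Measurable (qf g x) := by unfold qf; fun_prop

lemma qf_le (hd : 1 ≤ d) (g x y : EucSp d) : |qf g x y| ≤ ‖g‖ ^ 2 * dist y x ^ 2 := by
  unfold qf
  have hd1 : (1:ℝ) ≤ d := by exact_mod_cast hd
  have h1 : ⟪g, y - x⟫ ^ 2 ≤ ‖g‖ ^ 2 * dist y x ^ 2 := by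
    rw [dist_eq_norm, ← mul_pow, ← sq_abs]
    gcongr
    exact abs_real_inner_le_norm g (y - x)
  have h2 : ‖g‖ ^ 2 / d * dist y x ^ 2 ≤ ‖g‖ ^ 2 * dist y x ^ 2 := by
    gcongr
    exact div_le_self (by positivity) hd1
  have h3 : 0 ≤ ‖g‖ ^ 2 / d * dist y x ^ 2 := by positivity
  rw [abs_le]; constructor <;> nlinarith [sq_nonneg ⟪g, y - x⟫]

lemma near_bound (hd : 1 ≤ d) (κ : EucSp d → ℝ) (hκmeas : Measurable κ) (hκnn : ∀ x, 0 ≤ κ x)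
    (hκint : Integrable κ) (μ : Measure (EucSp d)) [IsProbabilityMeasure μ]
    (hμ : μ = volume.withDensity fun x => ENNReal.ofReal (κ x))
    (g x : EucSp d) (N m : ℕ) {ρ : ℝ} (hρ : 0 < ρ) :
    |∫ y in Metric.closedBall x ρ, qf g x y * betaW N m (ballP μ (x, y)) ∂μ| ≤
      (‖g‖ ^ 2 * ρ ^ 2 * ((N:ℝ) + m + 1)) * ∫ y in Metric.closedBall x ρ, ‖κ y - κ x‖ := by
  have hm : Measurable (fun y => ballP μ (x, y)) :=
    (measurable_ballP μ).comp measurable_prodMk_left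
  set f : EucSp d → ℝ := fun y => qf g x y * betaW N m (ballP μ (x, y)) with hf
  have hfm : Measurable f := (qf_meas g x).mul ((betaW_cont N m).measurable.comp hm)
  set B := Metric.closedBall x ρ with hB
  have hBm : MeasurableSet B := Metric.isClosed_closedBall.measurableSet
  have hfb : ∀ y ∈ B, ‖f y‖ ≤ ‖g‖ ^ 2 * ρ ^ 2 * ((N:ℝ) + m + 1) := by
    intro y hy
    have h0 := ballP_nonneg μ (x, y)
    have h1 := ballP_le_one μ (x, y)
    rw [hf]
    simp only
    rw [norm_mul, Real.norm_eq_abs, Real.norm_eq_abs, abs_of_nonneg (betaW_nonneg N m h0 h1)]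
    have hy' : dist y x ≤ ρ := hy
    have : |qf g x y| ≤ ‖g‖ ^ 2 * ρ ^ 2 := (qf_le hd g x y).trans (by gcongr)
    exact mul_le_mul this (betaW_le N m h0 h1) (betaW_nonneg N m h0 h1) (by positivity)
  have hfin : volume B ≠ ⊤ := measure_closedBall_lt_top.ne
  have hfi : IntegrableOn f B volume :=
    Measure.integrableOn_of_bounded hfin hfm.aestronglyMeasurable
      ((ae_restrict_iff' hBm).2 (Eventually.of_forall hfb))
  have hκf : IntegrableOn (fun y => κ y * f y) B volume := by
    refine Integrable.mul_bdd (c := ‖g‖ ^ 2 * ρ ^ 2 * ((N:ℝ) + m + 1)) hκint.integrableOn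
      hfm.aestronglyMeasurable ((ae_restrict_iff' hBm).2 (Eventually.of_forall hfb))
  have hzero : ∫ y in B, f y = 0 := by
    set G : ℝ → ℝ := fun r => μ.real (Metric.ball x r) with hG
    have hGm : Measurable G := by
      have : Monotone G := fun a b hab => measureReal_mono (Metric.ball_subset_ball hab)
      exact this.measurable
    set φ : ℝ → ℝ := (Set.Iic ρ).indicator (fun r => betaW N m (G r)) with hφ
    have hφm : Measurable φ := ((betaW_cont N m).measurable.comp hGm).indicator measurableSet_Iic
    have hφi : Integrable fun z : EucSp d => ‖z‖ ^ 2 * φ ‖z‖ := by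
      have hset : (fun z : EucSp d => ‖z‖ ^ 2 * φ ‖z‖) =
          (Metric.closedBall (0 : EucSp d) ρ).indicator (fun z => ‖z‖ ^ 2 * betaW N m (G ‖z‖)) := by
        ext z
        by_cases hz : ‖z‖ ≤ ρ
        · rw [Set.indicator_of_mem (by simpa using hz), hφ, Set.indicator_of_mem (show ‖z‖ ∈ Set.Iic ρ from hz)]
        · rw [Set.indicator_of_notMem (by simpa using hz), hφ, Set.indicator_of_notMem (show ‖z‖ ∉ Set.Iic ρ from hz), mul_zero]
      rw [hset, integrable_indicator_iff Metric.isClosed_closedBall.measurableSet]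
      refine Measure.integrableOn_of_bounded (M := ρ ^ 2 * ((N:ℝ) + m + 1))
        measure_closedBall_lt_top.ne ?_ ?_
      · refine Measurable.aestronglyMeasurable ?_
        have : Measurable (fun z : EucSp d => betaW N m (G ‖z‖)) :=
          (betaW_cont N m).measurable.comp (hGm.comp measurable_norm)
        fun_prop
      · refine (ae_restrict_iff' Metric.isClosed_closedBall.measurableSet).2
          (Eventually.of_forall fun z hz => ?_)
        have hz : ‖z‖ ≤ ρ := by simpa using hz
        have h0 : 0 ≤ G ‖z‖ := measureReal_nonneg
        have h1 : G ‖z‖ ≤ 1 := measureReal_le_one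
        rw [norm_mul, norm_pow, norm_norm, Real.norm_eq_abs, abs_of_nonneg (betaW_nonneg N m h0 h1)]
        exact mul_le_mul (by gcongr) (betaW_le N m h0 h1) (betaW_nonneg N m h0 h1) (by positivity)
    have hrot := rot_zero hd φ hφi g hφm
    rw [← integral_sub_right_eq_self _ x] at hrot
    rw [← integral_indicator hBm, ← hrot]
    congr 1
    ext y
    by_cases hy : y ∈ B
    · have hy' : ‖y - x‖ ≤ ρ := by rw [← dist_eq_norm]; exact hy
      rw [Set.indicator_of_mem hy, hφ, Set.indicator_of_mem (show ‖y - x‖ ∈ Set.Iic ρ from hy')]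
      simp only [hf, qf, ballP, hG, dist_eq_norm]
    · have hy' : ¬ ‖y - x‖ ≤ ρ := by rw [← dist_eq_norm]; exact hy
      rw [Set.indicator_of_notMem hy, hφ, Set.indicator_of_notMem (show ‖y - x‖ ∉ Set.Iic ρ from hy'),
        mul_zero]
  have heq : ∫ y in B, f y ∂μ = ∫ y in B, (κ y - κ x) * f y := by
    have h1 : ∫ y in B, f y ∂μ = ∫ y in B, κ y * f y := by
      rw [hμ, setIntegral_withDensity_eq_setIntegral_toReal_smul₀ (by fun_prop)
        (Eventually.of_forall fun _ => ENNReal.ofReal_lt_top) _ hBm]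
      simp only [ENNReal.toReal_ofReal (hκnn _), smul_eq_mul]
    have h2 : ∀ y, (κ y - κ x) * f y = κ y * f y - κ x * f y := fun y => by ring
    simp_rw [h2]
    rw [integral_sub hκf (hfi.const_mul (κ x)), integral_const_mul, hzero, h1]
    ring
  rw [heq, ← Real.norm_eq_abs, ← integral_const_mul]
  refine norm_integral_le_of_norm_le ?_ ?_
  · refine Integrable.const_mul ?_ _
    exact (hκint.integrableOn.sub (integrableOn_const hfin)).norm
  · refine (ae_restrict_iff' hBm).2 (Eventually.of_forall fun y hy => ?_)
    rw [norm_mul, mul_comm]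
    gcongr
    exact hfb y hy

lemma angular_limit (hd : 1 ≤ d) (κ : EucSp d → ℝ) (hκmeas : Measurable κ) (hκnn : ∀ x, 0 ≤ κ x)
    (hκint : Integrable κ) (μ : Measure (EucSp d)) [IsProbabilityMeasure μ]
    (hμ : μ = volume.withDensity fun x => ENNReal.ofReal (κ x))
    (hsph : ∀ x r, μ (Metric.sphere x r) = 0)
    (g x : EucSp d) (m : ℕ) {c : ℝ} (hc : 0 < c)
    (hball : ∀ᵐ y ∂μ, c * dist y x ^ d ≤ ballP μ (x, y))
    (hleb : Tendsto (fun r => ⨍ y in Metric.closedBall x r, ‖κ y - κ x‖) (𝓝[>] 0) (𝓝 0)) :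
    Tendsto (fun N : ℕ => (∫ y, qf g x y * betaW N m (ballP μ (x, y)) ∂μ) /
      betaM (2 / (d:ℝ)) N m) atTop (𝓝 0) := by
  have hd' : (d:ℝ) ≠ 0 := by positivity
  set s := 2 / (d:ℝ) with hsdef
  have hs : 0 < s := by positivity
  have hs2 : s ≤ 2 := two_div_le hd
  have hm : Measurable (fun y => ballP μ (x, y)) :=
    (measurable_ballP μ).comp measurable_prodMk_left
  obtain ⟨T, hT, H⟩ := abs_integral_le μ hsph x m hs.le (hs2.trans (by norm_num))
  set C := ‖g‖ ^ 2 * c ^ (-s) with hCdef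
  have hC : 0 ≤ C := by positivity
  set θ := volume.real (Metric.ball (0 : EucSp d) 1) with hθ
  rw [Metric.tendsto_atTop]
  intro ε hε
  obtain ⟨A, hA, hAε⟩ : ∃ A : ℝ, 0 < A ∧ C * (T * A ^ (s - 3)) < ε / 2 := by
    have h6 := (tendsto_rpow_neg_atTop (y := 3 - s) (by linarith))
    simp only [neg_sub] at h6
    have h7 := ((h6.const_mul T).const_mul C)
    simp only [mul_zero] at h7
    obtain ⟨A, h1, h2⟩ := ((h7.eventually (gt_mem_nhds (show (0:ℝ) < ε / 2 by linarith))).and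
      (eventually_gt_atTop 0)).exists
    exact ⟨A, h2, h1⟩
  set ρ : ℕ → ℝ := fun N => (A / (c * ((N:ℝ) + m + 2))) ^ (1 / (d:ℝ)) with hρ
  have hρpos : ∀ N, 0 < ρ N := fun N => by rw [hρ]; positivity
  have hρlim : Tendsto ρ atTop (𝓝[>] 0) := by
    refine tendsto_nhdsWithin_iff.2 ⟨?_, Eventually.of_forall hρpos⟩
    have h5 : Tendsto (fun N : ℕ => c * ((N:ℝ) + m + 2)) atTop atTop := by
      refine Tendsto.const_mul_atTop hc ?_
      exact tendsto_atTop_add_const_right _ _ (tendsto_atTop_add_const_right _ _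
        tendsto_natCast_atTop_atTop)
    have h6 := (h5.const_div_atTop A).rpow_const (p := 1 / (d:ℝ)) (Or.inr (by positivity))
    rwa [Real.zero_rpow (by positivity)] at h6
  set K := ‖g‖ ^ 2 * (A / c) ^ (s + 1) * θ * (2 * 2 ^ s) with hK
  have hdec := ((hleb.comp hρlim).const_mul K).add_const (C * (T * A ^ (s - 3)))
  simp only [mul_zero, zero_add] at hdec
  obtain ⟨N₀, hN₀⟩ := eventually_atTop.1 (hdec.eventually (gt_mem_nhds (hAε.trans (half_lt_self hε))))
  refine ⟨N₀, fun N hN => ?_⟩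
  have hN' := hN₀ N hN
  simp only [Function.comp_apply] at hN'
  have hM := betaM_pos hs.le N m
  have hlow := betaM_lower hs.le N m
  set n : ℝ := (N:ℝ) + m + 2 with hn
  have hn0 : 0 < n := by positivity
  have hρd : ρ N ^ d = A / (c * n) := by
    rw [hρ]; simp only
    rw [← Real.rpow_natCast, ← Real.rpow_mul (by positivity), one_div_mul_cancel hd', Real.rpow_one]
  have hρ2 : ρ N ^ 2 = (A / (c * n)) ^ s := by
    rw [hρ]; simp only
    rw [← Real.rpow_natCast, ← Real.rpow_mul (by positivity), hsdef]
    congr 1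
    push_cast; ring
  set B := Metric.closedBall x (ρ N) with hB
  have hBm : MeasurableSet B := Metric.isClosed_closedBall.measurableSet
  have hIntg : Integrable (fun y => qf g x y * betaW N m (ballP μ (x, y))) μ := by
    refine betaW_ballP_int μ x N m (C := C) (s := s) (qf_meas g x).aestronglyMeasurable hs.le ?_
    filter_upwards [hball] with y hy
    have h4 := sq_le_rpow hd hc dist_nonneg hy
    rw [← hsdef] at h4
    calc |qf g x y| ≤ ‖g‖ ^ 2 * dist y x ^ 2 := qf_le hd g x y
      _ ≤ ‖g‖ ^ 2 * (c ^ (-s) * ballP μ (x, y) ^ s) := by gcongr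
      _ = _ := by rw [hCdef]; ring
  have hsplit := integral_add_compl hBm hIntg
  have hnear : |∫ y in B, qf g x y * betaW N m (ballP μ (x, y)) ∂μ| ≤
      K * (⨍ y in B, ‖κ y - κ x‖) * betaM s N m := by
    refine (near_bound hd κ hκmeas hκnn hκint μ hμ g x N m (hρpos N)).trans ?_
    have hvol : volume.real B = A / (c * n) * θ := by
      rw [hB, Measure.addHaar_real_closedBall _ _ (hρpos N).le, ← hρd]
      simp [hθ]
    have hav : ∫ y in B, ‖κ y - κ x‖ = A / (c * n) * θ * ⨍ y in B, ‖κ y - κ x‖ := by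
      rw [← hvol, ← smul_eq_mul, measure_smul_setAverage _ measure_closedBall_lt_top.ne]
    have hav0 : 0 ≤ ⨍ y in B, ‖κ y - κ x‖ := by
      rw [setAverage_eq]
      exact smul_nonneg (by positivity) (integral_nonneg fun _ => norm_nonneg _)
    rw [hav, hρ2]
    set av := ⨍ y in B, ‖κ y - κ x‖
    have hN1 : (N:ℝ) + m + 1 ≤ n := by rw [hn]; linarith
    have hθ0 : 0 ≤ θ := measureReal_nonneg
    calc ‖g‖ ^ 2 * (A / (c * n)) ^ s * ((N:ℝ) + m + 1) * (A / (c * n) * θ * av)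
        ≤ ‖g‖ ^ 2 * (A / (c * n)) ^ s * n * (A / (c * n) * θ * av) := by gcongr
      _ = K * av * (1 / 2 * (2 * n) ^ (-s)) := by
          rw [hK, ← div_div, Real.div_rpow (x := A / c) (by positivity) hn0.le,
            Real.rpow_add (by positivity), Real.rpow_one,
            Real.mul_rpow (by norm_num) hn0.le, Real.rpow_neg hn0.le, Real.rpow_neg (by norm_num)]
          have : (0:ℝ) < 2 ^ s := by positivity
          have : (0:ℝ) < n ^ s := by positivity
          field_simp
      _ ≤ K * av * betaM s N m := by gcongr
  have hfar : |∫ y in Bᶜ, qf g x y * betaW N m (ballP μ (x, y)) ∂μ| ≤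
      C * (T * A ^ (s - 3)) * betaM s N m := by
    have := H N (Bᶜ.indicator (qf g x)) ((qf_meas g x).indicator hBm.compl).aestronglyMeasurable
      0 C A hC hA (by
        filter_upwards [hball] with y hy
        rw [zero_mul, zero_add, ← hn]
        have h0 := ballP_nonneg μ (x, y)
        by_cases hyB : y ∈ Bᶜ
        · rw [Set.indicator_of_mem hyB]
          have hgt : ρ N < dist y x := not_le.1 hyB
          have hS : ballP μ (x, y) ∈ Set.Ici (A / n) := by
            refine le_trans ?_ hy
            calc A / n = c * ρ N ^ d := by rw [hρd]; field_simp
              _ ≤ c * dist y x ^ d := by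
                have := (hρpos N).le
                gcongr
          rw [Set.indicator_of_mem hS]
          have h4 := sq_le_rpow hd hc dist_nonneg hy
          rw [← hsdef] at h4
          calc |qf g x y| ≤ ‖g‖ ^ 2 * dist y x ^ 2 := qf_le hd g x y
            _ ≤ ‖g‖ ^ 2 * (c ^ (-s) * ballP μ (x, y) ^ s) := by gcongr
            _ = _ := by rw [hCdef]; ring
        · rw [Set.indicator_of_notMem hyB, abs_zero]
          by_cases hS : ballP μ (x, y) ∈ Set.Ici (A / n)
          · rw [Set.indicator_of_mem hS]; positivity
          · rw [Set.indicator_of_notMem hS])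
    rw [zero_add] at this
    rw [← integral_indicator hBm.compl]
    convert this using 3
    ext y
    by_cases hyB : y ∈ Bᶜ
    · rw [Set.indicator_of_mem hyB, Set.indicator_of_mem hyB]
    · rw [Set.indicator_of_notMem hyB, Set.indicator_of_notMem hyB, zero_mul]
  rw [Real.dist_eq, sub_zero, abs_div, abs_of_pos hM, div_lt_iff₀ hM, ← hsplit]
  calc _ ≤ _ := abs_add_le _ _
    _ ≤ K * (⨍ y in B, ‖κ y - κ x‖) * betaM s N m + C * (T * A ^ (s - 3)) * betaM s N m :=
        add_le_add hnear hfar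
    _ = (K * (⨍ y in B, ‖κ y - κ x‖) + C * (T * A ^ (s - 3))) * betaM s N m := by ring
    _ < ε * betaM s N m := by gcongr

end angular

/-! ### Assembly -/

section assembly

variable {d : ℕ} {Ωp : Type*} [MeasureSpace Ωp] [IsProbabilityMeasure (ℙ : Measure Ωp)]

lemma expect_eq (μ : Measure (EucSp d)) [IsProbabilityMeasure μ]
    (hsph : ∀ x r, μ (Metric.sphere x r) = 0)
    (X : ℕ → Ωp → EucSp d) (hXmeas : ∀ i, Measurable (X i)) (hiid : iIndepFun X ℙ)
    (hlaw : ∀ i, Measure.map (X i) ℙ = μ)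
    (J : ℕ → ℕ → ℕ → Ωp → ℕ) (hJmeas : ∀ i n k, Measurable (J i n k))
    (hJ : IsNNIndex X J) (N m : ℕ) (f : EucSp d → EucSp d → ℝ)
    (hf : Measurable (Function.uncurry f)) (C : ℝ)
    (hC : ∀ᵐ z ∂(μ.prod μ), |f z.1 z.2| ≤ C) :
    ∫ ω, f (X 0 ω) (X (J 0 (N + m + 2) (m + 1) ω) ω) ∂ℙ =
      ∫ x, ∫ y, f x y * betaW N m (ballP μ (x, y)) ∂μ ∂μ := by
  have hXK : Measurable (fun ω => X (J 0 (N + m + 2) (m + 1) ω) ω) := by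
    have : Measurable (fun q : ℕ × Ωp => X q.1 q.2) := measurable_from_prod_countable_right hXmeas
    exact this.comp ((hJmeas _ _ _).prodMk measurable_id)
  have hbm : Measurable (fun z : EucSp d × EucSp d => betaW N m (ballP μ z)) :=
    (betaW_cont N m).measurable.comp (measurable_ballP μ)
  have h1 := integral_map (μ := (ℙ : Measure Ωp)) ((hXmeas 0).prodMk hXK).aemeasurable
    (f := Function.uncurry f) hf.aestronglyMeasurable
  rw [pair_law μ hsph X hXmeas hiid hlaw J hJmeas hJ N m,
    integral_withDensity_eq_integral_toReal_smul hbm.ennreal_ofReal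
      (Eventually.of_forall fun _ => ENNReal.ofReal_lt_top)] at h1
  have h2 : ∫ z, Function.uncurry f z * betaW N m (ballP μ z) ∂(μ.prod μ) =
      ∫ x, ∫ y, f x y * betaW N m (ballP μ (x, y)) ∂μ ∂μ := by
    rw [integral_prod]
    · rfl
    refine (integrable_const (C * ((N:ℝ) + m + 1))).mono' (hf.mul hbm).aestronglyMeasurable ?_
    filter_upwards [hC] with z hz
    have h0 := ballP_nonneg μ z
    have h1 := ballP_le_one μ z
    rw [norm_mul, Real.norm_eq_abs, Real.norm_eq_abs, abs_of_nonneg (betaW_nonneg N m h0 h1)]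
    exact mul_le_mul hz (betaW_le N m h0 h1) (betaW_nonneg N m h0 h1) ((abs_nonneg _).trans hz)
  rw [← h2]
  refine h1.symm.trans ?_
  refine integral_congr_ae (Eventually.of_forall fun z => ?_)
  simp only [smul_eq_mul]
  rw [ENNReal.toReal_ofReal (betaW_nonneg N m (ballP_nonneg μ z) (ballP_le_one μ z)), mul_comm]

lemma outer_limit (μ : Measure (EucSp d)) [IsProbabilityMeasure μ] (m : ℕ)
    (f : EucSp d → EucSp d → ℝ) (hf : Measurable (Function.uncurry f)) (L : EucSp d → ℝ) (B : ℝ)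
    {s : ℝ} (hs : 0 ≤ s)
    (hB : ∀ N, ∀ᵐ x ∂μ, |∫ y, f x y * betaW N m (ballP μ (x, y)) ∂μ| ≤ B * betaM s N m)
    (hL : ∀ᵐ x ∂μ, Tendsto (fun N => (∫ y, f x y * betaW N m (ballP μ (x, y)) ∂μ) / betaM s N m)
      atTop (𝓝 (L x))) :
    Tendsto (fun N => (∫ x, ∫ y, f x y * betaW N m (ballP μ (x, y)) ∂μ ∂μ) / betaM s N m)
      atTop (𝓝 (∫ x, L x ∂μ)) := by
  have := tendsto_integral_of_dominated_convergence (μ := μ)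
    (F := fun N x => (∫ y, f x y * betaW N m (ballP μ (x, y)) ∂μ) / betaM s N m) (f := L)
    (fun _ => B) (fun N => ?_) (integrable_const _) (fun N => ?_) hL
  · simpa only [integral_div] using this
  · refine (Measurable.div_const ?_ _).aestronglyMeasurable
    refine StronglyMeasurable.measurable ?_
    refine StronglyMeasurable.integral_prod_right (f := fun x y => f x y * betaW N m (ballP μ (x, y))) ?_
    refine Measurable.stronglyMeasurable ?_
    exact hf.mul ((betaW_cont N m).measurable.comp (measurable_ballP μ))
  · filter_upwards [hB N] with x hx
    have hM := betaM_pos hs N m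
    rw [norm_div, Real.norm_eq_abs, Real.norm_of_nonneg hM.le, div_le_iff₀ hM]
    exact hx

lemma dir_limit (hd : 1 ≤ d) (κ : EucSp d → ℝ) (hκmeas : Measurable κ) (hκnn : ∀ x, 0 ≤ κ x)
    (hκint : Integrable κ) (μ : Measure (EucSp d)) [IsProbabilityMeasure μ]
    (hμ : μ = volume.withDensity fun x => ENNReal.ofReal (κ x))
    (hsph : ∀ x r, μ (Metric.sphere x r) = 0)
    (g x : EucSp d) (m : ℕ) {c a : ℝ} (hc : 0 < c) (ha : 0 < a)
    (hball : ∀ᵐ y ∂μ, c * dist y x ^ d ≤ ballP μ (x, y))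
    (hlim : Tendsto (fun r => μ.real (Metric.ball x r) / r ^ d) (𝓝[>] 0) (𝓝 a))
    (hleb : Tendsto (fun r => ⨍ y in Metric.closedBall x r, ‖κ y - κ x‖) (𝓝[>] 0) (𝓝 0)) :
    Tendsto (fun N : ℕ => (∫ y, ⟪g, y - x⟫ ^ 2 * betaW N m (ballP μ (x, y)) ∂μ) /
      betaM (2 / (d:ℝ)) N m) atTop (𝓝 (‖g‖ ^ 2 / d * a ^ (-(2 / (d:ℝ))))) := by
  have hs : 0 ≤ 2 / (d:ℝ) := by positivity
  have h1 := angular_limit hd κ hκmeas hκnn hκint μ hμ hsph g x m hc hball hleb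
  have h2 := (radial_limit hd μ hsph x m hc ha hball hlim).const_mul (‖g‖ ^ 2 / d)
  have h3 := h1.add h2
  rw [zero_add] at h3
  refine h3.congr fun N => ?_
  have hi1 : Integrable (fun y => dist y x ^ 2 * betaW N m (ballP μ (x, y))) μ := by
    refine betaW_ballP_int μ x N m (C := c ^ (-(2 / (d:ℝ)))) (by fun_prop) hs ?_
    filter_upwards [hball] with y hy
    rw [abs_of_nonneg (by positivity)]
    exact sq_le_rpow hd hc dist_nonneg hy
  have hi2 : Integrable (fun y => qf g x y * betaW N m (ballP μ (x, y))) μ := by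
    refine betaW_ballP_int μ x N m (C := ‖g‖ ^ 2 * c ^ (-(2 / (d:ℝ))))
      (qf_meas g x).aestronglyMeasurable hs ?_
    filter_upwards [hball] with y hy
    refine (qf_le hd g x y).trans ?_
    rw [mul_assoc]
    gcongr
    exact sq_le_rpow hd hc dist_nonneg hy
  rw [← mul_div_assoc, ← add_div, ← integral_const_mul, ← integral_add hi2 (hi1.const_mul _)]
  congr 2
  ext y
  unfold qf
  ring

lemma dir_bound (hd : 1 ≤ d) (μ : Measure (EucSp d)) [IsProbabilityMeasure μ]
    (hsph : ∀ x r, μ (Metric.sphere x r) = 0)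
    (g x : EucSp d) (m N : ℕ) {c M : ℝ} (hc : 0 < c) (hM : ‖g‖ ≤ M)
    (hball : ∀ᵐ y ∂μ, c * dist y x ^ d ≤ ballP μ (x, y)) :
    |∫ y, ⟪g, y - x⟫ ^ 2 * betaW N m (ballP μ (x, y)) ∂μ| ≤
      (M ^ 2 * c ^ (-(2 / (d:ℝ)))) * betaM (2 / (d:ℝ)) N m := by
  have hs : 0 ≤ 2 / (d:ℝ) := by positivity
  have hi1 : Integrable (fun y => dist y x ^ 2 * betaW N m (ballP μ (x, y))) μ := by
    refine betaW_ballP_int μ x N m (C := c ^ (-(2 / (d:ℝ)))) (by fun_prop) hs ?_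
    filter_upwards [hball] with y hy
    rw [abs_of_nonneg (by positivity)]
    exact sq_le_rpow hd hc dist_nonneg hy
  have hM0 : 0 ≤ M := (norm_nonneg g).trans hM
  have h1 : |∫ y, ⟪g, y - x⟫ ^ 2 * betaW N m (ballP μ (x, y)) ∂μ| ≤
      ∫ y, M ^ 2 * (dist y x ^ 2 * betaW N m (ballP μ (x, y))) ∂μ := by
    rw [← Real.norm_eq_abs]
    refine norm_integral_le_of_norm_le (hi1.const_mul _) (Eventually.of_forall fun y => ?_)
    have hw := betaW_nonneg N m (ballP_nonneg μ (x, y)) (ballP_le_one μ (x, y))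
    rw [Real.norm_of_nonneg (by positivity), ← mul_assoc]
    gcongr
    rw [dist_eq_norm, ← mul_pow, ← sq_abs]
    gcongr
    exact (abs_real_inner_le_norm g (y - x)).trans (by gcongr)
  refine h1.trans ?_
  rw [integral_const_mul, mul_assoc]
  gcongr
  exact uniform_bound hd μ hsph x m N hc hball

lemma lebesgue_points (hd : 1 ≤ d) (κ : EucSp d → ℝ) (hκmeas : Measurable κ) (hκnn : ∀ x, 0 ≤ κ x)
    (hκint : Integrable κ) (μ : Measure (EucSp d)) [IsProbabilityMeasure μ]
    (hμ : μ = volume.withDensity fun x => ENNReal.ofReal (κ x))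
    (hsph : ∀ x r, μ (Metric.sphere x r) = 0)
    (hIntg : ∀ x r, ∫ y in Metric.closedBall x r, κ y = μ.real (Metric.closedBall x r)) :
    ∀ᵐ x, Tendsto (fun r => ⨍ y in Metric.closedBall x r, ‖κ y - κ x‖) (𝓝[>] 0) (𝓝 0) ∧
      Tendsto (fun r => μ.real (Metric.ball x r) / r ^ d) (𝓝[>] 0)
        (𝓝 (κ x * volume.real (Metric.ball (0 : EucSp d) 1))) := by
  filter_upwards [IsUnifLocDoublingMeasure.ae_tendsto_average_norm_sub volume
      hκint.locallyIntegrable 1,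
    IsUnifLocDoublingMeasure.ae_tendsto_average volume hκint.locallyIntegrable 1] with x h1 h2
  have hmem : ∀ᶠ r : ℝ in 𝓝[>] 0, x ∈ Metric.closedBall x (1 * r) := by
    filter_upwards [self_mem_nhdsWithin] with r hr
    have : 0 < r := hr
    simp [this.le]
  refine ⟨h1 (fun _ => x) (fun r => r) tendsto_id hmem, ?_⟩
  refine ((h2 (fun _ => x) (fun r => r) tendsto_id hmem).mul_const
    (volume.real (Metric.ball (0 : EucSp d) 1))).congr' ?_
  filter_upwards [self_mem_nhdsWithin] with r hr
  have hr : 0 < r := hr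
  have hθ : 0 < volume.real (Metric.ball (0 : EucSp d) 1) :=
    ENNReal.toReal_pos (Metric.measure_ball_pos _ _ one_pos).ne' measure_ball_lt_top.ne
  have hb : μ.real (Metric.closedBall x r) = μ.real (Metric.ball x r) := by
    rw [measureReal_def, measureReal_def, ← Metric.closedBall_sdiff_sphere,
      measure_sdiff_null (hsph x r)]
  rw [setAverage_eq, hIntg, hb, Measure.addHaar_real_closedBall _ _ hr.le, finrank_euclideanSpace_fin,
    smul_eq_mul]
  field_simp

end assembly

/-- **Theorem 5.2.** With `A_{n,k} = E[(∇h(X_1)·(X_{j(1,n,k)} − X_1))²] /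
(2 E[|X_{j(1,n,k)} − X_1|²])`, as `n → ∞`,
`A_{n,k} → (∫_Ω κ^{(d−2)/d} |∇h|²) / (2d ∫_Ω κ^{(d−2)/d})`. -/
theorem stmt9 {d : ℕ} (hd : 1 ≤ d)
    {Ωp : Type*} [MeasureSpace Ωp] [IsProbabilityMeasure (ℙ : Measure Ωp)]
    (Ωs : Set (EucSp d)) (hΩo : IsOpen Ωs) (hΩb : Bornology.IsBounded Ωs)
    (κ : EucSp d → ℝ) (hκmeas : Measurable κ) (hκnn : ∀ x, 0 ≤ κ x)
    (hκ1 : ∫ x in Ωs, κ x = 1)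
    (hκball : ∃ c > 0, ∀ x ∈ Ωs, ∀ r : ℝ, 0 < r → r ≤ 1 →
      c * r ^ d ≤ ∫ y in Metric.closedBall x r, κ y)
    (h : EucSp d → ℝ) (hh : ContDiff ℝ 2 h)
    (hgrad : ∃ M, ∀ x ∈ Ωs, ‖gradient h x‖ ≤ M)
    (X : ℕ → Ωp → EucSp d) (hXmeas : ∀ i, Measurable (X i))
    (hiid : iIndepFun X ℙ)
    (hlaw : ∀ i, Measure.map (X i) ℙ
      = volume.withDensity fun x => ENNReal.ofReal (κ x))
    (J : ℕ → ℕ → ℕ → Ωp → ℕ) (hJmeas : ∀ i n k, Measurable (J i n k))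
    (hJ : IsNNIndex X J) (k : ℕ) (hk : 1 ≤ k) :
    Tendsto (fun n : ℕ =>
        (∫ ω, ⟪gradient h (X 0 ω), X (J 0 n k ω) ω - X 0 ω⟫ ^ 2 ∂ℙ) /
          (2 * ∫ ω, dist (X (J 0 n k ω) ω) (X 0 ω) ^ 2 ∂ℙ))
      atTop
      (𝓝 ((∫ x in Ωs, κ x ^ (((d : ℝ) - 2) / d) * ‖gradient h x‖ ^ 2) /
        (2 * d * ∫ x in Ωs, κ x ^ (((d : ℝ) - 2) / d)))) := by
  obtain ⟨c, hc, hcb⟩ := hκball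
  obtain ⟨M, hM⟩ := hgrad
  obtain ⟨m, rfl⟩ : ∃ m, k = m + 1 := ⟨k - 1, by omega⟩
  obtain ⟨μ, hμ⟩ : ∃ μ : Measure (EucSp d), μ = volume.withDensity fun x => ENNReal.ofReal (κ x) :=
    ⟨_, rfl⟩
  rw [← hμ] at hlaw
  have hd0 : (0:ℝ) < d := by exact_mod_cast hd
  have hprob : IsProbabilityMeasure μ := by
    rw [← hlaw 0]; exact Measure.isProbabilityMeasure_map (hXmeas 0).aemeasurable
  have hκm : Measurable fun x => ENNReal.ofReal (κ x) := hκmeas.ennreal_ofReal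
  have hΩm : MeasurableSet Ωs := hΩo.measurableSet
  have hκint : Integrable κ := by
    refine ⟨hκmeas.aestronglyMeasurable, ?_⟩
    rw [hasFiniteIntegral_iff_ofReal (Eventually.of_forall hκnn)]
    have : μ Set.univ = 1 := measure_univ
    rw [hμ, withDensity_apply _ MeasurableSet.univ, Measure.restrict_univ] at this
    rw [this]; exact ENNReal.one_lt_top
  have hset : ∀ S, MeasurableSet S → ∫ y in S, κ y = μ.real S := by
    intro S hS
    rw [measureReal_def, hμ, withDensity_apply _ hS,
      ← ofReal_integral_eq_lintegral_ofReal hκint.integrableOn (Eventually.of_forall hκnn),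
      ENNReal.toReal_ofReal (integral_nonneg hκnn)]
  have hμΩ : ∀ᵐ y ∂μ, y ∈ Ωs := by
    have h1 : μ.real Ωs = 1 := by rw [← hset _ hΩm, hκ1]
    have h2 := probReal_compl_eq_one_sub (μ := μ) hΩm
    rw [h1, sub_self, measureReal_eq_zero_iff] at h2
    exact h2
  have hac : μ ≪ volume := hμ ▸ withDensity_absolutelyContinuous _ _
  have hsph : ∀ x r, μ (Metric.sphere x r) = 0 := by
    intro x r
    have : Nonempty (Fin d) := ⟨⟨0, hd⟩⟩
    exact hac (Measure.addHaar_sphere _ x r)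
  have hIntg : ∀ x r, ∫ y in Metric.closedBall x r, κ y = μ.real (Metric.closedBall x r) :=
    fun x r => hset _ Metric.isClosed_closedBall.measurableSet
  have hbb : ∀ x r, μ.real (Metric.closedBall x r) = μ.real (Metric.ball x r) := by
    intro x r
    rw [measureReal_def, measureReal_def, ← Metric.closedBall_sdiff_sphere,
      measure_sdiff_null (hsph x r)]
  -- global lower bound
  obtain ⟨R, hR1, hR⟩ := (Metric.isBounded_iff_exists_ge 1).1 hΩb
  obtain ⟨c', hc'def⟩ : ∃ c', c' = c / R ^ d := ⟨_, rfl⟩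
  have hR0 : 0 < R := by linarith
  have hc' : 0 < c' := by rw [hc'def]; positivity
  have hRd : 1 ≤ R ^ d := one_le_pow₀ hR1
  have hball1 : ∀ x ∈ Ωs, ∀ y ∈ Ωs, c' * dist y x ^ d ≤ ballP μ (x, y) := by
    intro x hx y hy
    have hD : dist y x ≤ R := hR hy hx
    have hD0 : 0 ≤ dist y x := dist_nonneg
    have hcc : c' ≤ c := by rw [hc'def]; exact div_le_self hc.le hRd
    unfold ballP
    simp only
    rcases hD0.eq_or_lt with h0 | h0
    · rw [← h0, zero_pow (by omega), mul_zero]; exact measureReal_nonneg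
    rcases le_or_gt (dist y x) 1 with h1 | h1
    · have h2 := hcb x hx _ h0 h1
      rw [hIntg, hbb] at h2
      exact le_trans (by gcongr) h2
    · have h2 := hcb x hx 1 one_pos le_rfl
      rw [hIntg, hbb, one_pow, mul_one] at h2
      have h3 : μ.real (Metric.ball x 1) ≤ μ.real (Metric.ball x (dist y x)) :=
        measureReal_mono (Metric.ball_subset_ball h1.le)
      refine le_trans ?_ (h2.trans h3)
      rw [hc'def, div_mul_eq_mul_div, div_le_iff₀ (by positivity)]
      gcongr
  have hball : ∀ x ∈ Ωs, ∀ᵐ y ∂μ, c' * dist y x ^ d ≤ ballP μ (x, y) := by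
    intro x hx
    filter_upwards [hμΩ] with y hy using hball1 x hx y hy
  obtain ⟨θ, hθdef⟩ : ∃ θ, θ = volume.real (Metric.ball (0 : EucSp d) 1) := ⟨_, rfl⟩
  have hθ : 0 < θ := by
    rw [hθdef]
    exact ENNReal.toReal_pos (Metric.measure_ball_pos _ _ one_pos).ne' measure_ball_lt_top.ne
  have hleb := lebesgue_points hd κ hκmeas hκnn hκint μ hμ hsph hIntg
  rw [← hθdef] at hleb
  -- lower bound for the density on the domain
  have hpos : ∀ᵐ x, x ∈ Ωs → c ≤ κ x * θ := by
    filter_upwards [hleb] with x hx hxΩ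
    refine ge_of_tendsto hx.2 ?_
    filter_upwards [Ioc_mem_nhdsGT (show (0:ℝ) < 1 from one_pos)] with r hr
    have h2 := hcb x hxΩ r hr.1 hr.2
    rw [hIntg, hbb] at h2
    rwa [le_div_iff₀ (pow_pos hr.1 d)]
  obtain ⟨s, hsdef⟩ : ∃ s, s = 2 / (d:ℝ) := ⟨_, rfl⟩
  have hs : 0 ≤ s := by rw [hsdef]; positivity
  have hgm : Measurable (gradient h) := by
    have : Continuous (gradient h) := by
      unfold gradient
      exact (LinearIsometryEquiv.continuous _).comp (hh.continuous_fderiv (by norm_num))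
    exact this.measurable
  -- conversion of integrals
  have hconv : ∀ G : EucSp d → ℝ, ∫ x, κ x ^ (-s) * G x ∂μ =
      ∫ x in Ωs, κ x ^ (((d : ℝ) - 2) / d) * G x := by
    intro G
    have h1 : ∫ x, κ x ^ (-s) * G x ∂μ = ∫ x in Ωs, κ x ^ (-s) * G x ∂μ := by
      rw [Measure.restrict_eq_self_of_ae_mem hμΩ]
    rw [h1, hμ, setIntegral_withDensity_eq_setIntegral_toReal_smul hκm
      (Eventually.of_forall fun _ => ENNReal.ofReal_lt_top) _ hΩm]
    refine integral_congr_ae ?_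
    filter_upwards [(ae_restrict_iff' hΩm).2 hpos] with x hx
    have hκp : 0 < κ x := by
      by_contra hcon
      have : κ x = 0 := le_antisymm (not_lt.1 hcon) (hκnn x)
      rw [this, zero_mul] at hx
      linarith
    rw [ENNReal.toReal_ofReal (hκnn x), smul_eq_mul, ← mul_assoc]
    congr 1
    have h2 : ((d : ℝ) - 2) / d = 1 + -s := by rw [hsdef]; field_simp; ring
    rw [h2, Real.rpow_add hκp, Real.rpow_one]
  -- inner integrals
  have hgood : ∀ᵐ x ∂μ, x ∈ Ωs ∧ 0 < κ x * θ ∧ c ≤ κ x * θ ∧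
      Tendsto (fun r => ⨍ y in Metric.closedBall x r, ‖κ y - κ x‖) (𝓝[>] 0) (𝓝 0) ∧
      Tendsto (fun r => μ.real (Metric.ball x r) / r ^ d) (𝓝[>] 0) (𝓝 (κ x * θ)) := by
    filter_upwards [hμΩ, hac.ae_le hpos, hac.ae_le hleb] with x h1 h2 h3
    exact ⟨h1, hc.trans_le (h2 h1), h2 h1, h3.1, h3.2⟩
  have hfm : Measurable (Function.uncurry fun x y : EucSp d => dist y x ^ 2) := by
    unfold Function.uncurry; fun_prop
  have hgm' : Measurable (Function.uncurry fun x y : EucSp d => ⟪gradient h x, y - x⟫ ^ 2) := by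
    unfold Function.uncurry
    have : Measurable (fun p : EucSp d × EucSp d => gradient h p.1) := hgm.comp measurable_fst
    fun_prop
  have hden := outer_limit μ m (fun x y => dist y x ^ 2) hfm (fun x => (κ x * θ) ^ (-s))
    (c' ^ (-s)) hs (fun N => by
      filter_upwards [hμΩ] with x hx
      rw [abs_of_nonneg]
      · rw [hsdef]; exact uniform_bound hd μ hsph x m N hc' (hball x hx)
      · exact integral_nonneg fun y => mul_nonneg (by positivity)
          (betaW_nonneg N m (ballP_nonneg μ _) (ballP_le_one μ _))) (by
      filter_upwards [hgood] with x hx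
      rw [hsdef]
      exact radial_limit hd μ hsph x m hc' hx.2.1 (hball x hx.1) hx.2.2.2.2)
  have hnum := outer_limit μ m (fun x y => ⟪gradient h x, y - x⟫ ^ 2) hgm'
    (fun x => ‖gradient h x‖ ^ 2 / d * (κ x * θ) ^ (-s))
    (M ^ 2 * c' ^ (-s)) hs (fun N => by
      filter_upwards [hμΩ] with x hx
      rw [hsdef]
      exact dir_bound hd μ hsph _ x m N hc' (hM x hx) (hball x hx)) (by
      filter_upwards [hgood] with x hx
      rw [hsdef]
      exact dir_limit hd κ hκmeas hκnn hκint μ hμ hsph _ x m hc' hx.2.1 (hball x hx.1)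
        hx.2.2.2.2 hx.2.2.2.1)
  have hmul : ∀ x, (κ x * θ) ^ (-s) = κ x ^ (-s) * θ ^ (-s) := fun x =>
    Real.mul_rpow (hκnn x) hθ.le
  set I0 := ∫ x in Ωs, κ x ^ (((d : ℝ) - 2) / d) with hI0
  set I1 := ∫ x in Ωs, κ x ^ (((d : ℝ) - 2) / d) * ‖gradient h x‖ ^ 2 with hI1
  have hc0 : ∫ x, κ x ^ (-s) ∂μ = I0 := by simpa using hconv (fun _ => 1)
  have hL0 : ∫ x, (κ x * θ) ^ (-s) ∂μ = θ ^ (-s) * I0 := by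
    rw [← hc0, ← integral_const_mul]
    congr 1; ext x; rw [hmul, mul_comm]
  have hL1 : ∫ x, ‖gradient h x‖ ^ 2 / d * (κ x * θ) ^ (-s) ∂μ = θ ^ (-s) / d * I1 := by
    rw [hI1, ← hconv, ← integral_const_mul]
    congr 1; ext x; rw [hmul]; ring
  have hθs : 0 < θ ^ (-s) := Real.rpow_pos_of_pos hθ _
  have hDpos : 0 < θ ^ (-s) * I0 := by
    rw [← hL0, integral_pos_iff_support_of_nonneg_ae]
    · have : ∀ᵐ x ∂μ, x ∈ Function.support (fun x => (κ x * θ) ^ (-s)) := by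
        filter_upwards [hgood] with x hx
        exact (Real.rpow_pos_of_pos hx.2.1 _).ne'
      have h5 := measure_congr (eventuallyEq_univ.2 this : _ =ᵐ[μ] Set.univ)
      rw [measure_univ] at h5
      refine lt_of_lt_of_eq ?_ h5.symm
      exact one_pos
    · exact Eventually.of_forall fun x => Real.rpow_nonneg (mul_nonneg (hκnn x) hθ.le) _
    · refine (integrable_const (c ^ (-s))).mono'
        (((hκmeas.mul_const θ).pow_const (-s)).aestronglyMeasurable) ?_
      filter_upwards [hgood] with x hx
      rw [Real.norm_of_nonneg (Real.rpow_nonneg hx.2.1.le _)]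
      exact Real.rpow_le_rpow_of_nonpos hc hx.2.2.1 (by linarith)
  rw [hL0] at hden
  rw [hL1] at hnum
  have hI0pos : 0 < I0 := pos_of_mul_pos_right hDpos hθs.le
  have hlim := hnum.div (hden.const_mul 2) (by positivity)
  have hval : θ ^ (-s) / d * I1 / (2 * (θ ^ (-s) * I0)) = I1 / (2 * d * I0) := by
    field_simp
  rw [hval] at hlim
  rw [← tendsto_add_atTop_iff_nat (m + 2)]
  refine hlim.congr fun N => ?_
  have hprodΩ : ∀ᵐ z ∂(μ.prod μ), z.1 ∈ Ωs ∧ z.2 ∈ Ωs := by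
    have h1 : ∀ᵐ z ∂(μ.prod μ), z.1 ∈ Ωs := Measure.quasiMeasurePreserving_fst.ae hμΩ
    have h2 : ∀ᵐ z ∂(μ.prod μ), z.2 ∈ Ωs := Measure.quasiMeasurePreserving_snd.ae hμΩ
    filter_upwards [h1, h2] with z a b using ⟨a, b⟩
  have e0 := expect_eq μ hsph X hXmeas hiid hlaw J hJmeas hJ N m (fun x y => dist y x ^ 2) hfm
    (R ^ 2) (by
      filter_upwards [hprodΩ] with z hz
      rw [abs_of_nonneg (by positivity)]
      have := hR hz.2 hz.1
      gcongr)
  have e1 := expect_eq μ hsph X hXmeas hiid hlaw J hJmeas hJ N m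
    (fun x y => ⟪gradient h x, y - x⟫ ^ 2) hgm' ((M * R) ^ 2) (by
      filter_upwards [hprodΩ] with z hz
      have h1 := hR hz.2 hz.1
      have h2 := hM _ hz.1
      have h3 : 0 ≤ M := (norm_nonneg _).trans h2
      rw [abs_of_nonneg (by positivity), ← sq_abs]
      gcongr
      refine (abs_real_inner_le_norm _ _).trans ?_
      rw [← dist_eq_norm]
      gcongr)
  rw [show N + (m + 2) = N + m + 2 by ring, e0, e1]
  have hMp := betaM_pos hs N m
  simp only [Pi.div_apply]
  rw [← mul_div_assoc, div_div_div_cancel_right₀ hMp.ne']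
end
end

section
/- As n → ∞, n^{2/d}·E[(∇h(X_1)·(X_{j(1,n,k)} − X_1))²] converges to d^{−1}·ω_d^{−2/d}·(Γ(k + 2/d)/Γ(k))·∫_Ω κ(x)^{1−2/d} |∇h(x)|² dx. (This is the limit (5.16) established in the proof of Theorem 5.2, with the k-th nearest-neighbour moment E[ρ_k²] = ω_d^{−2/d} Γ(k+2/d)/Γ(k) substituted.) -/
open MeasureTheory ProbabilityTheory Filter Topology
open scoped RealInnerProductSpace

noncomputable section

lemma binom_pi {E ι : Type*} [MeasurableSpace E] [Fintype ι] [DecidableEq ι] (μ : Measure E)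
    [IsProbabilityMeasure μ] (B : Set E) (hB : MeasurableSet B) (m : ℕ) :
    (Measure.pi (fun _ : ι => μ)).real
      {z | (by classical exact (Finset.univ.filter (fun l => z l ∈ B)).card = m)}
      = (Fintype.card ι).choose m * μ.real B ^ m * (1 - μ.real B) ^ (Fintype.card ι - m) := by
  classical
  have hset : {z : ι → E | (Finset.univ.filter (fun l => z l ∈ B)).card = m}
      = ⋃ S ∈ Finset.powersetCard m (Finset.univ : Finset ι),
        Set.pi Set.univ (fun l => if l ∈ S then B else Bᶜ) := by
    ext z
    simp only [Set.mem_ofPred_eq, Set.mem_iUnion, Set.mem_pi, Set.mem_univ, true_imp_iff,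
      Finset.mem_powersetCard, Finset.subset_univ, true_and, exists_prop]
    constructor
    · intro h
      refine ⟨_, h, fun l => ?_⟩
      by_cases hl : z l ∈ B <;> simp [hl]
    · rintro ⟨S, hS, h⟩
      rw [← hS]
      congr 1
      ext l
      have := h l
      by_cases hl : l ∈ S <;> simp_all
  have hm : ∀ S : Finset ι, MeasurableSet (Set.pi Set.univ (fun l => if l ∈ S then B else Bᶜ)) := by
    intro S
    refine MeasurableSet.univ_pi (fun l => ?_)
    split_ifs
    · exact hB
    · exact hB.compl
  have e : {z : ι → E | (by classical exact (Finset.univ.filter (fun l => z l ∈ B)).card = m)}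
    = {z : ι → E | (Finset.univ.filter (fun l => z l ∈ B)).card = m} := by
    ext z; simp only [Set.mem_ofPred_eq]
  rw [e, hset, measureReal_biUnion_finset]
  · have : ∀ S ∈ Finset.powersetCard m (Finset.univ : Finset ι),
        (Measure.pi (fun _ : ι => μ)).real (Set.pi Set.univ (fun l => if l ∈ S then B else Bᶜ))
        = μ.real B ^ m * (1 - μ.real B) ^ (Fintype.card ι - m) := by
      intro S hS
      rw [Finset.mem_powersetCard] at hS
      rw [measureReal_def, Measure.pi_pi, ENNReal.toReal_prod]
      have : ∀ l, (μ (if l ∈ S then B else Bᶜ)).toReal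
          = if l ∈ S then μ.real B else (1 - μ.real B) := by
        intro l
        split_ifs
        · rfl
        · exact probReal_compl_eq_one_sub hB
      simp only [this]
      rw [Finset.prod_ite]
      simp only [Finset.prod_const]
      have h1 : (Finset.univ.filter (fun l => l ∈ S)) = S := by ext; simp
      have h2 : (Finset.univ.filter (fun l => l ∉ S)) = Sᶜ := by ext; simp
      rw [h1, h2, Finset.card_compl, hS.2]
    rw [Finset.sum_congr rfl this]
    simp [Finset.card_powersetCard, mul_assoc]
  · intro S hS S' hS' hne
    rw [Function.onFun, Set.disjoint_left]
    intro z hz hz'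
    apply hne
    ext l
    have h1 := hz l trivial
    have h2 := hz' l trivial
    by_cases a : l ∈ S <;> by_cases b : l ∈ S' <;> simp_all
  · intro S _
    exact hm S

lemma joint_term {E Ωp : Type*} [MeasurableSpace E] [PseudoMetricSpace E] [BorelSpace E]
    [SecondCountableTopology E]
    [MeasureSpace Ωp] [IsProbabilityMeasure (ℙ : Measure Ωp)]
    (μ : Measure E) [IsProbabilityMeasure μ]
    (X : ℕ → Ωp → E) (hXmeas : ∀ i, Measurable (X i))
    (hiid : iIndepFun X ℙ) (hlaw : ∀ i, Measure.map (X i) ℙ = μ)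
    (F : E × E → ℝ) (hF : Measurable F) (B : ℝ) (hFB : ∀ z, ‖F z‖ ≤ B)
    (T : Finset ℕ) (j : ℕ) (hj : j ≠ 0) (h0T : 0 ∉ T) (hjT : j ∉ T) (m : ℕ) :
    ∫ ω, (if (T.filter fun l => dist (X l ω) (X 0 ω) < dist (X j ω) (X 0 ω)).card = m
      then F (X 0 ω, X j ω) else 0) ∂ℙ
    = ∫ x, ∫ y, F (x, y) * (T.card.choose m * μ.real (Metric.ball x (dist y x)) ^ m *
        (1 - μ.real (Metric.ball x (dist y x))) ^ (T.card - m)) ∂μ ∂μ := by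
  classical
  let U : Ωp → E × E := fun ω => (X 0 ω, X j ω)
  let Z : Ωp → (T → E) := fun ω l => X l ω
  have hU : Measurable U := (hXmeas 0).prodMk (hXmeas j)
  have hZ : Measurable Z := measurable_pi_lambda _ (fun l => hXmeas l)
  have hmapU : Measure.map U ℙ = μ.prod μ := by
    have := (indepFun_iff_map_prod_eq_prod_map_map (hXmeas 0).aemeasurable
      (hXmeas j).aemeasurable).1 (hiid.indepFun (Ne.symm hj))
    rw [hlaw, hlaw] at this
    exact this
  have hmapZ : Measure.map Z ℙ = Measure.pi (fun _ : T => μ) := by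
    have h1 : iIndepFun (fun l : T => X l) ℙ := hiid.precomp Subtype.val_injective
    have := (iIndepFun_iff_map_fun_eq_pi_map (fun l : T => (hXmeas l).aemeasurable)).1 h1
    simp only [hlaw] at this
    exact this
  have hUZ : IndepFun U Z ℙ := by
    have hd : Disjoint ({0, j} : Finset ℕ) T := by
      rw [Finset.disjoint_left]
      intro a ha
      simp only [Finset.mem_insert, Finset.mem_singleton] at ha
      rcases ha with rfl | rfl <;> assumption
    have h1 := hiid.indepFun_finset {0, j} T hd hXmeas
    have h2 : Measurable (fun z : ({0, j} : Finset ℕ) → E =>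
        ((z ⟨0, by simp⟩, z ⟨j, by simp⟩) : E × E)) := by fun_prop
    exact h1.comp h2 measurable_id
  have hmap : Measure.map (fun ω => (U ω, Z ω)) ℙ = (μ.prod μ).prod (Measure.pi (fun _ : T => μ)) := by
    rw [(indepFun_iff_map_prod_eq_prod_map_map hU.aemeasurable hZ.aemeasurable).1 hUZ, hmapU, hmapZ]
  let S : Set ((E × E) × (T → E)) :=
    {q | (Finset.univ.filter (fun l => q.2 l ∈ Metric.ball q.1.1 (dist q.1.2 q.1.1))).card = m}
  have hS : MeasurableSet S := by
    have : Measurable (fun q : (E × E) × (T → E) =>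
        (Finset.univ.filter (fun l => q.2 l ∈ Metric.ball q.1.1 (dist q.1.2 q.1.1))).card) := by
      simp only [Finset.card_filter]
      refine Finset.measurable_fun_sum _ (fun l _ => ?_)
      refine Measurable.ite ?_ measurable_const measurable_const
      simp only [Metric.mem_ball]
      exact measurableSet_lt (by fun_prop) (by fun_prop)
    exact this (measurableSet_singleton m)
  let Φ : (E × E) × (T → E) → ℝ := S.indicator (fun q => F q.1)
  have hΦ : Measurable Φ := (hF.comp measurable_fst).indicator hS
  have hΦi : Integrable Φ ((μ.prod μ).prod (Measure.pi (fun _ : T => μ))) := by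
    refine Integrable.of_bound hΦ.aestronglyMeasurable B (Eventually.of_forall fun q => ?_)
    refine (norm_indicator_le_norm_self _ _).trans (hFB _)
  have e1 : ∀ ω, (if (T.filter fun l => dist (X l ω) (X 0 ω) < dist (X j ω) (X 0 ω)).card = m
      then F (X 0 ω, X j ω) else 0) = Φ (U ω, Z ω) := by
    intro ω
    have hc : (T.filter fun l => dist (X l ω) (X 0 ω) < dist (X j ω) (X 0 ω)).card
      = (Finset.univ.filter (fun l : T => X l ω ∈ Metric.ball (X 0 ω) (dist (X j ω) (X 0 ω)))).card := by
      simp only [Metric.mem_ball]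
      rw [Finset.card_filter, Finset.card_filter]
      exact (Finset.sum_coe_sort T (fun l => if dist (X l ω) (X 0 ω) < dist (X j ω) (X 0 ω) then 1 else 0)).symm
    rw [hc]
    simp only [Φ, Set.indicator, S, U, Z, Set.mem_ofPred_eq]
  have e2 : ∫ ω, Φ (U ω, Z ω) ∂ℙ = ∫ q, Φ q ∂((μ.prod μ).prod (Measure.pi (fun _ : T => μ))) := by
    rw [← hmap, integral_map (hU.prodMk hZ).aemeasurable hΦ.aestronglyMeasurable]
  have e3 : ∀ u : E × E, ∫ z, Φ (u, z) ∂(Measure.pi (fun _ : T => μ)) =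
      F u * (T.card.choose m * μ.real (Metric.ball u.1 (dist u.2 u.1)) ^ m *
        (1 - μ.real (Metric.ball u.1 (dist u.2 u.1))) ^ (T.card - m)) := by
    intro u
    have hm : MeasurableSet {z : T → E | (u, z) ∈ S} := hS.preimage measurable_prodMk_left
    have : (fun z => Φ (u, z)) = {z : T → E | (u, z) ∈ S}.indicator (fun _ => F u) := by
      ext z
      simp [Φ, Set.indicator]
    rw [this, integral_indicator_const _ hm, smul_eq_mul, mul_comm]
    congr 1
    have := binom_pi (ι := T) μ (Metric.ball u.1 (dist u.2 u.1)) measurableSet_ball m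
    rw [Fintype.card_coe] at this
    rw [← this]
    congr 1
  calc _ = ∫ ω, Φ (U ω, Z ω) ∂ℙ := integral_congr_ae (Eventually.of_forall e1)
    _ = _ := by
      have hi2 := hΦi.integral_prod_left
      rw [e2, integral_prod _ hΦi, integral_prod _ hi2]
      simp only [e3]


lemma nn_formula {E Ωp : Type*} [MeasurableSpace E] [MetricSpace E] [BorelSpace E]
    [SecondCountableTopology E]
    [MeasureSpace Ωp] [IsProbabilityMeasure (ℙ : Measure Ωp)]
    (μ : Measure E) [IsProbabilityMeasure μ] (hsph : ∀ x r, μ (Metric.sphere x r) = 0)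
    (X : ℕ → Ωp → E) (hXmeas : ∀ i, Measurable (X i))
    (hiid : iIndepFun X ℙ) (hlaw : ∀ i, Measure.map (X i) ℙ = μ)
    (F : E × E → ℝ) (hF : Measurable F) (B : ℝ) (hFB : ∀ z, ‖F z‖ ≤ B)
    (n m : ℕ) (J : Ωp → ℕ)
    (hJ : ∀ᵐ ω ∂ℙ, J ω < n ∧ J ω ≠ 0 ∧ ((Finset.range n).filter fun ℓ => ℓ ≠ 0 ∧
        dist (X ℓ ω) (X 0 ω) < dist (X (J ω) ω) (X 0 ω)).card = m) :
    ∫ ω, F (X 0 ω, X (J ω) ω) ∂ℙ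
    = (n - 1 : ℕ) * ∫ x, ∫ y, F (x, y) * ((n - 2).choose m * μ.real (Metric.ball x (dist y x)) ^ m *
        (1 - μ.real (Metric.ball x (dist y x))) ^ (n - 2 - m)) ∂μ ∂μ := by
  classical
  let R : Finset ℕ := (Finset.range n).erase 0
  have hRcard : ∀ j ∈ R, (R.erase j).card = n - 2 ∧ R.card = n - 1 := by
    intro j hj
    have h2 : R.card = n - 1 := by
      have : 0 ∈ Finset.range n := by
        simp only [R, Finset.mem_erase, Finset.mem_range] at hj ⊢; omega
      simp [R, Finset.card_erase_of_mem this]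
    rw [Finset.card_erase_of_mem hj, h2]
    exact ⟨by omega, rfl⟩
  let c : ℕ → Ωp → Finset ℕ := fun j ω =>
    (R.erase j).filter fun l => dist (X l ω) (X 0 ω) < dist (X j ω) (X 0 ω)
  have hties : ∀ᵐ ω ∂ℙ, ∀ i ∈ R, ∀ j ∈ R, i ≠ j → dist (X i ω) (X 0 ω) ≠ dist (X j ω) (X 0 ω) := by
    have key : ∀ i ∈ R, ∀ j ∈ R, i ≠ j →
        ∀ᵐ ω ∂ℙ, dist (X i ω) (X 0 ω) ≠ dist (X j ω) (X 0 ω) := by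
      intro i hi j hj hij
      have hi0 : i ≠ 0 := by simp only [R, Finset.mem_erase] at hi; exact hi.1
      have hj0 : j ≠ 0 := by simp only [R, Finset.mem_erase] at hj; exact hj.1
      have hind := hiid.indepFun_prodMk hXmeas 0 j i hi0.symm hij.symm
      have h2 := (indepFun_iff_map_prod_eq_prod_map_map
        ((hXmeas 0).prodMk (hXmeas j)).aemeasurable (hXmeas i).aemeasurable).1 hind
      let S : Set ((E × E) × E) := {q | dist q.2 q.1.1 = dist q.1.2 q.1.1}
      have hS : MeasurableSet S := measurableSet_eq_fun (by fun_prop) (by fun_prop)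
      have hS0 : Measure.map (fun ω => ((X 0 ω, X j ω), X i ω)) ℙ S = 0 := by
        rw [h2, hlaw, Measure.measure_prod_null hS]
        refine Eventually.of_forall fun u => ?_
        exact hsph u.1 (dist u.2 u.1)
      rw [Measure.map_apply (((hXmeas 0).prodMk (hXmeas j)).prodMk (hXmeas i)) hS] at hS0
      rw [ae_iff]
      simpa [S] using hS0
    have : ∀ᵐ ω ∂ℙ, ∀ i : R, ∀ j : R, i.1 ≠ j.1 → dist (X i ω) (X 0 ω) ≠ dist (X j ω) (X 0 ω) := by
      rw [ae_all_iff]; intro i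
      rw [ae_all_iff]; intro j
      by_cases hij : i.1 = j.1
      · simp [hij]
      · filter_upwards [key i i.2 j j.2 hij] with ω h _ using h
    filter_upwards [this] with ω h i hi j hj using h ⟨i, hi⟩ ⟨j, hj⟩
  have hsum : ∀ᵐ ω ∂ℙ, F (X 0 ω, X (J ω) ω)
      = ∑ j ∈ R, if (c j ω).card = m then F (X 0 ω, X j ω) else 0 := by
    filter_upwards [hties, hJ] with ω ht hJω
    obtain ⟨hJn, hJ0, hJc⟩ := hJω
    have hJR : J ω ∈ R := by simp [R, hJn, hJ0]
    have hcJ : (c (J ω) ω).card = m := by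
      rw [← hJc]
      congr 1
      ext l
      simp only [c, R, Finset.mem_filter, Finset.mem_erase, Finset.mem_range]
      constructor
      · rintro ⟨⟨_, h1, h2⟩, h3⟩; exact ⟨h2, h1, h3⟩
      · rintro ⟨h2, h1, h3⟩
        refine ⟨⟨?_, h1, h2⟩, h3⟩
        rintro rfl
        exact lt_irrefl _ h3
    rw [Finset.sum_eq_single (J ω)]
    · rw [if_pos hcJ]
    · intro j hj hne
      rw [if_neg]
      intro hcj
      have hlt : ∀ a ∈ R, ∀ b ∈ R, dist (X a ω) (X 0 ω) < dist (X b ω) (X 0 ω) →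
          (c a ω).card < (c b ω).card := by
        intro a ha b hb hab
        apply Finset.card_lt_card
        rw [Finset.ssubset_iff_of_subset]
        · refine ⟨a, ?_, ?_⟩
          · simp only [c, Finset.mem_filter, Finset.mem_erase]
            refine ⟨⟨?_, ha⟩, hab⟩
            rintro rfl; exact lt_irrefl _ hab
          · simp [c]
        · intro l hl
          simp only [c, Finset.mem_filter, Finset.mem_erase] at hl ⊢
          have := hl.2.trans hab
          refine ⟨⟨?_, hl.1.2⟩, this⟩
          rintro rfl; exact lt_irrefl _ this
      rcases lt_trichotomy (dist (X j ω) (X 0 ω)) (dist (X (J ω) ω) (X 0 ω)) with h | h | h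
      · have := hlt _ hj _ hJR h; omega
      · exact ht _ hj _ hJR hne h
      · have := hlt _ hJR _ hj h; omega
    · intro h; exact absurd hJR h
  rw [integral_congr_ae hsum, integral_finsetSum]
  · have : ∀ j ∈ R, ∫ ω, (if (c j ω).card = m then F (X 0 ω, X j ω) else 0) ∂ℙ =
        ∫ x, ∫ y, F (x, y) * ((n - 2).choose m * μ.real (Metric.ball x (dist y x)) ^ m *
        (1 - μ.real (Metric.ball x (dist y x))) ^ (n - 2 - m)) ∂μ ∂μ := by
      intro j hj
      have := joint_term μ X hXmeas hiid hlaw F hF B hFB (R.erase j) j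
        (by simp only [R, Finset.mem_erase] at hj; exact hj.1) (by simp [R]) (by simp) m
      rw [(hRcard j hj).1] at this
      exact this
    rw [Finset.sum_congr rfl this, Finset.sum_const, nsmul_eq_mul]
    rcases R.eq_empty_or_nonempty with h | ⟨j, hj⟩
    · have : n - 1 = 0 := by
        by_contra hn
        have : 1 ∈ R := by simp only [R, Finset.mem_erase, Finset.mem_range]; omega
        rw [h] at this; simp at this
      simp [h, this]
    · rw [(hRcard j hj).2]
  · intro j _
    refine Integrable.of_bound ?_ B (Eventually.of_forall fun ω => ?_)
    · refine Measurable.aestronglyMeasurable ?_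
      refine Measurable.ite ?_ (hF.comp ((hXmeas 0).prodMk (hXmeas j))) measurable_const
      have : Measurable (fun ω => (c j ω).card) := by
        simp only [c, Finset.card_filter]
        refine Finset.measurable_fun_sum _ (fun l _ => ?_)
        refine Measurable.ite ?_ measurable_const measurable_const
        exact measurableSet_lt ((hXmeas l).dist (hXmeas 0)) ((hXmeas j).dist (hXmeas 0))
      exact this (measurableSet_singleton m)
    · split_ifs
      · exact hFB _
      · simpa using (norm_nonneg _).trans (hFB (X 0 ω, X j ω))


lemma layer_formula {E : Type*} [MeasurableSpace E] (μ : Measure E) [IsProbabilityMeasure μ]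
    (f F : E → ℝ) (hf : Measurable f) (hf0 : ∀ y, 0 ≤ f y) (hf1 : ∀ y, f y ≤ 1)
    (hF : Measurable F) (B : ℝ) (hFB : ∀ z, ‖F z‖ ≤ B)
    (w v : ℝ → ℝ) (hw : ∀ s, HasDerivAt w (v s) s) (hv : Continuous v) (hw1 : w 1 = 0) :
    ∫ y, F y * w (f y) ∂μ = - ∫ t in Set.Ioc (0:ℝ) 1, v t * ∫ y in {y | f y ≤ t}, F y ∂μ := by
  obtain ⟨C, hC⟩ := (isCompact_Icc (a := (0:ℝ)) (b := 1)).exists_bound_of_continuousOn hv.continuousOn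
  have hms : ∀ t, MeasurableSet {y | f y ≤ t} := fun t => measurableSet_le hf measurable_const
  have e1 : ∀ y, F y * w (f y) = - ∫ t in Set.Ioc (0:ℝ) 1, v t * ({y | f y ≤ t}.indicator F y) := by
    intro y
    have h1 : ∫ t in (f y)..1, v t = w 1 - w (f y) :=
      intervalIntegral.integral_eq_sub_of_hasDerivAt (fun s _ => hw s) (hv.intervalIntegrable _ _)
    have h2 : ∀ t, v t * ({y | f y ≤ t}.indicator F y) = (Set.Ici (f y)).indicator (fun t => v t * F y) t := by
      intro t
      by_cases h : f y ≤ t <;> simp [Set.indicator, h]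
    simp only [h2]
    rw [setIntegral_indicator measurableSet_Ici]
    have h3 : (Set.Ioc 0 1 ∩ Set.Ici (f y) : Set ℝ) =ᵐ[volume] Set.Ioc (f y) 1 := by
      have : (Set.Ioc 0 1 ∩ Set.Ioi (f y) : Set ℝ) = Set.Ioc (f y) 1 := by
        ext t; simp only [Set.mem_inter_iff, Set.mem_Ioc, Set.mem_Ioi]
        have := hf0 y
        constructor
        · rintro ⟨⟨a, b⟩, c⟩; exact ⟨c, b⟩
        · rintro ⟨a, b⟩; exact ⟨⟨by linarith, b⟩, a⟩
      rw [← this]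
      exact (ae_eq_refl _).inter Ioi_ae_eq_Ici.symm
    rw [setIntegral_congr_set h3, integral_mul_const, ← intervalIntegral.integral_of_le (hf1 y), h1, hw1]
    ring
  simp only [e1]
  rw [integral_neg]
  congr 1
  rw [integral_integral_swap]
  · congr 1
    ext t
    rw [integral_const_mul, integral_indicator (hms t)]
  · refine Integrable.of_bound ?_ (C * B) ?_
    · refine Measurable.aestronglyMeasurable ?_
      have : (Function.uncurry fun y t => v t * ({y | f y ≤ t}.indicator F y))
        = {q : E × ℝ | f q.1 ≤ q.2}.indicator (fun q => v q.2 * F q.1) := by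
        ext ⟨y, t⟩
        by_cases h : f y ≤ t <;> simp [Set.indicator, h]
      rw [this]
      refine Measurable.indicator ?_ (measurableSet_le (by fun_prop) (by fun_prop))
      have := hv.measurable
      fun_prop
    · have hae : ∀ᵐ q ∂(μ.prod (volume.restrict (Set.Ioc (0:ℝ) 1))), q.2 ∈ Set.Ioc (0:ℝ) 1 := by
        have h0 : ∀ᵐ t ∂(volume.restrict (Set.Ioc (0:ℝ) 1)), t ∈ Set.Ioc (0:ℝ) 1 :=
          ae_restrict_mem measurableSet_Ioc
        exact Measure.quasiMeasurePreserving_snd.ae h0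
      filter_upwards [hae] with q hq
      obtain ⟨y, t⟩ := q
      simp only [Function.uncurry, norm_mul]
      refine mul_le_mul (hC t ⟨hq.1.le, hq.2⟩) ((norm_indicator_le_norm_self _ _).trans (hFB _)) (norm_nonneg _) ?_
      exact (norm_nonneg _).trans (hC 0 (by simp))


/-- derivative of the weight -/
def vW (N m : ℕ) (t : ℝ) : ℝ :=
  (N + m + 1) * ((N + m).choose m : ℝ) * (m * t ^ (m - 1) * (1 - t) ^ N - N * t ^ m * (1 - t) ^ (N - 1))

def coefA (m N : ℕ) : ℝ := (N + m + 1) * ((N + m).choose m : ℝ) / (N : ℝ) ^ (m + 1)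

lemma coefA_tendsto (m : ℕ) : Tendsto (coefA m) atTop (𝓝 (1 / m.factorial)) := by
  have hp : Tendsto (fun n : ℕ => (n : ℝ) * ((n : ℝ) - m)⁻¹) atTop (𝓝 1) := by
    have h0 : Tendsto (fun n : ℕ => (n : ℝ)) atTop atTop := tendsto_natCast_atTop_atTop
    have h1 : Tendsto (fun x : ℝ => x - m) atTop atTop := tendsto_atTop_add_const_right _ _ tendsto_id
    have h2 : Tendsto (fun n : ℕ => 1 + m * ((n : ℝ) - m)⁻¹) atTop (𝓝 (1 + m * 0)) :=
      ((tendsto_inv_atTop_zero.comp (h1.comp h0)).const_mul _).const_add _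
    rw [mul_zero, add_zero] at h2
    refine h2.congr' ?_
    filter_upwards [eventually_gt_atTop m] with n hn
    have : (0:ℝ) < (n : ℝ) - m := by rw [sub_pos]; exact_mod_cast hn
    field_simp
    ring
  have h1 := tendsto_choose_mul_pow_atTop m hp
  have h2 := h1.comp (tendsto_add_atTop_nat m)
  have h3 : Tendsto (fun N : ℕ => 1 + (m + 1 : ℝ) * (N : ℝ)⁻¹) atTop (𝓝 (1 + (m + 1 : ℝ) * 0)) :=
    ((tendsto_inv_atTop_zero.comp tendsto_natCast_atTop_atTop).const_mul _).const_add _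
  have h4 := h3.mul h2
  simp only [mul_zero, add_zero, one_pow, one_mul] at h4
  refine h4.congr' ?_
  filter_upwards [eventually_gt_atTop 0] with N hN
  have : (0:ℝ) < N := by exact_mod_cast hN
  simp only [Function.comp, coefA]
  push_cast
  rw [add_sub_cancel_right, inv_pow]
  field_simp
  ring

lemma coefA_nonneg (m N : ℕ) : 0 ≤ coefA m N := by unfold coefA; positivity

lemma coefA_bdd (m : ℕ) : ∃ A, 0 ≤ A ∧ ∀ N, coefA m N ≤ A := by
  obtain ⟨A, hA⟩ := (coefA_tendsto m).bddAbove_range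
  exact ⟨A, (coefA_nonneg m 0).trans (hA ⟨0, rfl⟩), fun N => hA ⟨N, rfl⟩⟩

def phiW (m : ℕ) (α : ℝ) (G : ℝ → ℝ) (N : ℕ) (s : ℝ) : ℝ :=
  (Set.Ioc (0:ℝ) N).indicator (fun s => coefA m N *
    (m * s ^ (m - 1) * (1 - s / N) ^ N - s ^ m * (1 - s / N) ^ (N - 1)) *
      ((N:ℝ) ^ (1 + α) * G (s / N))) s

lemma scaled (m : ℕ) (α : ℝ) (G : ℝ → ℝ) (N : ℕ) (hN : 0 < N) :
    (N : ℝ) ^ α * ∫ t in Set.Ioc (0:ℝ) 1, vW N m t * G t = ∫ s in Set.Ioi (0:ℝ), phiW m α G N s := by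
  have hN' : (0:ℝ) < N := by exact_mod_cast hN
  let H : ℝ → ℝ := (Set.Ioc (0:ℝ) 1).indicator (fun t => vW N m t * G t)
  have h1 : ∫ t in Set.Ioc (0:ℝ) 1, vW N m t * G t = ∫ t in Set.Ioi (0:ℝ), H t := by
    rw [setIntegral_indicator measurableSet_Ioc]
    congr 2
    ext t; simp
  have h2 := integral_comp_mul_left_Ioi H 0 (inv_pos.2 hN')
  rw [mul_zero, inv_inv, smul_eq_mul] at h2
  have h3 : ∀ s, phiW m α G N s = (N:ℝ) ^ (α - 1) * H ((N:ℝ)⁻¹ * s) := by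
    intro s
    have hmem : (N:ℝ)⁻¹ * s ∈ Set.Ioc (0:ℝ) 1 ↔ s ∈ Set.Ioc (0:ℝ) N := by
      simp only [Set.mem_Ioc]
      rw [inv_mul_le_iff₀ hN', mul_one]
      refine and_congr_left fun _ => ?_
      exact mul_pos_iff_of_pos_left (inv_pos.2 hN')
    by_cases hs : s ∈ Set.Ioc (0:ℝ) N
    · have hs' := hmem.2 hs
      simp only [phiW, H, Set.indicator_of_mem hs, Set.indicator_of_mem hs']
      have e : (N:ℝ)⁻¹ * s = s / N := by ring
      have e2 : (N:ℝ) ^ (1 + α) = (N:ℝ) ^ (α - 1) * (N:ℝ) ^ 2 := by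
        rw [← Real.rpow_natCast, ← Real.rpow_add hN']; congr 1; push_cast; ring
      rw [e, e2]
      have e3 : coefA m N *
          (m * s ^ (m - 1) * (1 - s / N) ^ N - s ^ m * (1 - s / N) ^ (N - 1)) * (N:ℝ) ^ 2
          = vW N m (s / N) := by
        rcases m with _ | m
        · simp only [coefA, vW]
          field_simp
          simp
          ring
        · simp only [coefA, vW, Nat.add_sub_cancel, div_pow]
          field_simp
          ring
      rw [← e3]; ring
    · have hs' := fun h => hs (hmem.1 h)
      simp only [phiW, H, Set.indicator_of_notMem hs, Set.indicator_of_notMem hs', mul_zero]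
  simp only [h3]
  rw [integral_const_mul, h2, h1, Real.rpow_sub_one hN'.ne']
  field_simp

def bdW (m : ℕ) (α : ℝ) (s : ℝ) : ℝ :=
  (m * s ^ (m - 1) + s ^ m) * Real.exp (-s / 2) * s ^ (1 + α)

lemma bdW_integrable (m : ℕ) (α : ℝ) (hα : 0 ≤ α) : IntegrableOn (bdW m α) (Set.Ioi 0) := by
  have h : ∀ j : ℕ, IntegrableOn (fun s : ℝ => s ^ (j + (1 + α)) * Real.exp (-(1/2) * s ^ (1:ℝ))) (Set.Ioi 0) :=
    fun j => integrableOn_rpow_mul_exp_neg_mul_rpow (by linarith [Nat.cast_nonneg (α := ℝ) j]) one_pos (by norm_num)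
  refine IntegrableOn.congr_fun (((h (m-1)).const_mul (m:ℝ)).add (h m)) ?_ measurableSet_Ioi
  intro s hs
  have hs : 0 < s := hs
  simp only [bdW, Pi.add_apply, Real.rpow_one]
  rw [Real.rpow_add hs ((m - 1 : ℕ) : ℝ) (1 + α), Real.rpow_add hs (m : ℝ) (1 + α), Real.rpow_natCast, Real.rpow_natCast]
  have : -(1/2) * s = -s/2 := by ring
  rw [this]; ring

lemma phiW_bound (m : ℕ) (α : ℝ) (G : ℝ → ℝ) (K A : ℝ) (hA : ∀ N, coefA m N ≤ A)
    (hK : ∀ t ∈ Set.Ioc (0:ℝ) 1, |G t| ≤ K * t ^ (1 + α)) (N : ℕ) (hN : 2 ≤ N) (s : ℝ) (hs : 0 < s) :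
    ‖phiW m α G N s‖ ≤ A * K * bdW m α s := by
  have hN2 : (2:ℝ) ≤ N := by exact_mod_cast hN
  have hN' : (0:ℝ) < N := by linarith
  have hA0 : 0 ≤ A := (coefA_nonneg m 0).trans (hA 0)
  have hK0 : 0 ≤ K := by
    have := hK 1 (by simp); simp only [Real.one_rpow, mul_one] at this
    exact (abs_nonneg _).trans this
  by_cases hsN : s ∈ Set.Ioc (0:ℝ) N
  · simp only [phiW, Set.indicator_of_mem hsN, norm_mul, Real.norm_eq_abs]
    have hmem : s / N ∈ Set.Ioc (0:ℝ) 1 := ⟨by positivity, by rw [div_le_one hN']; exact hsN.2⟩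
    have h1 : |(N:ℝ) ^ (1 + α)| * |G (s / N)| ≤ K * s ^ (1 + α) := by
      rw [abs_of_nonneg (by positivity)]
      calc _ ≤ (N:ℝ) ^ (1 + α) * (K * (s / N) ^ (1 + α)) := by gcongr; exact hK _ hmem
        _ = K * s ^ (1 + α) := by
          rw [Real.div_rpow hs.le hN'.le]
          have : (N:ℝ) ^ (1 + α) ≠ 0 := by positivity
          field_simp
    have h0 : 0 ≤ 1 - s / N := by linarith [hmem.2]
    have hexp : ∀ j : ℕ, (N:ℝ) ≤ 2 * j → (1 - s / N) ^ j ≤ Real.exp (-s / 2) := by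
      intro j hj
      calc (1 - s / N) ^ j ≤ (Real.exp (-(s / N))) ^ j := by
            gcongr
            linarith [Real.add_one_le_exp (-(s / N))]
        _ = Real.exp (j * (-(s / N))) := by rw [Real.exp_nat_mul]
        _ ≤ _ := by
          apply Real.exp_le_exp.2
          have : s / 2 ≤ j * (s / N) := by
            rw [mul_div_assoc', div_le_div_iff₀ (by norm_num) hN']
            nlinarith
          linarith
    have h2 : |(m * s ^ (m - 1) * (1 - s / N) ^ N - s ^ m * (1 - s / N) ^ (N - 1))|
        ≤ (m * s ^ (m - 1) + s ^ m) * Real.exp (-s / 2) := by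
      have a1 := hexp N (by linarith)
      have a2 := hexp (N - 1) (by rw [Nat.cast_sub (by omega)]; push_cast; linarith)
      refine (abs_sub _ _).trans ?_
      rw [abs_of_nonneg (by positivity), abs_of_nonneg (by positivity), add_mul]
      gcongr
    rw [abs_of_nonneg (coefA_nonneg m N)]
    calc _ ≤ A * ((m * s ^ (m - 1) + s ^ m) * Real.exp (-s / 2)) * (K * s ^ (1 + α)) := by
          gcongr
          exact hA N
      _ = _ := by unfold bdW; ring
  · simp only [phiW, Set.indicator_of_notMem hsN, norm_zero]
    unfold bdW; positivity

lemma asymp_bound (m : ℕ) (α : ℝ) (hα : 0 ≤ α) : ∃ A : ℝ, ∀ (G : ℝ → ℝ) (K : ℝ),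
    (∀ t ∈ Set.Ioc (0:ℝ) 1, |G t| ≤ K * t ^ (1 + α)) → ∀ N : ℕ, 2 ≤ N →
    ‖(N : ℝ) ^ α * (- ∫ t in Set.Ioc (0:ℝ) 1, vW N m t * G t)‖ ≤ A * K := by
  obtain ⟨A, hA0, hA⟩ := coefA_bdd m
  refine ⟨A * ∫ s in Set.Ioi (0:ℝ), bdW m α s, fun G K hK N hN => ?_⟩
  rw [mul_neg, norm_neg, scaled m α G N (by omega)]
  calc _ ≤ ∫ s in Set.Ioi (0:ℝ), A * K * bdW m α s := by
        refine norm_integral_le_of_norm_le ((bdW_integrable m α hα).const_mul _) ?_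
        filter_upwards [ae_restrict_mem measurableSet_Ioi] with s hs
        exact phiW_bound m α G K A hA hK N hN s hs
    _ = _ := by rw [integral_const_mul]; ring

lemma asymp (m : ℕ) (α : ℝ) (hα : 0 ≤ α) (G : ℝ → ℝ) (hG : Measurable G) (K C : ℝ)
    (hK : ∀ t ∈ Set.Ioc (0:ℝ) 1, |G t| ≤ K * t ^ (1 + α))
    (hC : Tendsto (fun t => G t / t ^ (1 + α)) (𝓝[>] 0) (𝓝 C)) :
    Tendsto (fun N : ℕ => (N : ℝ) ^ α * (- ∫ t in Set.Ioc (0:ℝ) 1, vW N m t * G t)) atTop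
      (𝓝 (C * (1 + α) * (Real.Gamma (m + 1 + α) / m.factorial))) := by
  obtain ⟨A, hA0, hA⟩ := coefA_bdd m
  have hlim : ∫ s in Set.Ioi (0:ℝ), (1 / m.factorial : ℝ) *
      (m * s ^ (m - 1) * Real.exp (-s) - s ^ m * Real.exp (-s)) * (C * s ^ (1 + α))
      = - (C * (1 + α) * (Real.Gamma (m + 1 + α) / m.factorial)) := by
    have e1 : ∀ s ∈ Set.Ioi (0:ℝ), (1 / m.factorial : ℝ) *
      (m * s ^ (m - 1) * Real.exp (-s) - s ^ m * Real.exp (-s)) * (C * s ^ (1 + α))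
      = (C / m.factorial * m) * (Real.exp (-s) * s ^ ((m + 1 + α) - 1)) -
        (C / m.factorial) * (Real.exp (-s) * s ^ ((m + 1 + α + 1) - 1)) := by
      intro s hs
      have hs : 0 < s := hs
      have a2 : s ^ ((m + 1 + α + 1) - 1) = s ^ m * s ^ (1 + α) := by
        rw [← Real.rpow_natCast, ← Real.rpow_add hs]; congr 1; ring
      rw [a2]
      rcases m with _ | m
      · simp; ring
      · have a1 : s ^ ((((m + 1 : ℕ) : ℝ) + 1 + α) - 1) = s ^ m * s ^ (1 + α) := by
          rw [← Real.rpow_natCast, ← Real.rpow_add hs]; congr 1; push_cast; ring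
        rw [a1]
        simp only [Nat.add_sub_cancel]
        ring
    have hp : (0:ℝ) < m + 1 + α := by positivity
    rw [setIntegral_congr_fun measurableSet_Ioi e1, integral_sub, integral_const_mul, integral_const_mul,
      ← Real.Gamma_eq_integral hp, ← Real.Gamma_eq_integral (by linarith), Real.Gamma_add_one hp.ne']
    · ring
    · exact (Real.GammaIntegral_convergent hp).const_mul _
    · exact (Real.GammaIntegral_convergent (by linarith)).const_mul _
  have main : Tendsto (fun N : ℕ => ∫ s in Set.Ioi (0:ℝ), phiW m α G N s) atTop
      (𝓝 (- (C * (1 + α) * (Real.Gamma (m + 1 + α) / m.factorial)))) := by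
    rw [← hlim]
    refine tendsto_integral_filter_of_dominated_convergence (fun s => A * K * bdW m α s) ?_ ?_ 
      ((bdW_integrable m α hα).const_mul _) ?_
    · refine Eventually.of_forall fun N => Measurable.aestronglyMeasurable ?_
      unfold phiW
      refine Measurable.indicator ?_ measurableSet_Ioc
      fun_prop
    · filter_upwards [eventually_ge_atTop 2] with N hN
      filter_upwards [ae_restrict_mem measurableSet_Ioi] with s hs
      exact phiW_bound m α G K A hA hK N hN s hs
    · filter_upwards [ae_restrict_mem measurableSet_Ioi] with s hs
      have hs : 0 < s := hs
      have l1 : Tendsto (fun N : ℕ => (1 - s / N) ^ N) atTop (𝓝 (Real.exp (-s))) := by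
        convert Real.tendsto_one_add_div_pow_exp (-s) using 3 with N
        ring
      have hdiv : Tendsto (fun N : ℕ => s / (N:ℝ)) atTop (𝓝 0) := tendsto_const_div_atTop_nhds_zero_nat s
      have l0 : Tendsto (fun N : ℕ => 1 - s / (N:ℝ)) atTop (𝓝 1) := by
        simpa using hdiv.const_sub 1
      have l2 : Tendsto (fun N : ℕ => (1 - s / N) ^ (N - 1)) atTop (𝓝 (Real.exp (-s))) := by
        have := l1.div l0 one_ne_zero
        rw [div_one] at this
        refine this.congr' ?_
        filter_upwards [eventually_gt_atTop 0, l0.eventually (lt_mem_nhds zero_lt_one)] with N hN h0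
        obtain ⟨M, rfl⟩ : ∃ M, N = M + 1 := ⟨N - 1, by omega⟩
        simp only [Nat.add_sub_cancel, Pi.div_apply]
        rw [pow_succ]
        exact mul_div_cancel_right₀ _ h0.ne'
      have l3 : Tendsto (fun N : ℕ => (N:ℝ) ^ (1 + α) * G (s / N)) atTop (𝓝 (C * s ^ (1 + α))) := by
        have hd' : Tendsto (fun N : ℕ => s / (N:ℝ)) atTop (𝓝[>] 0) := by
          refine tendsto_nhdsWithin_iff.2 ⟨hdiv, ?_⟩
          filter_upwards [eventually_gt_atTop 0] with N hN
          have : (0:ℝ) < N := by exact_mod_cast hN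
          exact div_pos hs this
        refine ((hC.comp hd').mul_const (s ^ (1 + α))).congr' ?_
        filter_upwards [eventually_gt_atTop 0] with N hN
        have hN' : (0:ℝ) < N := by exact_mod_cast hN
        simp only [Function.comp]
        rw [Real.div_rpow hs.le hN'.le]
        have : (N:ℝ) ^ (1 + α) ≠ 0 := by positivity
        have : s ^ (1 + α) ≠ 0 := by positivity
        field_simp
      have l4 := ((coefA_tendsto m).mul ((l1.const_mul (m * s ^ (m - 1))).sub (l2.const_mul (s ^ m)))).mul l3
      refine l4.congr' ?_
      filter_upwards [tendsto_natCast_atTop_atTop.eventually (eventually_ge_atTop s)] with N hN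
      have : s ∈ Set.Ioc (0:ℝ) N := ⟨hs, hN⟩
      simp only [phiW, Set.indicator_of_mem this]
  have := main.neg
  rw [neg_neg] at this
  refine this.congr' ?_
  filter_upwards [eventually_gt_atTop 0] with N hN
  rw [mul_neg, scaled m α G N hN]


set_option linter.unusedSectionVars false
section radial
variable {E : Type*} [MeasurableSpace E] [MetricSpace E] [BorelSpace E] [SecondCountableTopology E]

lemma mfun_continuous (μ : Measure E) [IsProbabilityMeasure μ]
    (hsph : ∀ x r, μ (Metric.sphere x r) = 0) (x : E) :
    Continuous (fun r => μ.real (Metric.ball x r)) := by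
  have e : ∀ r, μ.real (Metric.ball x r) = ∫ y, (Metric.ball x r).indicator (fun _ => (1:ℝ)) y ∂μ := by
    intro r
    rw [integral_indicator_const _ measurableSet_ball]; simp
  simp only [e]
  rw [continuous_iff_continuousAt]
  intro r0
  refine continuousAt_of_dominated (bound := fun _ => 1) ?_ ?_ (integrable_const _) ?_
  · exact Eventually.of_forall fun r => (measurable_const.indicator measurableSet_ball).aestronglyMeasurable
  · refine Eventually.of_forall fun r => Eventually.of_forall fun y => ?_
    exact (norm_indicator_le_norm_self _ _).trans (by simp)
  · have : ∀ᵐ y ∂μ, y ∉ Metric.sphere x r0 := measure_eq_zero_iff_ae_notMem.1 (hsph x r0)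
    filter_upwards [this] with y hy
    rw [Metric.mem_sphere] at hy
    rcases lt_or_gt_of_ne hy with h | h
    · refine (continuousAt_const (y := (1:ℝ))).congr ?_
      filter_upwards [lt_mem_nhds h] with r hr
      rw [Set.indicator_of_mem]; exact hr
    · refine (continuousAt_const (y := (0:ℝ))).congr ?_
      filter_upwards [gt_mem_nhds h] with r hr
      rw [Set.indicator_of_notMem]; simpa using hr.le

lemma closedBall_eq_ball (μ : Measure E) [IsProbabilityMeasure μ]
    (hsph : ∀ x r, μ (Metric.sphere x r) = 0) (x : E) (r : ℝ) :
    μ.real (Metric.closedBall x r) = μ.real (Metric.ball x r) := by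
  refine le_antisymm ?_ (measureReal_mono Metric.ball_subset_closedBall)
  rw [← Metric.ball_union_sphere]
  refine (measureReal_union_le _ _).trans ?_
  simp [measureReal_def, hsph]

lemma mfun_mono (μ : Measure E) [IsProbabilityMeasure μ] (x : E) :
    Monotone (fun r => μ.real (Metric.ball x r)) :=
  fun _ _ h => measureReal_mono (Metric.ball_subset_ball h)

lemma exists_rho (μ : Measure E) [IsProbabilityMeasure μ]
    (hsph : ∀ x r, μ (Metric.sphere x r) = 0) (x : E) (D : ℝ)
    (hD : μ.real (Metric.ball x D) = 1) (t : ℝ) (ht0 : 0 < t) (ht1 : t < 1) :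
    ∃ ρ, 0 < ρ ∧ μ.real (Metric.ball x ρ) = t ∧
      {y | μ.real (Metric.ball x (dist y x)) ≤ t} = Metric.closedBall x ρ := by
  have hc := mfun_continuous μ hsph x
  have hm := mfun_mono μ x
  set m := fun r => μ.real (Metric.ball x r) with hmdef
  have hm0 : m 0 = 0 := by simp [m]
  have hmD : m D = 1 := hD
  have hD0 : 0 ≤ D := by
    by_contra h
    have : m D ≤ m 0 := hm (not_le.1 h).le
    linarith
  let S : Set ℝ := {r | m r ≤ t}
  have hSc : IsClosed S := isClosed_le hc continuous_const
  have hSn : S.Nonempty := ⟨0, by simp only [S, Set.mem_ofPred_eq]; linarith⟩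
  have hSb : BddAbove S := by
    refine ⟨D, fun r hr => ?_⟩
    by_contra h
    have : m D ≤ m r := hm (not_le.1 h).le
    have : m r ≤ t := hr
    linarith
  have hρ : sSup S ∈ S := hSc.csSup_mem hSn hSb
  have hρt : m (sSup S) = t := by
    refine le_antisymm hρ ?_
    obtain ⟨r, _, hr⟩ := intermediate_value_Icc hD0 hc.continuousOn
      (show t ∈ Set.Icc (m 0) (m D) from ⟨by linarith, by linarith⟩)
    rw [← hr]
    exact hm (le_csSup hSb (show m r ≤ t from hr.le))
  refine ⟨sSup S, ?_, hρt, ?_⟩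
  · by_contra h
    have : m (sSup S) ≤ m 0 := hm (not_lt.1 h)
    linarith
  · ext y
    simp only [Set.mem_ofPred_eq, Metric.mem_closedBall]
    constructor
    · intro h; exact le_csSup hSb h
    · intro h; exact (hm h).trans hρt.le

lemma f_measurable (μ : Measure E) [IsProbabilityMeasure μ] (x : E) :
    Measurable (fun y => μ.real (Metric.ball x (dist y x))) :=
  (mfun_mono μ x).measurable.comp (measurable_id.dist measurable_const)

lemma G_bound (μ : Measure E) [IsProbabilityMeasure μ]
    (hsph : ∀ x r, μ (Metric.sphere x r) = 0) (x : E) (D c M : ℝ) (hc : 0 < c) (hM : 0 ≤ M)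
    (d : ℕ) (hd : 1 ≤ d)
    (hD : μ.real (Metric.ball x D) = 1)
    (hlow : ∀ r, 0 < r → r ≤ D → c * r ^ d ≤ μ.real (Metric.ball x r))
    (F : E → ℝ) (hFM : ∀ y, |F y| ≤ M * dist y x ^ 2)
    (t : ℝ) (ht : t ∈ Set.Ioc (0:ℝ) 1) :
    |∫ y in {y | μ.real (Metric.ball x (dist y x)) ≤ t}, F y ∂μ|
      ≤ (M * c ^ (-(2 / (d:ℝ)))) * t ^ (1 + 2 / (d:ℝ)) := by
  have hd0 : (0:ℝ) < d := by exact_mod_cast hd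
  set S := {y | μ.real (Metric.ball x (dist y x)) ≤ t} with hS
  have hSm : MeasurableSet S := measurableSet_le (f_measurable μ x) measurable_const
  have hμS : μ.real S ≤ t := by
    rcases lt_or_eq_of_le ht.2 with h | h
    · obtain ⟨ρ, _, h2, h3⟩ := exists_rho μ hsph x D hD t ht.1 h
      rw [hS, h3, closedBall_eq_ball μ hsph, h2]
    · rw [h]; exact measureReal_le_one
  have hDae : ∀ᵐ y ∂μ, y ∈ Metric.ball x D := by
    rw [measureReal_def, ENNReal.toReal_eq_one_iff] at hD
    exact (prob_compl_eq_zero_iff measurableSet_ball).2 hD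
  have hb : ∀ᵐ y ∂(μ.restrict S), ‖F y‖ ≤ M * (t / c) ^ (2 / (d:ℝ)) := by
    filter_upwards [ae_restrict_mem hSm, ae_restrict_of_ae hDae] with y hyS hyD
    refine (hFM y).trans ?_
    gcongr
    rcases (dist_nonneg (x := y) (y := x)).eq_or_lt with h0 | h0
    · rw [← h0]; simp only [ne_eq, OfNat.ofNat_ne_zero, not_false_eq_true, zero_pow]
      have := ht.1; positivity
    · have h1 := hlow _ h0 (Metric.mem_ball.1 hyD).le
      have h2 : dist y x ^ d ≤ t / c := by
        rw [le_div_iff₀ hc, mul_comm]; exact h1.trans hyS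
      calc dist y x ^ 2 = (dist y x ^ d) ^ (2 / (d:ℝ)) := by
            rw [← Real.rpow_natCast, ← Real.rpow_natCast, ← Real.rpow_mul h0.le]
            congr 1; push_cast; field_simp
        _ ≤ _ := by gcongr
  have h1 := norm_setIntegral_le_of_norm_le_const_ae (measure_lt_top μ S) hb
  rw [Real.norm_eq_abs] at h1
  refine h1.trans ?_
  have ht0 := ht.1
  calc _ ≤ M * (t / c) ^ (2 / (d:ℝ)) * t := by gcongr
    _ = _ := by
      rw [Real.div_rpow ht0.le hc.le, Real.rpow_neg hc.le, Real.rpow_add ht0, Real.rpow_one]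
      ring

lemma G_limit (μ : Measure E) [IsProbabilityMeasure μ]
    (hsph : ∀ x r, μ (Metric.sphere x r) = 0) (x : E) (D : ℝ)
    (d : ℕ) (hd : 1 ≤ d)
    (hD : μ.real (Metric.ball x D) = 1)
    (hpos : ∀ r, 0 < r → 0 < μ.real (Metric.ball x r))
    (F : E → ℝ) (A1 A2 : ℝ) (hA1 : 0 < A1)
    (h1 : Tendsto (fun r => μ.real (Metric.closedBall x r) / r ^ d) (𝓝[>] 0) (𝓝 A1))
    (h2 : Tendsto (fun r => (∫ y in Metric.closedBall x r, F y ∂μ) / r ^ (d + 2)) (𝓝[>] 0) (𝓝 A2)) :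
    Tendsto (fun t => (∫ y in {y | μ.real (Metric.ball x (dist y x)) ≤ t}, F y ∂μ) / t ^ (1 + 2 / (d:ℝ)))
      (𝓝[>] 0) (𝓝 (A2 / A1 ^ (1 + 2 / (d:ℝ)))) := by
  have hd0 : (0:ℝ) < d := by exact_mod_cast hd
  have hex : ∀ t : ℝ, ∃ ρ, (0 < t ∧ t < 1) → (0 < ρ ∧ μ.real (Metric.ball x ρ) = t ∧
      {y | μ.real (Metric.ball x (dist y x)) ≤ t} = Metric.closedBall x ρ) := by
    intro t
    by_cases h : 0 < t ∧ t < 1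
    · obtain ⟨ρ, h3⟩ := exists_rho μ hsph x D hD t h.1 h.2
      exact ⟨ρ, fun _ => h3⟩
    · exact ⟨0, fun h' => absurd h' h⟩
  choose ρ hρ using hex
  have hev : ∀ᶠ t in 𝓝[>] (0:ℝ), 0 < t ∧ t < 1 := by
    filter_upwards [Ioo_mem_nhdsGT (zero_lt_one (α := ℝ))] with t ht using ht
  have hρlim : Tendsto ρ (𝓝[>] 0) (𝓝[>] 0) := by
    refine tendsto_nhdsWithin_iff.2 ⟨?_, ?_⟩
    · rw [Metric.tendsto_nhds]
      intro ε hε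
      filter_upwards [hev, Ioo_mem_nhdsGT (hpos ε hε)] with t ht ht2
      obtain ⟨a, b, _⟩ := hρ t ht
      rw [Real.dist_eq, sub_zero, abs_of_pos a]
      by_contra h
      have := mfun_mono μ x (not_lt.1 h)
      simp only at this
      linarith [ht2.2]
    · filter_upwards [hev] with t ht using (hρ t ht).1
  have h3 := (h2.comp hρlim).div ((h1.comp hρlim).rpow_const (p := 1 + 2 / (d:ℝ)) (Or.inl hA1.ne'))
    (by positivity)
  refine h3.congr' ?_
  filter_upwards [hev] with t ht
  obtain ⟨a, b, e⟩ := hρ t ht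
  simp only [Function.comp, Pi.div_apply]
  rw [e, closedBall_eq_ball μ hsph, b, Real.div_rpow ht.1.le (by positivity)]
  have : (ρ t ^ d) ^ (1 + 2 / (d:ℝ)) = ρ t ^ (d + 2) := by
    rw [← Real.rpow_natCast, ← Real.rpow_natCast, ← Real.rpow_mul a.le]
    congr 1; push_cast; field_simp
  rw [this]
  have : ρ t ^ (d + 2) ≠ 0 := by positivity
  field_simp
end radial


lemma vol_closedBall {d : ℕ} (x : EucSp d) (r : ℝ) (hr : 0 ≤ r) :
    (volume : Measure (EucSp d)).real (Metric.closedBall x r)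
      = (volume (Metric.closedBall (0 : EucSp d) 1)).toReal * r ^ d := by
  rw [measureReal_def, Measure.addHaar_closedBall' volume x hr, ENNReal.toReal_mul,
    ENNReal.toReal_ofReal (by positivity), finrank_euclideanSpace_fin, mul_comm]

lemma norm_moment {d : ℕ} (hd : 1 ≤ d) (r : ℝ) (hr : 0 < r) :
    ∫ z in Metric.closedBall (0 : EucSp d) r, ‖z‖ ^ 2
      = d * ((volume (Metric.closedBall (0 : EucSp d) 1)).toReal * r ^ (d + 2) / (d + 2)) := by
  have : Nontrivial (EucSp d) := by
    have : Nonempty (Fin d) := ⟨⟨0, hd⟩⟩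
    infer_instance
  have h1 : ∫ z in Metric.closedBall (0 : EucSp d) r, ‖z‖ ^ 2
      = ∫ z : EucSp d, (Set.Iic r).indicator (fun t : ℝ => t ^ 2) ‖z‖ := by
    rw [← integral_indicator measurableSet_closedBall]
    congr 1
    ext z
    by_cases h : ‖z‖ ≤ r <;> simp [Set.indicator, h]
  rw [h1, integral_fun_norm_addHaar, finrank_euclideanSpace_fin]
  have h2 : ∀ y : ℝ, y ^ (d - 1) • (Set.Iic r).indicator (fun t : ℝ => t ^ 2) y
      = (Set.Iic r).indicator (fun t : ℝ => t ^ (d + 1)) y := by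
    intro y
    by_cases h : y ≤ r
    · simp only [Set.indicator, Set.mem_Iic, h, if_true, smul_eq_mul, ← pow_add]
      congr 1; omega
    · simp [Set.indicator, h]
  simp only [h2]
  rw [setIntegral_indicator measurableSet_Iic, Set.Ioi_inter_Iic, ← intervalIntegral.integral_of_le hr.le,
    integral_pow]
  have h3 : (volume : Measure (EucSp d)).real (Metric.ball 0 1)
      = (volume (Metric.closedBall (0 : EucSp d) 1)).toReal := by
    rw [measureReal_def, Measure.addHaar_closedBall_eq_addHaar_ball]
  rw [h3]
  simp only [smul_eq_mul, nsmul_eq_mul]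
  push_cast
  rw [zero_pow (by omega), sub_zero, show (d:ℝ) + 1 + 1 = d + 2 by ring]
  ring

lemma inner_moment0 {d : ℕ} (hd : 1 ≤ d) (u : EucSp d) (r : ℝ) (hr : 0 < r) :
    ∫ z in Metric.closedBall (0 : EucSp d) r, ⟪u, z⟫ ^ 2
      = ‖u‖ ^ 2 * ((volume (Metric.closedBall (0 : EucSp d) 1)).toReal * r ^ (d + 2) / (d + 2)) := by
  let I : EucSp d → ℝ := fun u => ∫ z in Metric.closedBall (0 : EucSp d) r, ⟪u, z⟫ ^ 2
  have hI : ∀ u v : EucSp d, ‖u‖ = ‖v‖ → I u = I v := by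
    intro u v huv
    let e : EucSp d ≃ₗᵢ[ℝ] EucSp d := (ℝ ∙ (u - v))ᗮ.reflection
    have heu : e u = v := Submodule.reflection_sub huv
    have hpre : e ⁻¹' (Metric.closedBall 0 r) = Metric.closedBall (0 : EucSp d) r := by
      ext z; simp
    have := (e.measurePreserving).setIntegral_preimage_emb e.toHomeomorph.measurableEmbedding
      (fun z => ⟪v, z⟫ ^ 2) (Metric.closedBall 0 r)
    rw [hpre] at this
    simp only [I]
    rw [← this]
    congr 1
    ext z
    rw [← heu, LinearIsometryEquiv.inner_map_map]
  let b : Fin d → EucSp d := fun i => EuclideanSpace.single i 1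
  have hIb : ∀ i, I u = ‖u‖ ^ 2 * I (b i) := by
    intro i
    rw [hI u (‖u‖ • b i) (by simp [b, norm_smul])]
    simp only [I, inner_smul_left, mul_pow]
    rw [integral_const_mul]
    simp
  have hsum : ∑ i, I (b i) = ∫ z in Metric.closedBall (0 : EucSp d) r, ‖z‖ ^ 2 := by
    simp only [I]
    rw [← integral_finsetSum]
    · congr 1
      ext z
      rw [EuclideanSpace.norm_sq_eq]
      simp [b, EuclideanSpace.inner_single_left]
    · intro i _
      exact ContinuousOn.integrableOn_compact (isCompact_closedBall _ _) (by fun_prop)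
  have hd0 : (0:ℝ) < d := by exact_mod_cast hd
  have h1 : (d:ℝ) * I u = ‖u‖ ^ 2 * ∑ i, I (b i) := by
    rw [Finset.mul_sum, ← Finset.sum_congr rfl (fun i _ => hIb i)]
    simp
  rw [hsum, norm_moment hd r hr] at h1
  have h2 : (d:ℝ) * I u = d * (‖u‖ ^ 2 * ((volume (Metric.closedBall (0 : EucSp d) 1)).toReal * r ^ (d + 2) / (d + 2))) := by
    rw [h1]; ring
  exact mul_left_cancel₀ hd0.ne' h2

lemma inner_moment {d : ℕ} (hd : 1 ≤ d) (u x : EucSp d) (r : ℝ) (hr : 0 < r) :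
    ∫ y in Metric.closedBall x r, ⟪u, y - x⟫ ^ 2
      = (‖u‖ ^ 2 * (volume (Metric.closedBall (0 : EucSp d) 1)).toReal / (d + 2)) * r ^ (d + 2) := by
  have hp : (fun y => y - x) ⁻¹' (Metric.closedBall 0 r) = Metric.closedBall x r := by
    ext y; simp [dist_eq_norm]
  have := (measurePreserving_sub_right volume x).setIntegral_preimage_emb
    (MeasurableEquiv.subRight x).measurableEmbedding (fun z => ⟪u, z⟫ ^ 2) (Metric.closedBall 0 r)
  rw [hp] at this
  rw [this, inner_moment0 hd u r hr]
  ring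

lemma dens_limit {d : ℕ} (κ : EucSp d → ℝ) (hκi : Integrable κ) (x : EucSp d)
    (hLeb : Tendsto (fun r => ⨍ y in Metric.closedBall x r, ‖κ y - κ x‖) (𝓝[>] 0) (𝓝 0))
    (q : EucSp d → ℝ) (hq : Continuous q) (Q L : ℝ) (j : ℕ) (hQ : ∀ y, |q y| ≤ Q * dist y x ^ j)
    (hL : ∀ r, 0 < r → ∫ y in Metric.closedBall x r, q y = L * r ^ (d + j)) (hQ0 : 0 ≤ Q) :
    Tendsto (fun r => (∫ y in Metric.closedBall x r, κ y * q y) / r ^ (d + j)) (𝓝[>] 0)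
      (𝓝 (κ x * L)) := by
  set w := (volume (Metric.closedBall (0 : EucSp d) 1)).toReal with hw
  have hb := hLeb.const_mul (Q * w)
  rw [mul_zero] at hb
  rw [tendsto_iff_norm_sub_tendsto_zero]
  refine squeeze_zero' (Eventually.of_forall fun _ => norm_nonneg _) ?_ hb
  filter_upwards [self_mem_nhdsWithin] with r hr
  have hr : 0 < r := hr
  have hw0 : 0 < w := by
    apply ENNReal.toReal_pos
    · exact (Metric.measure_closedBall_pos volume 0 one_pos).ne'
    · exact measure_closedBall_lt_top.ne
  have hfin : IntegrableOn (fun y => ‖κ y - κ x‖) (Metric.closedBall x r) :=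
    ((hκi.integrableOn).sub (integrableOn_const measure_closedBall_lt_top.ne)).norm
  have hqi : IntegrableOn q (Metric.closedBall x r) :=
    hq.continuousOn.integrableOn_compact (isCompact_closedBall _ _)
  have hκq : IntegrableOn (fun y => κ y * q y) (Metric.closedBall x r) :=
    (hκi.integrableOn).mul_continuousOn hq.continuousOn (isCompact_closedBall _ _)
  have e1 : (∫ y in Metric.closedBall x r, κ y * q y) / r ^ (d + j) - κ x * L
      = (∫ y in Metric.closedBall x r, (κ y - κ x) * q y) / r ^ (d + j) := by
    have : ∫ y in Metric.closedBall x r, (κ y - κ x) * q y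
        = (∫ y in Metric.closedBall x r, κ y * q y) - κ x * (L * r ^ (d + j)) := by
      rw [← hL r hr, ← integral_const_mul, ← integral_sub hκq (hqi.const_mul _)]
      congr 1; ext y; ring
    rw [this]
    field_simp
  rw [e1, setAverage_eq, vol_closedBall x r hr.le, ← hw, norm_div, Real.norm_of_nonneg (by positivity : 0 ≤ r ^ (d+j)),
    div_le_iff₀ (by positivity), smul_eq_mul]
  have e2 : ‖∫ y in Metric.closedBall x r, (κ y - κ x) * q y‖
      ≤ ∫ y in Metric.closedBall x r, (Q * r ^ j) * ‖κ y - κ x‖ := by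
    refine norm_integral_le_of_norm_le (hfin.const_mul _) ?_
    filter_upwards [ae_restrict_mem measurableSet_closedBall] with y hy
    rw [norm_mul, mul_comm]
    gcongr
    refine (hQ y).trans ?_
    gcongr
    exact hy
  refine e2.trans (le_of_eq ?_)
  rw [integral_const_mul]
  field_simp
  ring



/-- the weight -/
def wW (N m : ℕ) (t : ℝ) : ℝ :=
  (N + m + 1) * ((N + m).choose m : ℝ) * (t ^ m * (1 - t) ^ N)

lemma wW_deriv (N m : ℕ) (t : ℝ) : HasDerivAt (wW N m) (vW N m t) t := by
  have h1 : HasDerivAt (fun t : ℝ => t ^ m) (m * t ^ (m - 1)) t := hasDerivAt_pow m t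
  have h2 : HasDerivAt (fun t : ℝ => (1 - t) ^ N) (N * (1 - t) ^ (N - 1) * (-1)) t := by
    have := ((hasDerivAt_id' t).const_sub 1).fun_pow N
    exact this
  have h3 := (h1.mul h2).const_mul ((N + m + 1) * ((N + m).choose m : ℝ))
  refine h3.congr_deriv ?_
  unfold vW
  ring

lemma vW_cont (N m : ℕ) : Continuous (vW N m) := by unfold vW; fun_prop

lemma per_x_formula {E : Type*} [MeasurableSpace E] [MetricSpace E] [BorelSpace E]
    [SecondCountableTopology E] (μ : Measure E) [IsProbabilityMeasure μ] (x : E)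
    (F : E → ℝ) (hF : Measurable F) (B : ℝ) (hFB : ∀ z, ‖F z‖ ≤ B) (N m : ℕ) (hN : 1 ≤ N) :
    ∫ y, F y * wW N m (μ.real (Metric.ball x (dist y x))) ∂μ
      = - ∫ t in Set.Ioc (0:ℝ) 1, vW N m t * ∫ y in {y | μ.real (Metric.ball x (dist y x)) ≤ t}, F y ∂μ := by
  refine layer_formula μ (fun y => μ.real (Metric.ball x (dist y x))) F (f_measurable μ x)
    (fun _ => measureReal_nonneg) (fun _ => measureReal_le_one) hF B hFB (wW N m) (vW N m)
    (wW_deriv N m) (vW_cont N m) ?_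
  have : N ≠ 0 := by omega
  simp [wW, this]

lemma per_x_pos {d : ℕ} (κ : EucSp d → ℝ) (hκi : Integrable κ) (x : EucSp d)
    (hLeb : Tendsto (fun r => ⨍ y in Metric.closedBall x r, ‖κ y - κ x‖) (𝓝[>] 0) (𝓝 0))
    (c : ℝ) (hc : 0 < c)
    (hlow : ∀ r : ℝ, 0 < r → r ≤ 1 → c * r ^ d ≤ ∫ y in Metric.closedBall x r, κ y) :
    Tendsto (fun r => (∫ y in Metric.closedBall x r, κ y) / r ^ d) (𝓝[>] 0)
      (𝓝 (κ x * (volume (Metric.closedBall (0 : EucSp d) 1)).toReal)) ∧ 0 < κ x := by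
  have h1 := dens_limit κ hκi x hLeb (fun _ => 1) continuous_const 1
    (volume (Metric.closedBall (0 : EucSp d) 1)).toReal 0 (by simp)
    (fun r hr => by
      rw [setIntegral_const, vol_closedBall x r hr.le]; simp) zero_le_one
  simp only [mul_one, add_zero] at h1
  refine ⟨h1, ?_⟩
  have h2 : c ≤ κ x * (volume (Metric.closedBall (0 : EucSp d) 1)).toReal := by
    refine ge_of_tendsto h1 ?_
    filter_upwards [Ioc_mem_nhdsGT (zero_lt_one (α := ℝ))] with r hr
    rw [le_div_iff₀ (pow_pos hr.1 d)]
    exact hlow r hr.1 hr.2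
  have h3 : 0 ≤ (volume (Metric.closedBall (0 : EucSp d) 1)).toReal := ENNReal.toReal_nonneg
  by_contra h
  nlinarith [not_lt.1 h]

lemma per_x_limit {d : ℕ} (hd : 1 ≤ d) (κ : EucSp d → ℝ) (hκmeas : Measurable κ) (hκnn : ∀ x, 0 ≤ κ x)
    (hκi : Integrable κ) (μ : Measure (EucSp d)) [IsProbabilityMeasure μ]
    (hμ : μ = volume.withDensity fun x => ENNReal.ofReal (κ x))
    (hsph : ∀ x r, μ (Metric.sphere x r) = 0) (x : EucSp d) 
    (hLeb : Tendsto (fun r => ⨍ y in Metric.closedBall x r, ‖κ y - κ x‖) (𝓝[>] 0) (𝓝 0))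
    (c : ℝ) (hc : 0 < c)
    (hlow1 : ∀ r : ℝ, 0 < r → r ≤ 1 → c * r ^ d ≤ ∫ y in Metric.closedBall x r, κ y)
    (D c' M : ℝ) (hc' : 0 < c') (hM : 0 ≤ M)
    (hD : μ.real (Metric.ball x D) = 1)
    (hlow : ∀ r, 0 < r → r ≤ D → c' * r ^ d ≤ μ.real (Metric.ball x r))
    (u : EucSp d) (F : EucSp d → ℝ) (hF : Measurable F) (hF0 : ∀ y, 0 ≤ F y) (B : ℝ) (hFB : ∀ z, ‖F z‖ ≤ B)
    (hFM : ∀ y, |F y| ≤ M * dist y x ^ 2) (hFu : ∀ᵐ y ∂μ, F y = ⟪u, y - x⟫ ^ 2) (m : ℕ) :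
    Tendsto (fun N : ℕ => (N:ℝ) ^ (2 / (d:ℝ)) *
        ∫ y, F y * wW N m (μ.real (Metric.ball x (dist y x))) ∂μ) atTop
      (𝓝 ((d : ℝ)⁻¹ * (volume (Metric.closedBall (0 : EucSp d) 1)).toReal ^ (-2 / (d : ℝ)) *
        (Real.Gamma (m + 1 + 2 / (d : ℝ)) / m.factorial) * (κ x ^ (- (2 / (d:ℝ))) * ‖u‖ ^ 2))) := by
  have hd0 : (0:ℝ) < d := by exact_mod_cast hd
  obtain ⟨hl1, hκx⟩ := per_x_pos κ hκi x hLeb c hc hlow1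
  set w := (volume (Metric.closedBall (0 : EucSp d) 1)).toReal with hw
  have hw0 : 0 < w := by
    apply ENNReal.toReal_pos
    · exact (Metric.measure_closedBall_pos volume 0 one_pos).ne'
    · exact measure_closedBall_lt_top.ne
  have hint : ∀ (s : Set (EucSp d)) (hs : MeasurableSet s) (q : EucSp d → ℝ),
      ∫ y in s, q y ∂μ = ∫ y in s, κ y * q y := by
    intro s hs q
    rw [hμ, setIntegral_withDensity_eq_setIntegral_toReal_smul₀ (by fun_prop)
      (Eventually.of_forall fun _ => ENNReal.ofReal_lt_top) q hs]
    simp [ENNReal.toReal_ofReal (hκnn _)]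
  have h1 : Tendsto (fun r => μ.real (Metric.closedBall x r) / r ^ d) (𝓝[>] 0) (𝓝 (κ x * w)) := by
    refine hl1.congr fun r => ?_
    have := hint (Metric.closedBall x r) measurableSet_closedBall (fun _ => 1)
    simp only [mul_one, setIntegral_const, smul_eq_mul] at this
    rw [this]
  have h2 : Tendsto (fun r => (∫ y in Metric.closedBall x r, F y ∂μ) / r ^ (d + 2)) (𝓝[>] 0)
      (𝓝 (κ x * (‖u‖ ^ 2 * w / (d + 2)))) := by
    have := dens_limit κ hκi x hLeb (fun y => ⟪u, y - x⟫ ^ 2) (by fun_prop) (‖u‖ ^ 2)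
      (‖u‖ ^ 2 * w / (d + 2)) 2 (fun y => by
        rw [abs_of_nonneg (sq_nonneg _), ← mul_pow, ← sq_abs, dist_eq_norm]
        gcongr
        exact abs_real_inner_le_norm _ _) (fun r hr => inner_moment hd u x r hr) (by positivity)
    refine this.congr fun r => ?_
    rw [← hint _ measurableSet_closedBall (fun y => ⟪u, y - x⟫ ^ 2)]
    congr 1
    refine integral_congr_ae ?_
    filter_upwards [ae_restrict_of_ae hFu] with y hy using hy.symm
  have hpos : ∀ r, 0 < r → 0 < μ.real (Metric.ball x r) := by
    intro r hr
    have hD0 : 0 < D := by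
      by_contra h
      rw [Metric.ball_eq_empty.2 (not_lt.1 h)] at hD
      simp at hD
    have h3 : 0 < min r D := lt_min hr hD0
    calc 0 < c' * (min r D) ^ d := by positivity
      _ ≤ μ.real (Metric.ball x (min r D)) := hlow _ h3 (min_le_right _ _)
      _ ≤ _ := measureReal_mono (Metric.ball_subset_ball (min_le_left _ _))
  have hGlim := G_limit μ hsph x D d hd hD hpos F (κ x * w) (κ x * (‖u‖ ^ 2 * w / (d + 2))) (by positivity) h1 h2
  have hGb := G_bound μ hsph x D c' M hc' hM d hd hD hlow F hFM
  have hGm : Measurable (fun t : ℝ => ∫ y in {y | μ.real (Metric.ball x (dist y x)) ≤ t}, F y ∂μ) := by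
    refine Monotone.measurable fun s t hst => ?_
    refine setIntegral_mono_set ?_ (Eventually.of_forall fun y => hF0 y) ?_
    · exact (Integrable.of_bound hF.aestronglyMeasurable B (Eventually.of_forall hFB)).integrableOn
    · exact (show {y | μ.real (Metric.ball x (dist y x)) ≤ s} ⊆ {y | μ.real (Metric.ball x (dist y x)) ≤ t} from
        fun y hy => le_trans (show _ ≤ s from hy) hst).eventuallyLE
  have hfin := asymp m (2 / (d:ℝ)) (by positivity) _ hGm _ _ hGb hGlim
  have hval : κ x * (‖u‖ ^ 2 * w / (d + 2)) / (κ x * w) ^ (1 + 2 / (d:ℝ)) * (1 + 2 / (d:ℝ)) *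
      (Real.Gamma (m + 1 + 2 / (d:ℝ)) / m.factorial) = (d : ℝ)⁻¹ * w ^ (-2 / (d : ℝ)) *
        (Real.Gamma (m + 1 + 2 / (d : ℝ)) / m.factorial) * (κ x ^ (- (2 / (d:ℝ))) * ‖u‖ ^ 2) := by
    rw [Real.rpow_add (by positivity), Real.rpow_one, Real.mul_rpow hκx.le hw0.le, neg_div,
      Real.rpow_neg hκx.le, Real.rpow_neg hw0.le]
    have : (0:ℝ) < κ x ^ (2 / (d:ℝ)) := by positivity
    have : (0:ℝ) < w ^ (2 / (d:ℝ)) := by positivity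
    field_simp
  rw [hval] at hfin
  refine hfin.congr' ?_
  filter_upwards [eventually_ge_atTop 1] with N hN
  rw [per_x_formula μ x F hF B hFB N m hN]



lemma pfun_measurable {E : Type*} [MeasurableSpace E] [MetricSpace E] [BorelSpace E]
    [SecondCountableTopology E] (μ : Measure E) [IsProbabilityMeasure μ] :
    Measurable fun z : E × E => μ.real (Metric.ball z.1 (dist z.2 z.1)) := by
  have hs : MeasurableSet {w : (E × E) × E | dist w.2 w.1.1 < dist w.1.2 w.1.1} :=
    measurableSet_lt (by fun_prop) (by fun_prop)
  exact (measurable_measure_prodMk_left (ν := μ) hs).ennreal_toReal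

lemma wW_measurable (N m : ℕ) : Measurable (wW N m) := by
  unfold wW; fun_prop

/-- The core statement, for a general bounded integrand and the law `μ`. -/
lemma core {d : ℕ} (hd : 1 ≤ d) (Ωs : Set (EucSp d)) (hΩo : IsOpen Ωs)
    (κ : EucSp d → ℝ) (hκmeas : Measurable κ) (hκnn : ∀ x, 0 ≤ κ x)
    (hκi : Integrable κ) (μ : Measure (EucSp d)) [IsProbabilityMeasure μ]
    (hμ : μ = volume.withDensity fun x => ENNReal.ofReal (κ x))
    (hμΩ : ∀ᵐ x ∂μ, x ∈ Ωs)
    (hsph : ∀ x r, μ (Metric.sphere x r) = 0)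
    (c : ℝ) (hc : 0 < c)
    (hlow1 : ∀ x ∈ Ωs, ∀ r : ℝ, 0 < r → r ≤ 1 → c * r ^ d ≤ ∫ y in Metric.closedBall x r, κ y)
    (D c' M : ℝ) (hc' : 0 < c') (hM : 0 ≤ M)
    (hD : ∀ x ∈ Ωs, μ.real (Metric.ball x D) = 1)
    (hlow : ∀ x ∈ Ωs, ∀ r, 0 < r → r ≤ D → c' * r ^ d ≤ μ.real (Metric.ball x r))
    (g : EucSp d → EucSp d) (F : EucSp d × EucSp d → ℝ) (hF : Measurable F)
    (hF0 : ∀ z, 0 ≤ F z) (B : ℝ) (hFB : ∀ z, ‖F z‖ ≤ B)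
    (hFM : ∀ x ∈ Ωs, ∀ y, |F (x, y)| ≤ M * dist y x ^ 2)
    (hFu : ∀ x ∈ Ωs, ∀ y ∈ Ωs, F (x, y) = ⟪g x, y - x⟫ ^ 2) (m : ℕ) :
    Tendsto (fun N : ℕ => (N:ℝ) ^ (2 / (d:ℝ)) *
        ∫ x, ∫ y, F (x, y) * wW N m (μ.real (Metric.ball x (dist y x))) ∂μ ∂μ) atTop
      (𝓝 ((d : ℝ)⁻¹ * (volume (Metric.closedBall (0 : EucSp d) 1)).toReal ^ (-2 / (d : ℝ)) *
        (Real.Gamma (m + 1 + 2 / (d : ℝ)) / m.factorial) *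
        ∫ x in Ωs, κ x ^ (1 - 2 / (d : ℝ)) * ‖g x‖ ^ 2)) := by
  have hd0 : (0:ℝ) < d := by exact_mod_cast hd
  have hLeb : ∀ᵐ x, Tendsto (fun r => ⨍ y in Metric.closedBall x r, ‖κ y - κ x‖) (𝓝[>] 0) (𝓝 0) := by
    filter_upwards [(Besicovitch.vitaliFamily (volume : Measure (EucSp d))).ae_tendsto_average_norm_sub
      hκi.locallyIntegrable] with x hx
    exact hx.comp (Besicovitch.tendsto_filterAt volume x)
  have hac : μ ≪ volume := by rw [hμ]; exact withDensity_absolutelyContinuous _ _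
  have hval : ∫ x in Ωs, κ x ^ (1 - 2 / (d : ℝ)) * ‖g x‖ ^ 2
      = ∫ x, κ x ^ (- (2 / (d:ℝ))) * ‖g x‖ ^ 2 ∂μ := by
    rw [← Measure.restrict_eq_self_of_ae_mem hμΩ, hμ,
      setIntegral_withDensity_eq_setIntegral_toReal_smul₀ (by fun_prop)
      (Eventually.of_forall fun _ => ENNReal.ofReal_lt_top) _ hΩo.measurableSet]
    refine setIntegral_congr_ae hΩo.measurableSet ?_
    filter_upwards [hLeb] with x hx hxΩ
    have hpos := (per_x_pos κ hκi x hx c hc (hlow1 x hxΩ)).2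
    rw [ENNReal.toReal_ofReal (hκnn _), smul_eq_mul, ← mul_assoc, sub_eq_add_neg,
      Real.rpow_add hpos, Real.rpow_one]
  rw [hval, ← integral_const_mul]
  obtain ⟨A, hA⟩ := asymp_bound m (2 / (d:ℝ)) (by positivity)
  have hcongr : ∀ N : ℕ, (N:ℝ) ^ (2 / (d:ℝ)) *
        ∫ x, ∫ y, F (x, y) * wW N m (μ.real (Metric.ball x (dist y x))) ∂μ ∂μ
      = ∫ x, (N:ℝ) ^ (2 / (d:ℝ)) *
        ∫ y, F (x, y) * wW N m (μ.real (Metric.ball x (dist y x))) ∂μ ∂μ := by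
    intro N; rw [integral_const_mul]
  simp_rw [hcongr]
  refine tendsto_integral_filter_of_dominated_convergence
    (fun _ => A * (M * c' ^ (-(2 / (d:ℝ))))) ?_ ?_ (integrable_const _) ?_
  · refine Eventually.of_forall fun N => ?_
    refine AEStronglyMeasurable.const_mul ?_ _
    have h1 : StronglyMeasurable (fun z : EucSp d × EucSp d =>
        F z * wW N m (μ.real (Metric.ball z.1 (dist z.2 z.1)))) :=
      (hF.mul ((wW_measurable N m).comp (pfun_measurable μ))).stronglyMeasurable
    exact h1.integral_prod_right.aestronglyMeasurable
  · filter_upwards [eventually_ge_atTop 2] with N hN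
    filter_upwards [hμΩ] with x hx
    rw [per_x_formula μ x (fun y => F (x, y)) (by fun_prop) B (fun y => hFB _) N m (by omega)]
    exact hA _ _ (G_bound μ hsph x D c' M hc' hM d hd (hD x hx) (hlow x hx)
      (fun y => F (x, y)) (hFM x hx)) N hN
  · filter_upwards [hμΩ, hac.ae_le hLeb] with x hx hL
    exact per_x_limit hd κ hκmeas hκnn hκi μ hμ hsph x hL c hc (hlow1 x hx) D c' M hc' hM (hD x hx)
      (hlow x hx) (g x) (fun y => F (x, y)) (by fun_prop) (fun y => hF0 _) B (fun y => hFB _)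
      (hFM x hx) (by filter_upwards [hμΩ] with y hy using hFu x hx y hy) m

/-- The limit (5.16) in the proof of Theorem 5.2: as `n → ∞`,
`n^{2/d} E[(∇h(X_1)·(X_{j(1,n,k)} − X_1))²] →
d⁻¹ ω_d^{−2/d} (Γ(k + 2/d)/Γ(k)) ∫_Ω κ^{1−2/d} |∇h|²`. -/
theorem stmt10 {d : ℕ} (hd : 1 ≤ d)
    {Ωp : Type*} [MeasureSpace Ωp] [IsProbabilityMeasure (ℙ : Measure Ωp)]
    (Ωs : Set (EucSp d)) (hΩo : IsOpen Ωs) (hΩb : Bornology.IsBounded Ωs)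
    (κ : EucSp d → ℝ) (hκmeas : Measurable κ) (hκnn : ∀ x, 0 ≤ κ x)
    (hκ1 : ∫ x in Ωs, κ x = 1)
    (hκball : ∃ c > 0, ∀ x ∈ Ωs, ∀ r : ℝ, 0 < r → r ≤ 1 →
      c * r ^ d ≤ ∫ y in Metric.closedBall x r, κ y)
    (h : EucSp d → ℝ) (hh : ContDiff ℝ 2 h)
    (hgrad : ∃ M, ∀ x ∈ Ωs, ‖gradient h x‖ ≤ M)
    (X : ℕ → Ωp → EucSp d) (hXmeas : ∀ i, Measurable (X i))
    (hiid : iIndepFun X ℙ)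
    (hlaw : ∀ i, Measure.map (X i) ℙ
      = volume.withDensity fun x => ENNReal.ofReal (κ x))
    (J : ℕ → ℕ → ℕ → Ωp → ℕ) (hJmeas : ∀ i n k, Measurable (J i n k))
    (hJ : IsNNIndex X J) (k : ℕ) (hk : 1 ≤ k) :
    Tendsto (fun n : ℕ =>
        (n : ℝ) ^ (2 / (d : ℝ)) *
          ∫ ω, ⟪gradient h (X 0 ω), X (J 0 n k ω) ω - X 0 ω⟫ ^ 2 ∂ℙ)
      atTop
      (𝓝 ((d : ℝ)⁻¹ *
        (volume (Metric.closedBall (0 : EucSp d) 1)).toReal ^ (-2 / (d : ℝ)) *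
        (Real.Gamma (k + 2 / (d : ℝ)) / Real.Gamma k) *
        ∫ x in Ωs, κ x ^ (1 - 2 / (d : ℝ)) * ‖gradient h x‖ ^ 2)) := by
  have hd0 : (0:ℝ) < d := by exact_mod_cast hd
  have : Nonempty (Fin d) := ⟨⟨0, hd⟩⟩
  obtain ⟨c, hc, hlow1⟩ := hκball
  obtain ⟨M0, hM0⟩ := hgrad
  obtain ⟨μ, hμ⟩ : ∃ μ : Measure (EucSp d), μ = volume.withDensity fun x => ENNReal.ofReal (κ x) :=
    ⟨_, rfl⟩
  rw [← hμ] at hlaw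
  have hprob : IsProbabilityMeasure μ := by
    rw [← hlaw 0]; exact Measure.isProbabilityMeasure_map (hXmeas 0).aemeasurable
  have hac : μ ≪ volume := by rw [hμ]; exact withDensity_absolutelyContinuous _ _
  have hκi : Integrable κ := by
    refine ⟨hκmeas.aestronglyMeasurable, ?_⟩
    rw [hasFiniteIntegral_iff_ofReal (Eventually.of_forall hκnn)]
    have : μ Set.univ = ∫⁻ x, ENNReal.ofReal (κ x) := by
      rw [hμ, withDensity_apply _ MeasurableSet.univ, Measure.restrict_univ]
    rw [← this]
    exact measure_lt_top _ _
  have hreal : ∀ s : Set (EucSp d), MeasurableSet s → μ.real s = ∫ y in s, κ y := by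
    intro s hs
    rw [measureReal_def, hμ, withDensity_apply _ hs,
      integral_eq_lintegral_of_nonneg_ae (Eventually.of_forall hκnn) hκmeas.aestronglyMeasurable]
  have hμ1 : μ.real Ωs = 1 := by rw [hreal _ hΩo.measurableSet, hκ1]
  have hμΩ : ∀ᵐ x ∂μ, x ∈ Ωs := by
    rw [ae_iff]
    have : μ Ωs = 1 := by
      rw [measureReal_def] at hμ1
      exact (ENNReal.toReal_eq_one_iff _).1 hμ1
    exact (prob_compl_eq_zero_iff hΩo.measurableSet).2 this
  have hsph : ∀ x r, μ (Metric.sphere x r) = 0 := fun x r => hac (Measure.addHaar_sphere volume x r)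
  set D : ℝ := Metric.diam Ωs + 1 with hDdef
  have hD1 : 1 ≤ D := by have : 0 ≤ Metric.diam Ωs := Metric.diam_nonneg; linarith
  have hdist : ∀ x ∈ Ωs, ∀ y ∈ Ωs, dist y x < D := fun x hx y hy => by
    have := Metric.dist_le_diam_of_mem hΩb hy hx
    linarith
  have hD : ∀ x ∈ Ωs, μ.real (Metric.ball x D) = 1 := by
    intro x hx
    refine le_antisymm measureReal_le_one ?_
    rw [← hμ1]
    exact measureReal_mono (fun y hy => hdist x hx y hy)
  set c' : ℝ := c / D ^ d with hc'def
  have hc' : 0 < c' := by positivity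
  have hDp : 1 ≤ D ^ d := one_le_pow₀ hD1
  have hlow : ∀ x ∈ Ωs, ∀ r, 0 < r → r ≤ D → c' * r ^ d ≤ μ.real (Metric.ball x r) := by
    intro x hx r hr hrD
    have key : ∀ s : ℝ, 0 < s → s ≤ 1 → c * s ^ d ≤ μ.real (Metric.ball x s) := by
      intro s hs hs1
      rw [← closedBall_eq_ball μ hsph, hreal _ measurableSet_closedBall]
      exact hlow1 x hx s hs hs1
    have hle : c' ≤ c := div_le_self hc.le hDp
    rcases le_or_gt r 1 with h1 | h1
    · refine le_trans ?_ (key r hr h1)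
      gcongr
    · calc c' * r ^ d ≤ c' * D ^ d := by gcongr
        _ = c * 1 ^ d := by rw [hc'def]; field_simp; simp
        _ ≤ μ.real (Metric.ball x 1) := key 1 one_pos le_rfl
        _ ≤ _ := measureReal_mono (Metric.ball_subset_ball h1.le)
  set g : EucSp d → EucSp d := gradient h with hg
  have hgc : Continuous g := by
    have h1 : Continuous (fderiv ℝ h) := hh.continuous_fderiv (by norm_num)
    exact (InnerProductSpace.toDual ℝ (EucSp d)).symm.continuous.comp h1
  let F : EucSp d × EucSp d → ℝ := (Ωs ×ˢ Ωs).indicator (fun z => ⟪g z.1, z.2 - z.1⟫ ^ 2)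
  have hF : Measurable F := by
    refine Measurable.indicator ?_ (hΩo.measurableSet.prod hΩo.measurableSet)
    exact Continuous.measurable (by fun_prop)
  have hF0 : ∀ z, 0 ≤ F z := fun z => Set.indicator_nonneg (fun _ _ => sq_nonneg _) z
  have hFM : ∀ x ∈ Ωs, ∀ y, |F (x, y)| ≤ M0 ^ 2 * dist y x ^ 2 := by
    intro x hx y
    rw [abs_of_nonneg (hF0 _)]
    refine Set.indicator_le' (f := fun z : EucSp d × EucSp d => ⟪g z.1, z.2 - z.1⟫ ^ 2)
      (g := fun z => M0 ^ 2 * dist z.2 z.1 ^ 2) ?_ ?_ (x, y)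
    · rintro ⟨a, b⟩ ⟨ha, hb⟩
      simp only
      rw [← mul_pow, ← sq_abs, dist_eq_norm]
      gcongr
      exact (abs_real_inner_le_norm _ _).trans (by gcongr; exact hM0 a ha)
    · intro z _; positivity
  have hFB : ∀ z, ‖F z‖ ≤ M0 ^ 2 * D ^ 2 := by
    intro z
    by_cases hz : z ∈ Ωs ×ˢ Ωs
    · refine (hFM z.1 hz.1 z.2).trans ?_
      gcongr
      exact (hdist z.1 hz.1 z.2 hz.2).le
    · simp only [F, Set.indicator_of_notMem hz, norm_zero]; positivity
  have hFu : ∀ x ∈ Ωs, ∀ y ∈ Ωs, F (x, y) = ⟪g x, y - x⟫ ^ 2 := by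
    intro x hx y hy
    simp only [F]
    rw [Set.indicator_of_mem (show (x, y) ∈ Ωs ×ˢ Ωs from ⟨hx, hy⟩)]
  obtain ⟨m, rfl⟩ : ∃ m, k = m + 1 := ⟨k - 1, by omega⟩
  have hcore := core hd Ωs hΩo κ hκmeas hκnn hκi μ hμ hμΩ hsph c hc hlow1 D c' (M0 ^ 2) hc'
    (by positivity) hD hlow g F hF hF0 _ hFB hFM hFu m
  have hXΩ : ∀ᵐ ω ∂(ℙ : Measure Ωp), ∀ i, X i ω ∈ Ωs := by
    rw [ae_all_iff]
    intro i
    have := hμΩ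
    rw [← hlaw i] at this
    exact ae_of_ae_map (hXmeas i).aemeasurable this
  have hE : ∀ N : ℕ, ∫ ω, ⟪g (X 0 ω), X (J 0 (N + (m + 2)) (m + 1) ω) ω - X 0 ω⟫ ^ 2 ∂ℙ
      = ∫ x, ∫ y, F (x, y) * wW N m (μ.real (Metric.ball x (dist y x))) ∂μ ∂μ := by
    intro N
    have h1 := nn_formula μ hsph X hXmeas hiid hlaw F hF _ hFB (N + (m + 2)) m
      (J 0 (N + (m + 2)) (m + 1)) (hJ 0 (N + (m + 2)) (m + 1) (by omega) (by omega) (by omega))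
    have h2 : ∫ ω, ⟪g (X 0 ω), X (J 0 (N + (m + 2)) (m + 1) ω) ω - X 0 ω⟫ ^ 2 ∂ℙ
        = ∫ ω, F (X 0 ω, X (J 0 (N + (m + 2)) (m + 1) ω) ω) ∂ℙ := by
      refine integral_congr_ae ?_
      filter_upwards [hXΩ] with ω hω
      rw [hFu _ (hω _) _ (hω _)]
    have e1 : N + (m + 2) - 1 = N + m + 1 := by omega
    have e2 : N + (m + 2) - 2 = N + m := by omega
    have e3 : N + m - m = N := by omega
    rw [h2, h1, e1, e2, e3, ← integral_const_mul]
    congr 1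
    funext x
    rw [← integral_const_mul]
    congr 1
    funext y
    unfold wW
    push_cast
    ring
  rw [← tendsto_add_atTop_iff_nat (m + 2)]
  have hratio : Tendsto (fun N : ℕ => (((N + (m + 2) : ℕ) : ℝ) / N) ^ (2 / (d:ℝ))) atTop (𝓝 1) := by
    have h1 : Tendsto (fun N : ℕ => ((N + (m + 2) : ℕ) : ℝ) / N) atTop (𝓝 1) := by
      have h2 : Tendsto (fun N : ℕ => 1 + ((m + 2 : ℕ) : ℝ) / N) atTop (𝓝 (1 + 0)) :=
        tendsto_const_nhds.add (tendsto_const_div_atTop_nhds_zero_nat _)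
      rw [add_zero] at h2
      refine h2.congr' ?_
      filter_upwards [eventually_gt_atTop 0] with N hN
      have : (N:ℝ) ≠ 0 := by positivity
      push_cast
      field_simp
    have := h1.rpow_const (p := 2 / (d:ℝ)) (Or.inl one_ne_zero)
    simpa using this
  have hfin := hratio.mul hcore
  rw [one_mul] at hfin
  have hG : Real.Gamma ((m + 1 : ℕ) : ℝ) = m.factorial := by
    push_cast; exact Real.Gamma_nat_eq_factorial m
  rw [hG]
  push_cast at hfin ⊢
  refine hfin.congr' ?_
  filter_upwards [eventually_gt_atTop 0] with N hN
  have hN' : (0:ℝ) < N := by exact_mod_cast hN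
  rw [hE N, ← mul_assoc, ← Real.mul_rpow (by positivity) (by positivity)]
  congr 2
  field_simp
end
end
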